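/- (Dehomogenisation at a consecutive minor.) Fix 1≤α≤n, let M_α = [α,α+1,…,α+m−1] be the corresponding consecutive quantum minor of O_q(G(m,n)), and form the localisation O_q(G(m,n))[M_α^{−1}] at the powers of the normal element M_α. For 1≤i≤m and 1≤j≤n−m set x_{ij} := [M_α ∪ {~(j+α+m−1)} ∖ {~(α+m−i)}]·M_α^{−1}, where ~k denotes the residue of k modulo n in {1,…,n}. Then: (1) the subalgebra K[x_{ij}] of O_q(G(m,n))[M_α^{−1}] is isomorphic to the quantum matrix algebra O_q(M_{m,n−m}) via x_{ij} ↦ X_{ij}; (2) there is a K-algebra isomorphism φ_α : O_q(G(m,n))[M_α^{−1}] → K[x_{ij}][y_α^{±1}; σ_α], a skew-Laurent extension where σ_α is the automorphism of K[x_{ij}] determined by σ_α(x_{ij})M_α = M_α x_{ij}, and φ_α(M_α) = y_α. -/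

import Mathlib

open scoped BigOperators

namespace QG

variable (K : Type*) [Field K]

/-- The defining relations of the quantum matrix algebra `O_q(M_{m,n})`. -/
inductive QMatRel (q : K) (m n : ℕ) :
    FreeAlgebra K (Fin m × Fin n) → FreeAlgebra K (Fin m × Fin n) → Prop
  | row : ∀ (i : Fin m) (j l : Fin n), j < l →
      QMatRel q m n (FreeAlgebra.ι K (i, j) * FreeAlgebra.ι K (i, l))
        (q • (FreeAlgebra.ι K (i, l) * FreeAlgebra.ι K (i, j)))
  | col : ∀ (i k : Fin m) (j : Fin n), i < k →
      QMatRel q m n (FreeAlgebra.ι K (i, j) * FreeAlgebra.ι K (k, j))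
        (q • (FreeAlgebra.ι K (k, j) * FreeAlgebra.ι K (i, j)))
  | comm : ∀ (i k : Fin m) (j l : Fin n), k < i → j < l →
      QMatRel q m n (FreeAlgebra.ι K (i, j) * FreeAlgebra.ι K (k, l))
        (FreeAlgebra.ι K (k, l) * FreeAlgebra.ι K (i, j))
  | qrel : ∀ (i k : Fin m) (j l : Fin n), i < k → j < l →
      QMatRel q m n
        (FreeAlgebra.ι K (i, j) * FreeAlgebra.ι K (k, l) -
          FreeAlgebra.ι K (k, l) * FreeAlgebra.ι K (i, j))
        ((q - q⁻¹) • (FreeAlgebra.ι K (i, l) * FreeAlgebra.ι K (k, j)))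

/-- The quantum matrix algebra `O_q(M_{m,n})`. -/
abbrev QMat (q : K) (m n : ℕ) := RingQuot (QMatRel K q m n)

/-- The generator `X_{ij}` of `O_q(M_{m,n})`. -/
noncomputable def X (q : K) {m n : ℕ} (i : Fin m) (j : Fin n) : QMat K q m n :=
  RingQuot.mkAlgHom K (QMatRel K q m n) (FreeAlgebra.ι K (i, j))

/-- The number of inversions (Coxeter length) of a permutation of `Fin t`. -/
def invCount {t : ℕ} (σ : Equiv.Perm (Fin t)) : ℕ :=
  ((Finset.univ : Finset (Fin t × Fin t)).filter fun p => p.1 < p.2 ∧ σ p.2 < σ p.1).card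

/-- The quantum minor `Σ_σ (-q)^{ℓ(σ)} x_{σ(1)1} ⋯ x_{σ(t)t}` of a `t × t`
matrix of elements of a `K`-algebra. -/
noncomputable def qMinor {A : Type*} [Ring A] [Algebra K A] (q : K) (t : ℕ)
    (x : Fin t → Fin t → A) : A :=
  ∑ σ : Equiv.Perm (Fin t), ((-q) ^ invCount σ) • (List.ofFn fun k => x (σ k) k).prod

/-- The maximal (`m × m`) quantum minor `[J]` of `O_q(M_{m,n})`, with column index set `J`
(columns taken in increasing order, rows `1,…,m`).  (Defined to be `0` if `J` does not
have exactly `m` elements.) -/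
noncomputable def grMinor (q : K) (m : ℕ) {n : ℕ} (J : Finset (Fin n)) : QMat K q m n :=
  if h : J.card = m then
    qMinor K q m (fun i k => X K q i (J.orderEmbOfFin h k)) else 0

/-- The set of maximal quantum minors of `O_q(M_{m,n})`. -/
def grGenSet (q : K) (m n : ℕ) : Set (QMat K q m n) :=
  {a | ∃ J : Finset (Fin n), a = grMinor K q m J}

/-- The quantum grassmannian `O_q(G(m,n))`: the subalgebra of `O_q(M_{m,n})`
generated by the maximal quantum minors. -/
noncomputable def qGrass (q : K) (m n : ℕ) : Subalgebra K (QMat K q m n) :=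
  Algebra.adjoin K (grGenSet K q m n)

/-- The maximal quantum minor `[J]` viewed as an element of the quantum grassmannian. -/
noncomputable def grE (q : K) (m : ℕ) {n : ℕ} (J : Finset (Fin n)) : ↥(qGrass K q m n) :=
  ⟨grMinor K q m J, Algebra.subset_adjoin ⟨J, rfl⟩⟩

/-- Reduction of a natural number modulo `n`, landing in `Fin n` (this encodes the
paper's convention that a column index is read modulo `n`; indices here are 0-based). -/
def fmod (n : ℕ) (hn : 0 < n) (k : ℕ) : Fin n := ⟨k % n, Nat.mod_lt k hn⟩

/-- The index set `{α, α+1, …, α+m-1}` (read modulo `n`) of a consecutive quantum minor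
(0-based indices). -/
def consecSet {n : ℕ} (hn : 0 < n) (m : ℕ) (α : ℕ) : Finset (Fin n) :=
  (Finset.range m).image fun k => fmod n hn (α + k)

end QG
namespace QG

variable (K : Type*) [Field K]

/-- Localisation of a `K`-algebra `A` at the powers of a normal element `u`:
an algebra `B` together with an injective map `A → B` inverting `u`, such that every
element of `B` has the form `a·u^{-k}`. -/
structure NormalLoc (A : Type*) [Ring A] [Algebra K A]
    (B : Type*) [Ring B] [Algebra K B] (u : A) where
  emb : A →ₐ[K] B
  inj : Function.Injective emb
  isUnit : IsUnit (emb u)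
  surj : ∀ b : B, ∃ (a : A) (k : ℕ), b = emb a * ↑(isUnit.unit⁻¹ ^ k)

/-- The index set (0-based) of the quantum minor defining the dehomogenisation
generator `x_{ij}` at the consecutive minor starting at `α`:
`M_α ∪ {~(α+m+j)} ∖ {~(α+(m-1-i))}`. -/
def JxSet {n : ℕ} (hn : 0 < n) (m : ℕ) (α : ℕ) (i : Fin m) (j : Fin (n - m)) :
    Finset (Fin n) :=
  insert (fmod n hn (α + m + j)) ((consecSet hn m α).erase (fmod n hn (α + (m - 1 - i))))

/-- The generator `x_{ij} = [M_α ∪ {~(α+m+j)} ∖ {~(α+(m-1-i))}]·M_α^{-1}` of the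
dehomogenisation of the quantum grassmannian at the consecutive minor `M_α`. -/
noncomputable def xElt (q : K) (m n : ℕ) (hn : 0 < n) (α : ℕ)
    {B : Type*} [Ring B] [Algebra K B]
    (L : NormalLoc K (↥(qGrass K q m n)) B (grE K q m (consecSet hn m α)))
    (i : Fin m) (j : Fin (n - m)) : B :=
  L.emb (grE K q m (JxSet hn m α i j)) * ↑(L.isUnit.unit⁻¹)

/-- `B` is a skew-Laurent extension `R[y^{±1};σ]` of the subalgebra `R`, where `σ` is
conjugation by the unit `y`:  `R` is stable under conjugation by `y` and `B` is free as a
left `R`-module with basis the (integer) powers of `y`. -/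
def IsSkewLaurent {B : Type*} [Ring B] [Algebra K B] (R : Subalgebra K B) (y : Bˣ) : Prop :=
  (∀ r ∈ R, (y : B) * r * ((y⁻¹ : Bˣ) : B) ∈ R) ∧
    ∀ b : B, ∃! f : ℤ →₀ ↥R, b = f.sum fun k r => (r : B) * ((y ^ k : Bˣ) : B)

/-- The quantum minor of a matrix of elements with row index set `R` and column index
set `C` (rows and columns taken in increasing order); `0` if the cardinalities differ. -/
noncomputable def finsetMinor {B : Type*} [Ring B] [Algebra K B] (q : K) {m c : ℕ}
    (x : Fin m → Fin c → B) (R : Finset (Fin m)) (C : Finset (Fin c)) : B :=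
  if h : C.card = R.card then
    qMinor K q R.card (fun a b => x (R.orderEmbOfFin rfl a) (C.orderEmbOfFin h b))
  else 0

/-- The row set `(α+m) − (M_α ∖ I_r)` (0-based) of the image of the maximal minor `[I]`
under the dehomogenisation at `M_α`. -/
def rowSetOf {n : ℕ} (hn : 0 < n) (m : ℕ) (α : ℕ) (I : Finset (Fin n)) : Finset (Fin m) :=
  (Finset.univ.filter fun k : Fin m => fmod n hn (α + k) ∉ I).image Fin.rev

/-- The column set `I_c − (α+m−1)` (0-based) of the image of the maximal minor `[I]`
under the dehomogenisation at `M_α`. -/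
def colSetOf {n : ℕ} (hn : 0 < n) (m : ℕ) (α : ℕ) (I : Finset (Fin n)) :
    Finset (Fin (n - m)) :=
  Finset.univ.filter fun d : Fin (n - m) => fmod n hn (α + m + d) ∈ I

/-- The last index (0-based, corresponding to the paper's index `n`). -/
def lastIdx (n : ℕ) (hn : 0 < n) : Fin n := ⟨n - 1, by omega⟩

/-- The 2-cocycle `c((s_1,…,s_n),(t_1,…,t_n)) = ∏_{j ≠ n} p^{s_n t_j}` on `ℤ^n`. -/
noncomputable def cmap {n : ℕ} (hn : 0 < n) (p : K) :
    (Fin n → ℤ) → (Fin n → ℤ) → K := fun s t =>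
  ∏ j ∈ Finset.univ.filter (fun j : Fin n => j ≠ lastIdx n hn),
    p ^ (s (lastIdx n hn) * t j)

/-- The content `ε(j+m) − ε(m+1−i)` of the dehomogenisation generator `x_{ij}`
(0-based: `ε(m+j) − ε(m-1-i)`). -/
def xContent (m n : ℕ) (i : Fin m) (j : Fin (n - m)) : Fin n → ℤ := fun l =>
  (if (l : ℕ) = m + j then 1 else 0) - (if (l : ℕ) = m - 1 - i then 1 else 0)

/-- The content `ε(1) + ⋯ + ε(m)` of `y` (equivalently, of a consecutive minor `M_1`). -/
def yContent (m n : ℕ) : Fin n → ℤ := fun l => if (l : ℕ) < m then 1 else 0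

/-- The content `Σ_{i ∈ I} ε(i)` of a maximal quantum minor `[I]`. -/
def contentOf {n : ℕ} (I : Finset (Fin n)) : Fin n → ℤ := fun l => if l ∈ I then 1 else 0

/-- A realization of the twist `T(A)` of a `ℤ^n`-graded `K`-algebra `A` by a
2-cocycle `c`: a `K`-algebra `T` together with a `K`-linear isomorphism `τ : A ≃ T`
(the twist map `a ↦ a'`) satisfying `a'b' = c(s,t)·(ab)'` on homogeneous elements. -/
structure CocycleTwist {n : ℕ} (A : Type*) [Ring A] [Algebra K A]
    (𝒜 : (Fin n → ℤ) → Submodule K A) (c : (Fin n → ℤ) → (Fin n → ℤ) → K)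
    (T : Type*) [Ring T] [Algebra K T] where
  τ : A ≃ₗ[K] T
  mul_tw : ∀ (s t : Fin n → ℤ) (a b : A), a ∈ 𝒜 s → b ∈ 𝒜 t →
    τ a * τ b = c s t • τ (a * b)

/-- The image of an index set under the cycle `(1 2 … n)` (0-based). -/
def shiftSet {n : ℕ} (hn : 0 < n) (I : Finset (Fin n)) : Finset (Fin n) :=
  I.image fun a : Fin n => fmod n hn (a.val + 1)

end QG

open scoped BigOperators
namespace QG

/-! ### Laplace expansions of quantum minors -/

lemma invCount_eq {t : ℕ} (σ : Equiv.Perm (Fin t)) :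
    invCount σ = ∑ a : Fin t, ∑ b : Fin t, if a < b ∧ σ b < σ a then 1 else 0 := by
  rw [invCount, Finset.card_filter, ← Finset.univ_product_univ, Finset.sum_product]

/-- The permutation with `0 ↦ r` and `k+1 ↦ r.succAbove (τ k)`. -/
noncomputable def permFirst {t : ℕ} (p : Fin (t + 1) × Equiv.Perm (Fin t)) :
    Equiv.Perm (Fin (t + 1)) :=
  Equiv.ofBijective (Fin.cons p.1 (fun k => p.1.succAbove (p.2 k)) : Fin (t+1) → Fin (t+1))
    (by
      rw [← Finite.injective_iff_bijective]
      intro a b h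
      induction a using Fin.cases with
      | zero =>
        induction b using Fin.cases with
        | zero => rfl
        | succ b => simp at h
      | succ a =>
        induction b using Fin.cases with
        | zero => simp at h
        | succ b => simpa using h)

@[simp] lemma permFirst_zero {t : ℕ} (p : Fin (t + 1) × Equiv.Perm (Fin t)) :
    permFirst p 0 = p.1 := rfl
@[simp] lemma permFirst_succ {t : ℕ} (p : Fin (t + 1) × Equiv.Perm (Fin t)) (k : Fin t) :
    permFirst p k.succ = p.1.succAbove (p.2 k) := rfl

lemma permFirst_bij {t : ℕ} : Function.Bijective (permFirst (t := t)) := by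
  rw [Fintype.bijective_iff_injective_and_card]
  constructor
  · rintro ⟨r, τ⟩ ⟨r', τ'⟩ h
    have h0 : r = r' := by simpa using congrArg (fun f => f 0) h
    subst h0
    congr 1
    ext k
    have := congrArg (fun f => f k.succ) h
    simp at this
    rw [this]
  · simp [Fintype.card_perm, Nat.factorial_succ]

lemma sum_succAbove_lt {t : ℕ} (r : Fin (t+1)) (τ : Equiv.Perm (Fin t)) :
    (∑ k : Fin t, if r.succAbove (τ k) < r then 1 else 0) = (r : ℕ) := by
  rw [Equiv.sum_comp τ (fun k => if r.succAbove k < r then 1 else 0)]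
  have : ∀ k : Fin t, (r.succAbove k < r) ↔ ((k : ℕ) < r) := fun k => by
    rw [Fin.succAbove_lt_iff_castSucc_lt]; rfl
  simp only [this]
  rw [Fin.sum_univ_eq_sum_range (fun k => if k < (r:ℕ) then 1 else 0) t, ← Finset.card_filter]
  have : (Finset.range t).filter (fun k => k < (r:ℕ)) = Finset.range r := by
    ext; simp; have := r.2; omega
  simp [this]

lemma sum_lt_succAbove {t : ℕ} (r : Fin (t+1)) (τ : Equiv.Perm (Fin t)) :
    (∑ k : Fin t, if r < r.succAbove (τ k) then 1 else 0) = t - (r : ℕ) := by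
  have h1 := sum_succAbove_lt r τ
  have h2 : (∑ k : Fin t, ((if r < r.succAbove (τ k) then 1 else 0) +
     (if r.succAbove (τ k) < r then 1 else 0))) = t := by
    rw [Finset.sum_congr rfl (g := fun _ => 1)]
    · simp
    · intro k _
      rcases lt_or_gt_of_ne (Fin.succAbove_ne r (τ k)) with h | h
      · simp [h, not_lt.2 h.le]
      · simp [h, not_lt.2 h.le]
  rw [Finset.sum_add_distrib] at h2
  omega

lemma invCount_permFirst {t : ℕ} (p : Fin (t + 1) × Equiv.Perm (Fin t)) :
    invCount (permFirst p) = p.1 + invCount p.2 := by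
  rw [invCount_eq, invCount_eq, Fin.sum_univ_succ]
  congr 1
  · rw [Fin.sum_univ_succ]
    simpa using sum_succAbove_lt p.1 p.2
  · refine Finset.sum_congr rfl fun a _ => ?_
    rw [Fin.sum_univ_succ]
    simp [Fin.succAbove_lt_succAbove_iff]

/-- The permutation with `last ↦ r` and `k ↦ r.succAbove (τ k)`. -/
noncomputable def permLast {t : ℕ} (p : Fin (t + 1) × Equiv.Perm (Fin t)) :
    Equiv.Perm (Fin (t + 1)) :=
  Equiv.ofBijective (Fin.snoc (α := fun _ => Fin (t+1)) (fun k => p.1.succAbove (p.2 k)) p.1)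
    (by
      rw [← Finite.injective_iff_bijective]
      intro a b h
      induction a using Fin.lastCases with
      | last =>
        induction b using Fin.lastCases with
        | last => rfl
        | cast b => simp at h
      | cast a =>
        induction b using Fin.lastCases with
        | last => simp at h
        | cast b => simpa using h)

@[simp] lemma permLast_last {t : ℕ} (p : Fin (t + 1) × Equiv.Perm (Fin t)) :
    permLast p (Fin.last t) = p.1 := by simp [permLast]
@[simp] lemma permLast_castSucc {t : ℕ} (p : Fin (t + 1) × Equiv.Perm (Fin t)) (k : Fin t) :
    permLast p k.castSucc = p.1.succAbove (p.2 k) := by simp [permLast]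

lemma permLast_bij {t : ℕ} : Function.Bijective (permLast (t := t)) := by
  rw [Fintype.bijective_iff_injective_and_card]
  constructor
  · rintro ⟨r, τ⟩ ⟨r', τ'⟩ h
    have h0 : r = r' := by simpa using congrArg (fun f => f (Fin.last t)) h
    subst h0
    congr 1
    ext k
    have := congrArg (fun f => f k.castSucc) h
    simp at this
    rw [this]
  · simp [Fintype.card_perm, Nat.factorial_succ]

lemma invCount_permLast {t : ℕ} (p : Fin (t + 1) × Equiv.Perm (Fin t)) :
    invCount (permLast p) = (t - p.1) + invCount p.2 := by
  rw [invCount_eq, invCount_eq]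
  have h0 : ∀ a : Fin t, ¬ (Fin.last t < a.castSucc) := fun a =>
    not_lt.2 (Fin.le_last _)
  simp only [Fin.sum_univ_castSucc, permLast_castSucc, permLast_last, h0, false_and, if_false,
    lt_self_iff_false, Finset.sum_const_zero, add_zero,
    Fin.castSucc_lt_last, true_and, Fin.castSucc_lt_castSucc_iff, Finset.sum_add_distrib,
    Fin.succAbove_lt_succAbove_iff, sum_lt_succAbove]
  omega

variable {K : Type*} [Field K] {A : Type*} [Ring A] [Algebra K A]

lemma qMinor_zero (q : K) (x : Fin 0 → Fin 0 → A) : qMinor K q 0 x = 1 := by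
  have : invCount (1 : Equiv.Perm (Fin 0)) = 0 := by simp [invCount]
  simp [qMinor, this]

lemma qMinor_first (q : K) (t : ℕ) (x : Fin (t+1) → Fin (t+1) → A) :
    qMinor K q (t+1) x = ∑ r : Fin (t+1), ((-q) ^ (r : ℕ)) •
      (x r 0 * qMinor K q t (fun i k => x (r.succAbove i) k.succ)) := by
  rw [qMinor, ← Equiv.sum_comp (Equiv.ofBijective _ (permFirst_bij (t := t))),
    Fintype.sum_prod_type]
  refine Finset.sum_congr rfl fun r _ => ?_
  rw [qMinor, Finset.mul_sum, Finset.smul_sum]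
  refine Finset.sum_congr rfl fun τ _ => ?_
  rw [Equiv.ofBijective_apply, invCount_permFirst, List.ofFn_succ, List.prod_cons]
  simp only [permFirst_zero, permFirst_succ, mul_smul_comm, smul_smul, pow_add]

lemma qMinor_last (q : K) (t : ℕ) (x : Fin (t+1) → Fin (t+1) → A) :
    qMinor K q (t+1) x = ∑ r : Fin (t+1), ((-q) ^ (t - r : ℕ)) •
      (qMinor K q t (fun i k => x (r.succAbove i) k.castSucc) * x r (Fin.last t)) := by
  rw [qMinor, ← Equiv.sum_comp (Equiv.ofBijective _ (permLast_bij (t := t))),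
    Fintype.sum_prod_type]
  refine Finset.sum_congr rfl fun r _ => ?_
  rw [qMinor, Finset.sum_mul, Finset.smul_sum]
  refine Finset.sum_congr rfl fun τ _ => ?_
  rw [Equiv.ofBijective_apply, invCount_permLast, List.ofFn_succ', List.concat_eq_append,
    List.prod_append]
  simp only [permLast_last, permLast_castSucc, smul_mul_assoc, smul_smul, pow_add,
    List.prod_singleton]

/-! ### Laplace expansions over finsets -/

lemma card_filter_lt_orderEmb {c t : ℕ} (I : Finset (Fin c)) (h : I.card = t) (r : Fin t) :
    (I.filter (fun i => i < I.orderEmbOfFin h r)).card = r := by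
  have : I.filter (fun i => i < I.orderEmbOfFin h r) =
      (Finset.univ.filter (fun s : Fin t => s < r)).map (I.orderEmbOfFin h).toEmbedding := by
    ext i
    simp only [Finset.mem_filter, Finset.mem_map, Finset.mem_univ, true_and]
    constructor
    · rintro ⟨hi, hlt⟩
      have : i ∈ Set.range (I.orderEmbOfFin h) := by simpa using hi
      obtain ⟨s, rfl⟩ := this
      exact ⟨s, by simpa using hlt, rfl⟩
    · rintro ⟨s, hs, rfl⟩
      exact ⟨by simp, by simpa using hs⟩
  rw [this, Finset.card_map]
  convert! Fin.card_Iio r using 2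
  ext; simp

lemma card_filter_gt_orderEmb {c t : ℕ} (I : Finset (Fin c)) (h : I.card = t + 1)
    (r : Fin (t + 1)) :
    (I.filter (fun i => I.orderEmbOfFin h r < i)).card = t - r := by
  have h1 := card_filter_lt_orderEmb I h r
  have h2 : I.filter (fun i => I.orderEmbOfFin h r < i) =
    (I.erase (I.orderEmbOfFin h r)) \ (I.filter (fun i => i < I.orderEmbOfFin h r)) := by
    ext i; simp; constructor
    · rintro ⟨a, b⟩; exact ⟨⟨b.ne', a⟩, fun _ => b.le⟩
    · rintro ⟨⟨a, b⟩, c⟩; exact ⟨b, lt_of_le_of_ne (c b) (Ne.symm a)⟩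
  rw [h2, Finset.card_sdiff_of_subset, Finset.card_erase_of_mem (by simp), h, h1]
  · rfl
  · intro i; simp; intro a b; exact ⟨b.ne, a⟩

lemma orderEmb_erase {c t : ℕ} (I : Finset (Fin c)) (h : I.card = t + 1) (r : Fin (t+1))
    (h' : (I.erase (I.orderEmbOfFin h r)).card = t) (k : Fin t) :
    (I.erase (I.orderEmbOfFin h r)).orderEmbOfFin h' k = I.orderEmbOfFin h (r.succAbove k) := by
  have := Finset.orderEmbOfFin_unique h' (f := fun k => I.orderEmbOfFin h (r.succAbove k))
    (fun k => by simp [Fin.succAbove_ne])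
    ((I.orderEmbOfFin h).strictMono.comp (Fin.strictMono_succAbove r))
  exact (congrFun this k).symm

lemma sum_finset_orderEmb {M : Type*} [AddCommMonoid M] {c t : ℕ} (I : Finset (Fin c))
    (h : I.card = t) (f : Fin c → M) :
    ∑ i ∈ I, f i = ∑ r : Fin t, f (I.orderEmbOfFin h r) := by
  have hI : I = Finset.univ.map (I.orderEmbOfFin h).toEmbedding := by
    ext i
    simp only [Finset.mem_map, Finset.mem_univ, true_and]
    have : i ∈ Set.range (I.orderEmbOfFin h) ↔ i ∈ I := by simp
    rw [← this]; rfl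
  conv_lhs => rw [hI]
  rw [Finset.sum_map]
  rfl

end QG

open scoped BigOperators
namespace QG

/-- A matrix satisfying the quantum matrix relations. -/
structure IsQM {K : Type*} [Field K] {A : Type*} [Ring A] [Algebra K A] (q : K) {a c : ℕ}
    (X : Fin a → Fin c → A) : Prop where
  row : ∀ i j l, j < l → X i j * X i l = q • (X i l * X i j)
  col : ∀ i k j, i < k → X i j * X k j = q • (X k j * X i j)
  comm : ∀ i k j l, k < i → j < l → X i j * X k l = X k l * X i j
  qrel : ∀ i k j l, i < k → j < l →
    X i j * X k l - X k l * X i j = (q - q⁻¹) • (X i l * X k j)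

variable {K : Type*} [Field K] {A : Type*} [Ring A] [Algebra K A]

lemma IsQM.transpose {q : K} {a c : ℕ} {X : Fin a → Fin c → A} (h : IsQM q X) :
    IsQM q (fun j i => X i j) where
  row := fun i j l hjl => h.col j l i hjl
  col := fun i k j hik => h.row j i k hik
  comm := fun i k j l hki hjl => (h.comm l j k i hjl hki).symm
  qrel := fun i k j l hik hjl => by
    rw [h.qrel j l i k hjl hik, h.comm l j i k hjl hik]

lemma sum_pairs {M : Type*} [AddCommMonoid M] {c : ℕ} (I : Finset (Fin c))
    (g : Fin c → Fin c → M) :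
    ∑ r ∈ I, ∑ s ∈ I.erase r, g r s =
      ∑ p ∈ (I ×ˢ I).filter (fun p => p.1 < p.2), (g p.1 p.2 + g p.2 p.1) := by
  have h1 : ∑ r ∈ I, ∑ s ∈ I.erase r, g r s =
      ∑ p ∈ (I ×ˢ I).filter (fun p => p.1 ≠ p.2), g p.1 p.2 := by
    rw [Finset.sum_filter, Finset.sum_product]
    refine Finset.sum_congr rfl fun r _ => ?_
    rw [← Finset.sum_filter]
    refine Finset.sum_congr ?_ fun _ _ => rfl
    ext s; simp; tauto
  have h2 : (I ×ˢ I).filter (fun p => p.1 ≠ p.2) =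
      (I ×ˢ I).filter (fun p => p.1 < p.2) ∪ (I ×ˢ I).filter (fun p => p.2 < p.1) := by
    rw [← Finset.filter_or]
    refine Finset.filter_congr fun p _ => ?_
    exact ne_iff_lt_or_gt
  rw [h1, h2, Finset.sum_union, Finset.sum_add_distrib]
  · congr 1
    refine Finset.sum_bij' (fun p _ => (p.2, p.1)) (fun p _ => (p.2, p.1)) ?_ ?_ ?_ ?_ ?_ <;>
    simp +contextual
  · rw [Finset.disjoint_filter]
    intro p _ h
    exact not_lt.2 h.le

lemma card_erase_lt {c : ℕ} (I : Finset (Fin c)) {r s : Fin c} (hr : r ∈ I) (h : r < s) :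
    (I.filter (fun i => i < s)).card = ((I.erase r).filter (fun i => i < s)).card + 1 := by
  rw [Finset.filter_erase, Finset.card_erase_add_one]
  simp [hr, h]

lemma card_erase_lt' {c : ℕ} (I : Finset (Fin c)) {r s : Fin c} (h : s < r) :
    ((I.erase r).filter (fun i => i < s)).card = (I.filter (fun i => i < s)).card := by
  rw [Finset.filter_erase, Finset.erase_eq_of_notMem]
  simp [h.le]

lemma card_erase_gt {c : ℕ} (I : Finset (Fin c)) {r s : Fin c} (hr : r ∈ I) (h : s < r) :
    (I.filter (fun i => s < i)).card = ((I.erase r).filter (fun i => s < i)).card + 1 := by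
  rw [Finset.filter_erase, Finset.card_erase_add_one]
  simp [hr, h]

lemma card_erase_gt' {c : ℕ} (I : Finset (Fin c)) {r s : Fin c} (h : r < s) :
    ((I.erase r).filter (fun i => s < i)).card = (I.filter (fun i => s < i)).card := by
  rw [Finset.filter_erase, Finset.erase_eq_of_notMem]
  simp [h.le]

/-- Left multiplication by the column vector `v_b` in the quantum exterior algebra. -/
noncomputable def Vop (q : K) {a c : ℕ} (X : Fin a → Fin c → A) (b : Fin c)
    (f : Finset (Fin a) → A) (I : Finset (Fin a)) : A :=
  ∑ r ∈ I, ((-q) ^ (I.filter (fun i => i < r)).card) • (X r b * f (I.erase r))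

/-- Right multiplication by the column vector `v_b` in the quantum exterior algebra. -/
noncomputable def Wop (q : K) {a c : ℕ} (X : Fin a → Fin c → A) (b : Fin c)
    (f : Finset (Fin a) → A) (I : Finset (Fin a)) : A :=
  ∑ r ∈ I, ((-q) ^ (I.filter (fun i => r < i)).card) • (f (I.erase r) * X r b)

lemma Vop_Vop (q : K) {a c : ℕ} (X : Fin a → Fin c → A) (l j : Fin c)
    (f : Finset (Fin a) → A) (I : Finset (Fin a)) :
    Vop q X l (Vop q X j f) I = ∑ p ∈ (I ×ˢ I).filter (fun p => p.1 < p.2),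
      (-q) ^ ((I.filter (fun i => i < p.1)).card + ((I.erase p.1).filter (fun i => i < p.2)).card) •
        ((X p.1 l * X p.2 j - q • (X p.2 l * X p.1 j)) * f ((I.erase p.1).erase p.2)) := by
  simp only [Vop]
  simp only [Finset.mul_sum, Finset.smul_sum]
  rw [sum_pairs]
  refine Finset.sum_congr rfl fun p hp => ?_
  simp only [Finset.mem_filter, Finset.mem_product] at hp
  obtain ⟨⟨h1, h2⟩, h3⟩ := hp
  rw [card_erase_lt' I h3, card_erase_lt I h1 h3, Finset.erase_right_comm (a := p.2)]
  simp only [mul_smul_comm, smul_smul, sub_mul, smul_sub, smul_mul_assoc, mul_assoc, pow_add,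
    pow_one]
  rw [sub_eq_add_neg, ← neg_smul]
  congr 2
  ring

lemma Wop_Wop (q : K) {a c : ℕ} (X : Fin a → Fin c → A) (l j : Fin c)
    (f : Finset (Fin a) → A) (I : Finset (Fin a)) :
    Wop q X l (Wop q X j f) I = ∑ p ∈ (I ×ˢ I).filter (fun p => p.1 < p.2),
      (-q) ^ ((I.filter (fun i => p.2 < i)).card + ((I.erase p.2).filter (fun i => p.1 < i)).card) •
        (f ((I.erase p.1).erase p.2) * (X p.1 j * X p.2 l - q • (X p.2 j * X p.1 l))) := by
  simp only [Wop]
  simp only [Finset.sum_mul, Finset.smul_sum]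
  rw [sum_pairs]
  refine Finset.sum_congr rfl fun p hp => ?_
  simp only [Finset.mem_filter, Finset.mem_product] at hp
  obtain ⟨⟨h1, h2⟩, h3⟩ := hp
  rw [card_erase_gt' I h3, card_erase_gt I h2 h3, Finset.erase_right_comm (a := p.2)]
  simp only [mul_smul_comm, smul_smul, mul_sub, smul_sub, smul_mul_assoc, mul_assoc, pow_add,
    pow_one]
  rw [sub_eq_add_neg, ← neg_smul, add_comm]
  congr 2
  ring

lemma qm_pair {q : K} (hq : q ≠ 0) {a c : ℕ} {X : Fin a → Fin c → A} (h : IsQM q X)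
    {r s : Fin a} {j l : Fin c} (hrs : r < s) (hjl : j < l) :
    X r l * X s j - q • (X s l * X r j) = (-q) • (X r j * X s l - q • (X s j * X r l)) := by
  have h1 := h.qrel r s j l hrs hjl
  have h2 := h.comm s r j l hrs hjl
  have h3 : X s l * X r j = X r j * X s l - (q - q⁻¹) • (X r l * X s j) := by
    rw [← h1]; abel
  rw [h3, h2]
  simp only [smul_sub, smul_smul, sub_smul, mul_sub, neg_mul, neg_smul]
  rw [mul_inv_cancel₀ hq]
  rw [one_smul]
  abel

lemma Vop_self {q : K} {a c : ℕ} {X : Fin a → Fin c → A} (h : IsQM q X) (j : Fin c)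
    (f : Finset (Fin a) → A) : Vop q X j (Vop q X j f) = 0 := by
  funext I
  rw [Vop_Vop]
  refine Finset.sum_eq_zero fun p hp => ?_
  simp only [Finset.mem_filter, Finset.mem_product] at hp
  rw [h.col _ _ j hp.2]; simp

lemma Wop_self {q : K} {a c : ℕ} {X : Fin a → Fin c → A} (h : IsQM q X) (j : Fin c)
    (f : Finset (Fin a) → A) : Wop q X j (Wop q X j f) = 0 := by
  funext I
  rw [Wop_Wop]
  refine Finset.sum_eq_zero fun p hp => ?_
  simp only [Finset.mem_filter, Finset.mem_product] at hp
  rw [h.col _ _ j hp.2]; simp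

lemma Vop_comm {q : K} (hq : q ≠ 0) {a c : ℕ} {X : Fin a → Fin c → A} (h : IsQM q X)
    {j l : Fin c} (hjl : j < l) (f : Finset (Fin a) → A) :
    Vop q X l (Vop q X j f) = (-q) • Vop q X j (Vop q X l f) := by
  funext I
  rw [Pi.smul_apply, Vop_Vop, Vop_Vop, Finset.smul_sum]
  refine Finset.sum_congr rfl fun p hp => ?_
  simp only [Finset.mem_filter, Finset.mem_product] at hp
  rw [qm_pair hq h hp.2 hjl, smul_mul_assoc, smul_comm]

lemma Wop_comm {q : K} (hq : q ≠ 0) {a c : ℕ} {X : Fin a → Fin c → A} (h : IsQM q X)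
    {j l : Fin c} (hjl : j < l) (f : Finset (Fin a) → A) :
    Wop q X j (Wop q X l f) = (-q) • Wop q X l (Wop q X j f) := by
  funext I
  rw [Pi.smul_apply, Wop_Wop, Wop_Wop, Finset.smul_sum]
  refine Finset.sum_congr rfl fun p hp => ?_
  simp only [Finset.mem_filter, Finset.mem_product] at hp
  rw [qm_pair hq h hp.2 hjl, mul_smul_comm, smul_comm]

lemma Vop_smul (q : K) {a c : ℕ} (X : Fin a → Fin c → A) (b : Fin c) (k : K)
    (f : Finset (Fin a) → A) : Vop q X b (k • f) = k • Vop q X b f := by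
  funext I
  simp only [Vop, Pi.smul_apply, Finset.smul_sum, mul_smul_comm]
  exact Finset.sum_congr rfl fun r _ => smul_comm _ _ _

lemma Wop_smul (q : K) {a c : ℕ} (X : Fin a → Fin c → A) (b : Fin c) (k : K)
    (f : Finset (Fin a) → A) : Wop q X b (k • f) = k • Wop q X b f := by
  funext I
  simp only [Wop, Pi.smul_apply, Finset.smul_sum, smul_mul_assoc]
  exact Finset.sum_congr rfl fun r _ => smul_comm _ _ _

/-- Minors with column tuple `d` as functions of the row set. -/
noncomputable def cmin (q : K) {a c : ℕ} (X : Fin a → Fin c → A) {t : ℕ} (d : Fin t → Fin c)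
    (I : Finset (Fin a)) : A :=
  if h : I.card = t then qMinor K q t (fun i k => X (I.orderEmbOfFin h i) (d k)) else 0

lemma cmin_first (q : K) {a c : ℕ} (X : Fin a → Fin c → A) {t : ℕ} (d : Fin (t+1) → Fin c) :
    cmin q X d = Vop q X (d 0) (cmin q X (fun k => d k.succ)) := by
  funext I
  by_cases h : I.card = t + 1
  · rw [cmin, dif_pos h, qMinor_first, Vop, sum_finset_orderEmb I h]
    refine Finset.sum_congr rfl fun r _ => ?_
    have h' : (I.erase (I.orderEmbOfFin h r)).card = t := by
      rw [Finset.card_erase_of_mem (by simp), h]; rfl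
    rw [card_filter_lt_orderEmb, cmin, dif_pos h']
    simp only [orderEmb_erase]
  · rw [cmin, dif_neg h, Vop]
    refine (Finset.sum_eq_zero fun r hr => ?_).symm
    have h' : (I.erase r).card ≠ t := by
      rw [Finset.card_erase_of_mem hr]
      have := Finset.card_pos.2 ⟨r, hr⟩
      omega
    rw [cmin, dif_neg h']; simp

lemma cmin_last (q : K) {a c : ℕ} (X : Fin a → Fin c → A) {t : ℕ} (d : Fin (t+1) → Fin c) :
    cmin q X d = Wop q X (d (Fin.last t)) (cmin q X (fun k => d k.castSucc)) := by
  funext I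
  by_cases h : I.card = t + 1
  · rw [cmin, dif_pos h, qMinor_last, Wop, sum_finset_orderEmb I h]
    refine Finset.sum_congr rfl fun r _ => ?_
    have h' : (I.erase (I.orderEmbOfFin h r)).card = t := by
      rw [Finset.card_erase_of_mem (by simp), h]; rfl
    rw [card_filter_gt_orderEmb, cmin, dif_pos h']
    simp only [orderEmb_erase]
  · rw [cmin, dif_neg h, Wop]
    refine (Finset.sum_eq_zero fun r hr => ?_).symm
    have h' : (I.erase r).card ≠ t := by
      rw [Finset.card_erase_of_mem hr]
      have := Finset.card_pos.2 ⟨r, hr⟩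
      omega
    rw [cmin, dif_neg h']; simp

/-- Minors with column set `J` as functions of the row set. -/
noncomputable def cS (q : K) {a c : ℕ} (X : Fin a → Fin c → A) (J : Finset (Fin c)) :
    Finset (Fin a) → A := cmin q X (fun k => J.orderEmbOfFin rfl k)

lemma cS_eq (q : K) {a c : ℕ} (X : Fin a → Fin c → A) (J : Finset (Fin c)) {t : ℕ}
    (h : J.card = t) : cS q X J = cmin q X (fun k => J.orderEmbOfFin h k) := by
  subst h; rfl

lemma cS_insert_min (q : K) {a c : ℕ} (X : Fin a → Fin c → A) (J : Finset (Fin c)) (b : Fin c)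
    (h : ∀ j ∈ J, b < j) : cS q X (insert b J) = Vop q X b (cS q X J) := by
  have hb : b ∉ J := fun hb => lt_irrefl _ (h b hb)
  have hc : (insert b J).card = J.card + 1 := Finset.card_insert_of_notMem hb
  have key : (fun k => (insert b J).orderEmbOfFin hc k) =
      (Fin.cons b (fun k => J.orderEmbOfFin rfl k) : Fin (J.card + 1) → Fin c) := by
    symm
    apply Finset.orderEmbOfFin_unique
    · intro x
      induction x using Fin.cases with
      | zero => simp
      | succ x => simp
    · intro x y hxy
      induction x using Fin.cases with
      | zero =>
        induction y using Fin.cases with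
        | zero => exact absurd hxy (lt_irrefl _)
        | succ y => simpa using h _ (Finset.orderEmbOfFin_mem _ _ _)
      | succ x =>
        induction y using Fin.cases with
        | zero => exact absurd hxy (by simp)
        | succ y => simpa using hxy
  rw [cS_eq q X _ hc, cmin_first]
  have k0 := congrFun key 0
  have ks : (fun k : Fin J.card => (insert b J).orderEmbOfFin hc k.succ) =
    fun k => J.orderEmbOfFin rfl k := funext fun k => congrFun key (Fin.succ k)
  rw [ks, k0]
  rfl

lemma cS_insert_max (q : K) {a c : ℕ} (X : Fin a → Fin c → A) (J : Finset (Fin c)) (b : Fin c)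
    (h : ∀ j ∈ J, j < b) : cS q X (insert b J) = Wop q X b (cS q X J) := by
  have hb : b ∉ J := fun hb => lt_irrefl _ (h b hb)
  have hc : (insert b J).card = J.card + 1 := Finset.card_insert_of_notMem hb
  have key : (fun k => (insert b J).orderEmbOfFin hc k) =
      (Fin.snoc (fun k => J.orderEmbOfFin rfl k) b : Fin (J.card + 1) → Fin c) := by
    symm
    apply Finset.orderEmbOfFin_unique
    · intro x
      induction x using Fin.lastCases with
      | last => simp
      | cast x => simp
    · intro x y hxy
      induction y using Fin.lastCases with
      | last =>
        induction x using Fin.lastCases with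
        | last => exact absurd hxy (lt_irrefl _)
        | cast x => simpa using h _ (Finset.orderEmbOfFin_mem _ _ _)
      | cast y =>
        induction x using Fin.lastCases with
        | last => exact absurd hxy (not_lt.2 (Fin.le_last _))
        | cast x => simpa using hxy
  rw [cS_eq q X _ hc, cmin_last]
  have k0 := congrFun key (Fin.last _)
  have ks : (fun k : Fin J.card => (insert b J).orderEmbOfFin hc k.castSucc) =
    fun k => J.orderEmbOfFin rfl k := funext fun k => by
      have := congrFun key (Fin.castSucc k)
      simpa using this
  rw [ks, k0]
  simp only [Fin.snoc_last]
  rfl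

lemma Vop_cS_mem {q : K} (hq : q ≠ 0) {a c : ℕ} {X : Fin a → Fin c → A} (h : IsQM q X)
    (b : Fin c) (J : Finset (Fin c)) : b ∈ J → Vop q X b (cS q X J) = 0 := by
  induction J using Finset.induction_on_min with
  | empty => simp
  | insert d J hd ih =>
    intro hb
    rw [cS_insert_min q X J d hd]
    rcases Finset.mem_insert.1 hb with rfl | hb
    · rw [Vop_self h]
    · rw [Vop_comm hq h (hd b hb), ih hb]
      funext I; simp [Vop]

lemma Vop_cS {q : K} (hq : q ≠ 0) {a c : ℕ} {X : Fin a → Fin c → A} (h : IsQM q X)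
    (b : Fin c) (J : Finset (Fin c)) : b ∉ J → Vop q X b (cS q X J) =
      ((-q) ^ (J.filter (fun k => k < b)).card) • cS q X (insert b J) := by
  induction J using Finset.induction_on_min with
  | empty =>
    intro _
    rw [cS_insert_min q X ∅ b (by simp)]; simp
  | insert d J hd ih =>
    intro hb
    have hb1 : b ≠ d := fun h => hb (by simp [h])
    have hb2 : b ∉ J := fun h => hb (by simp [h])
    have hdJ : d ∉ J := fun h => lt_irrefl _ (hd d h)
    rcases lt_or_gt_of_ne hb1 with hlt | hlt
    · rw [← cS_insert_min q X (insert d J) b, Finset.filter_false_of_mem]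
      · simp
      · intro k hk
        rcases Finset.mem_insert.1 hk with rfl | hk
        · exact not_lt.2 hlt.le
        · exact not_lt.2 (hlt.trans (hd k hk)).le
      · intro k hk
        rcases Finset.mem_insert.1 hk with rfl | hk
        · exact hlt
        · exact (hlt.trans (hd k hk))
    · rw [cS_insert_min q X J d hd, Vop_comm hq h hlt, ih hb2, Vop_smul,
        Finset.filter_insert, if_pos hlt, Finset.card_insert_of_notMem (by simp [hdJ]),
        Finset.insert_comm, cS_insert_min q X (insert b J) d, smul_smul, pow_succ, mul_comm]
      intro k hk
      rcases Finset.mem_insert.1 hk with rfl | hk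
      · exact hlt
      · exact hd k hk

lemma Wop_cS_mem {q : K} (hq : q ≠ 0) {a c : ℕ} {X : Fin a → Fin c → A} (h : IsQM q X)
    (b : Fin c) (J : Finset (Fin c)) : b ∈ J → Wop q X b (cS q X J) = 0 := by
  induction J using Finset.induction_on_max with
  | empty => simp
  | insert d J hd ih =>
    intro hb
    rw [cS_insert_max q X J d hd]
    rcases Finset.mem_insert.1 hb with rfl | hb
    · rw [Wop_self h]
    · rw [Wop_comm hq h (hd b hb), ih hb]
      funext I; simp [Wop]

lemma Wop_cS {q : K} (hq : q ≠ 0) {a c : ℕ} {X : Fin a → Fin c → A} (h : IsQM q X)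
    (b : Fin c) (J : Finset (Fin c)) : b ∉ J → Wop q X b (cS q X J) =
      ((-q) ^ (J.filter (fun k => b < k)).card) • cS q X (insert b J) := by
  induction J using Finset.induction_on_max with
  | empty =>
    intro _
    rw [cS_insert_max q X ∅ b (by simp)]; simp
  | insert d J hd ih =>
    intro hb
    have hb1 : b ≠ d := fun h => hb (by simp [h])
    have hb2 : b ∉ J := fun h => hb (by simp [h])
    have hdJ : d ∉ J := fun h => lt_irrefl _ (hd d h)
    rcases lt_or_gt_of_ne hb1 with hlt | hlt
    · rw [cS_insert_max q X J d hd, Wop_comm hq h hlt, ih hb2, Wop_smul,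
        Finset.filter_insert, if_pos hlt, Finset.card_insert_of_notMem (by simp [hdJ]),
        Finset.insert_comm, cS_insert_max q X (insert b J) d, smul_smul, pow_succ, mul_comm]
      intro k hk
      rcases Finset.mem_insert.1 hk with rfl | hk
      · exact hlt
      · exact hd k hk
    · rw [← cS_insert_max q X (insert d J) b, Finset.filter_false_of_mem]
      · simp
      · intro k hk
        rcases Finset.mem_insert.1 hk with rfl | hk
        · exact not_lt.2 hlt.le
        · exact not_lt.2 ((hd k hk).trans hlt).le
      · intro k hk
        rcases Finset.mem_insert.1 hk with rfl | hk
        · exact hlt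
        · exact ((hd k hk).trans hlt)

lemma IsQM.sub {q : K} {a c a' c' : ℕ} {X : Fin a → Fin c → A} (h : IsQM q X)
    {f : Fin a' → Fin a} {g : Fin c' → Fin c} (hf : StrictMono f) (hg : StrictMono g) :
    IsQM q (fun i j => X (f i) (g j)) where
  row := fun i j l hjl => h.row _ _ _ (hg hjl)
  col := fun i k j hik => h.col _ _ _ (hf hik)
  comm := fun i k j l hki hjl => h.comm _ _ _ _ (hf hki) (hg hjl)
  qrel := fun i k j l hik hjl => h.qrel _ _ _ _ (hf hik) (hg hjl)

lemma qMinor_transpose {q : K} (t : ℕ) :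
    (∀ x : Fin t → Fin t → A, IsQM q x → qMinor K q t x = qMinor K q t (fun i j => x j i)) ∧
    (∀ x : Fin (t+1) → Fin (t+1) → A, IsQM q x →
      qMinor K q (t+1) x = qMinor K q (t+1) (fun i j => x j i)) := by
  induction t with
  | zero =>
    refine ⟨fun x _ => by rw [qMinor_zero, qMinor_zero], fun x _ => ?_⟩
    rw [qMinor_first, qMinor_first]
    simp [qMinor_zero]
  | succ t ih =>
    refine ⟨ih.2, fun x hx => ?_⟩
    rw [qMinor_first, qMinor_first, Fin.sum_univ_succ, Fin.sum_univ_succ (n := t + 1)]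
    congr 1
    · rw [ih.2]
      · simp
      · simpa using hx.sub (Fin.strictMono_succ) (Fin.strictMono_succ)
    · have e1 : ∀ r : Fin (t+1), qMinor K q (t+1) (fun i k => x (r.succ.succAbove i) k.succ) =
        ∑ s : Fin (t+1), (-q)^(s:ℕ) • (x 0 s.succ *
          qMinor K q t (fun k i => x (r.succAbove i).succ (s.succAbove k).succ)) := by
        intro r
        rw [ih.2 _ (hx.sub (Fin.strictMono_succAbove _) Fin.strictMono_succ), qMinor_first]
        simp
      have e2 : ∀ s : Fin (t+1), qMinor K q (t+1) (fun i k => x k.succ (s.succ.succAbove i)) =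
        ∑ r : Fin (t+1), (-q)^(r:ℕ) • (x r.succ 0 *
          qMinor K q t (fun k i => x (r.succAbove i).succ (s.succAbove k).succ)) := by
        intro s
        rw [← ih.2 (fun k i => x k.succ (s.succ.succAbove i))
          (hx.sub Fin.strictMono_succ (Fin.strictMono_succAbove _)), qMinor_first]
        refine Finset.sum_congr rfl fun r _ => ?_
        rw [ih.1]
        · simp
        · exact hx.sub (Fin.strictMono_succ.comp (Fin.strictMono_succAbove _))
            ((Fin.strictMono_succAbove _).comp (Fin.strictMono_succ))
      simp only [e1, e2, Finset.mul_sum, Finset.smul_sum]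
      rw [Finset.sum_comm]
      refine Finset.sum_congr rfl fun s _ => Finset.sum_congr rfl fun r _ => ?_
      simp only [mul_smul_comm, smul_smul, ← mul_assoc]
      rw [hx.comm r.succ 0 0 s.succ (Fin.succ_pos _) (Fin.succ_pos _)]
      congr 1
      simp only [Fin.val_succ]
      ring

end QG

open scoped BigOperators
namespace QG

variable {K : Type*} [Field K] {A : Type*} [Ring A] [Algebra K A]

lemma isQM_X (q : K) (m n : ℕ) : IsQM q (fun (i : Fin m) (j : Fin n) => X K q i j) where
  row := fun i j l hjl => by
    have := RingQuot.mkAlgHom_rel K (QMatRel.row (K := K) (q := q) i j l hjl)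
    simpa [X] using this
  col := fun i k j hik => by
    have := RingQuot.mkAlgHom_rel K (QMatRel.col (K := K) (q := q) i k j hik)
    simpa [X] using this
  comm := fun i k j l hki hjl => by
    have := RingQuot.mkAlgHom_rel K (QMatRel.comm (K := K) (q := q) i k j l hki hjl)
    simpa [X] using this
  qrel := fun i k j l hik hjl => by
    have := RingQuot.mkAlgHom_rel K (QMatRel.qrel (K := K) (q := q) i k j l hik hjl)
    simpa [X] using this

/-- The universal property of the quantum matrix algebra. -/
noncomputable def qlift {q : K} {m n : ℕ} {x : Fin m → Fin n → A} (h : IsQM q x) :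
    QMat K q m n →ₐ[K] A :=
  RingQuot.liftAlgHom K ⟨FreeAlgebra.lift K (fun p : Fin m × Fin n => x p.1 p.2), by
    intro a b hab
    induction hab with
    | row i j l hjl => simpa using h.row i j l hjl
    | col i k j hik => simpa using h.col i k j hik
    | comm i k j l hki hjl => simpa using h.comm i k j l hki hjl
    | qrel i k j l hik hjl => simpa using h.qrel i k j l hik hjl⟩

lemma qlift_X {q : K} {m n : ℕ} {x : Fin m → Fin n → A} (h : IsQM q x) (i : Fin m) (j : Fin n) :
    qlift h (X K q i j) = x i j := by
  simp [qlift, X]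

/-- maximal minor of a `q`-matrix -/
noncomputable def gm (q : K) {m n : ℕ} (x : Fin m → Fin n → A) (J : Finset (Fin n)) : A :=
  cS q x J Finset.univ

lemma gm_row {q : K} {m n : ℕ} {x : Fin m → Fin n → A} (h : IsQM q x) (J : Finset (Fin n)) :
    gm q x J = cS q (fun j i => x i j) Finset.univ J := by
  by_cases hJ : J.card = m
  · subst hJ
    have hu : (Finset.univ : Finset (Fin J.card)).card = J.card := by simp
    rw [gm, cS_eq q x J rfl, cS_eq q _ Finset.univ hu, cmin, cmin, dif_pos hu, dif_pos rfl]
    rw [(qMinor_transpose _).1]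
    exact h.sub (OrderEmbedding.strictMono _) (OrderEmbedding.strictMono _)
  · rw [gm, cS_eq q x J rfl, cS, cmin, cmin, dif_neg, dif_neg]
    · simpa using hJ
    · simpa using fun h => hJ h.symm

lemma gm_eq_grMinor (q : K) (m n : ℕ) (J : Finset (Fin n)) :
    gm q (fun (i : Fin m) (j : Fin n) => X K q i j) J = grMinor K q m J := by
  by_cases hJ : J.card = m
  · have hu : (Finset.univ : Finset (Fin m)).card = m := by simp
    rw [gm, cS_eq q _ J hJ, cmin, dif_pos hu, grMinor, dif_pos hJ]
    have : (Finset.univ : Finset (Fin m)).orderEmbOfFin hu =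
      (OrderIso.refl (Fin m)).toOrderEmbedding := by
      symm
      apply Finset.orderEmbOfFin_unique'
      simp
    rw [this]; rfl
  · rw [gm, cS_eq q _ J rfl, cmin, grMinor, dif_neg, dif_neg]
    · exact hJ
    · simpa using fun h => hJ h.symm

lemma plucker {q : K} (hq : q ≠ 0) {m n : ℕ} {x : Fin m → Fin n → A} (h : IsQM q x)
    (L J : Finset (Fin n)) :
    ∑ b ∈ L \ J, (-q) ^ ((L.filter (fun l => b < l)).card + (J.filter (fun k => k < b)).card) •
      (gm q x (L.erase b) * gm q x (insert b J)) = 0 := by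
  have e1 : ∀ b, (if b ∈ J then (0 : A) else
      (-q) ^ ((J.filter (fun k => k < b)).card) • gm q x (insert b J)) =
      Vop q x b (cS q x J) Finset.univ := by
    intro b
    split_ifs with hb
    · rw [Vop_cS_mem hq h b J hb]; rfl
    · rw [Vop_cS hq h b J hb]; rfl
  have e2 : ∑ b ∈ L, (-q) ^ ((L.filter (fun l => b < l)).card) • (gm q x (L.erase b) *
     Vop q x b (cS q x J) Finset.univ) = 0 := by
    have e3 : ∀ r, ∑ b ∈ L, (-q) ^ ((L.filter (fun l => b < l)).card) •
        (gm q x (L.erase b) * x r b) = 0 := by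
      intro r
      have := congrFun (Wop_cS_mem hq h.transpose r Finset.univ (Finset.mem_univ r)) L
      simpa [Wop, gm_row h] using this
    simp only [Vop, Finset.mul_sum, Finset.smul_sum]
    rw [Finset.sum_comm]
    refine Finset.sum_eq_zero fun r _ => ?_
    have := congrArg (fun z => (-q) ^ ((Finset.univ.filter (fun i => i < r)).card) •
      (z * cS q x J (Finset.univ.erase r))) (e3 r)
    simp only [zero_mul, smul_zero, Finset.sum_mul, Finset.smul_sum] at this
    rw [← this]
    refine Finset.sum_congr rfl fun b _ => ?_
    simp only [mul_smul_comm, smul_mul_assoc, mul_assoc]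
    rw [smul_comm]
  rw [← e2, Finset.sdiff_eq_filter, Finset.sum_filter]
  refine Finset.sum_congr rfl fun b _ => ?_
  rw [← e1]
  by_cases hb : b ∈ J
  · simp [hb]
  · simp [hb, pow_add, smul_smul]

lemma plucker' {q : K} (hq : q ≠ 0) {m n : ℕ} {x : Fin m → Fin n → A} (h : IsQM q x)
    (L J : Finset (Fin n)) :
    ∑ b ∈ L \ J, (-q) ^ ((L.filter (fun l => l < b)).card + (J.filter (fun k => b < k)).card) •
      (gm q x (insert b J) * gm q x (L.erase b)) = 0 := by
  have e1 : ∀ b, (if b ∈ J then (0 : A) else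
      (-q) ^ ((J.filter (fun k => b < k)).card) • gm q x (insert b J)) =
      Wop q x b (cS q x J) Finset.univ := by
    intro b
    split_ifs with hb
    · rw [Wop_cS_mem hq h b J hb]; rfl
    · rw [Wop_cS hq h b J hb]; rfl
  have e2 : ∑ b ∈ L, (-q) ^ ((L.filter (fun l => l < b)).card) • (
     Wop q x b (cS q x J) Finset.univ * gm q x (L.erase b)) = 0 := by
    have e3 : ∀ r, ∑ b ∈ L, (-q) ^ ((L.filter (fun l => l < b)).card) •
        (x r b * gm q x (L.erase b)) = 0 := by
      intro r
      have := congrFun (Vop_cS_mem hq h.transpose r Finset.univ (Finset.mem_univ r)) L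
      simpa [Vop, gm_row h] using this
    simp only [Wop, Finset.sum_mul, Finset.smul_sum]
    rw [Finset.sum_comm]
    refine Finset.sum_eq_zero fun r _ => ?_
    have := congrArg (fun z => (-q) ^ ((Finset.univ.filter (fun i => r < i)).card) •
      (cS q x J (Finset.univ.erase r) * z)) (e3 r)
    simp only [mul_zero, smul_zero, Finset.mul_sum, Finset.smul_sum] at this
    rw [← this]
    refine Finset.sum_congr rfl fun b _ => ?_
    simp only [mul_smul_comm, smul_mul_assoc, mul_assoc]
    rw [smul_comm]
  rw [← e2, Finset.sdiff_eq_filter, Finset.sum_filter]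
  refine Finset.sum_congr rfl fun b _ => ?_
  rw [← e1]
  by_cases hb : b ∈ J
  · simp [hb]
  · simp [hb, pow_add, smul_smul]

end QG

open scoped BigOperators
namespace QG

variable {K : Type*} [Field K] {A : Type*} [Ring A] [Algebra K A]

/-- A family indexed by column sets satisfying the quantum Pluecker relations. -/
structure IsPl (q : K) {n : ℕ} (E : Finset (Fin n) → A) : Prop where
  p : ∀ L J : Finset (Fin n), ∑ b ∈ L \ J, (-q) ^ ((L.filter (fun l => b < l)).card +
      (J.filter (fun k => k < b)).card) • (E (L.erase b) * E (insert b J)) = 0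
  p' : ∀ L J : Finset (Fin n), ∑ b ∈ L \ J, (-q) ^ ((L.filter (fun l => l < b)).card +
      (J.filter (fun k => b < k)).card) • (E (insert b J) * E (L.erase b)) = 0

lemma isPl_gm {q : K} (hq : q ≠ 0) {m n : ℕ} {x : Fin m → Fin n → A} (h : IsQM q x) :
    IsPl q (fun J : Finset (Fin n) => gm q x J) :=
  ⟨plucker hq h, plucker' hq h⟩

lemma IsPl.map {q : K} {n : ℕ} {E : Finset (Fin n) → A} (h : IsPl q E) {B : Type*} [Ring B]
    [Algebra K B] (φ : A →ₐ[K] B) : IsPl q (fun J => φ (E J)) := by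
  constructor
  · intro L J
    have := congrArg φ (h.p L J)
    simpa using this
  · intro L J
    have := congrArg φ (h.p' L J)
    simpa using this

lemma IsPl.of_map {q : K} {n : ℕ} {E : Finset (Fin n) → A} {B : Type*} [Ring B]
    [Algebra K B] (φ : A →ₐ[K] B) (hφ : Function.Injective φ) (h : IsPl q (fun J => φ (E J))) :
     IsPl q E := by
  constructor
  · intro L J
    apply hφ
    simpa using h.p L J
  · intro L J
    apply hφ
    simpa using h.p' L J

lemma isPl_grE {q : K} (hq : q ≠ 0) (m n : ℕ) : IsPl q (fun J : Finset (Fin n) => grE K q m J) := by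
  refine IsPl.of_map (qGrass K q m n).val Subtype.val_injective ?_
  have := isPl_gm hq (isQM_X q m n)
  simp only [gm_eq_grMinor] at this
  exact this

lemma card_split {n : ℕ} (S : Finset (Fin n)) (b : Fin n) (hb : b ∉ S) :
    (S.filter (fun l => b < l)).card + (S.filter (fun l => l < b)).card = S.card := by
  rw [← Finset.card_union_of_disjoint, ← Finset.filter_or, Finset.filter_true_of_mem]
  · intro l hl
    rcases lt_trichotomy l b with h | h | h
    · exact Or.inr h
    · exact absurd (h ▸ hl) hb
    · exact Or.inl h
  · rw [Finset.disjoint_filter]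
    intro l _ h
    exact not_lt.2 h.le

lemma IsPl.pS {q : K} (hq : q ≠ 0) {n : ℕ} {E : Finset (Fin n) → A} (h : IsPl q E)
    (S T F : Finset (Fin n)) (hT : Disjoint S T) (hF : Disjoint S F) :
    ∑ b ∈ T \ F, (-q) ^ ((T.filter (fun l => b < l)).card +
      (F.filter (fun k => k < b)).card) • (E (T.erase b ∪ S) * E (insert b F ∪ S)) = 0 := by
  have h1 := h.p (S ∪ T) (S ∪ F)
  have h2 : (S ∪ T) \ (S ∪ F) = T \ F := by
    ext z
    have : z ∈ S → z ∉ T := fun hz => Finset.disjoint_left.1 hT hz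
    simp; tauto
  rw [h2] at h1
  have hne : (-q) ^ S.card ≠ 0 := pow_ne_zero _ (neg_ne_zero.2 hq)
  have h3 : (-q) ^ S.card • (∑ b ∈ T \ F, (-q) ^ ((T.filter (fun l => b < l)).card +
      (F.filter (fun k => k < b)).card) • (E (T.erase b ∪ S) * E (insert b F ∪ S))) = 0 := by
    rw [← h1, Finset.smul_sum]
    refine Finset.sum_congr rfl fun b hb => ?_
    have hbT : b ∈ T := (Finset.mem_sdiff.1 hb).1
    have hbS : b ∉ S := fun h => Finset.disjoint_left.1 hT h hbT
    rw [smul_smul, ← pow_add]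
    have a1 : (S ∪ T).erase b = T.erase b ∪ S := by
      ext z; simp
      have : z ∈ S → z ≠ b := fun h1 h2 => hbS (h2 ▸ h1)
      tauto
    have a2 : insert b (S ∪ F) = insert b F ∪ S := by
      ext z; simp; tauto
    rw [a1, a2, Finset.filter_union, Finset.filter_union, Finset.card_union_of_disjoint,
      Finset.card_union_of_disjoint]
    · congr 2
      have := card_split S b hbS
      omega
    · exact Finset.disjoint_filter_filter hF
    · exact Finset.disjoint_filter_filter hT
  exact (smul_eq_zero.1 h3).resolve_left hne

lemma IsPl.pS' {q : K} (hq : q ≠ 0) {n : ℕ} {E : Finset (Fin n) → A} (h : IsPl q E)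
    (S T F : Finset (Fin n)) (hT : Disjoint S T) (hF : Disjoint S F) :
    ∑ b ∈ T \ F, (-q) ^ ((T.filter (fun l => l < b)).card +
      (F.filter (fun k => b < k)).card) • (E (insert b F ∪ S) * E (T.erase b ∪ S)) = 0 := by
  have h1 := h.p' (S ∪ T) (S ∪ F)
  have h2 : (S ∪ T) \ (S ∪ F) = T \ F := by
    ext z
    have : z ∈ S → z ∉ T := fun hz => Finset.disjoint_left.1 hT hz
    simp; tauto
  rw [h2] at h1
  have hne : (-q) ^ S.card ≠ 0 := pow_ne_zero _ (neg_ne_zero.2 hq)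
  have h3 : (-q) ^ S.card • (∑ b ∈ T \ F, (-q) ^ ((T.filter (fun l => l < b)).card +
      (F.filter (fun k => b < k)).card) • (E (insert b F ∪ S) * E (T.erase b ∪ S))) = 0 := by
    rw [← h1, Finset.smul_sum]
    refine Finset.sum_congr rfl fun b hb => ?_
    have hbT : b ∈ T := (Finset.mem_sdiff.1 hb).1
    have hbS : b ∉ S := fun h => Finset.disjoint_left.1 hT h hbT
    rw [smul_smul, ← pow_add]
    have a1 : (S ∪ T).erase b = T.erase b ∪ S := by
      ext z; simp
      have : z ∈ S → z ≠ b := fun h1 h2 => hbS (h2 ▸ h1)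
      tauto
    have a2 : insert b (S ∪ F) = insert b F ∪ S := by
      ext z; simp; tauto
    rw [a1, a2, Finset.filter_union, Finset.filter_union, Finset.card_union_of_disjoint,
      Finset.card_union_of_disjoint]
    · congr 2
      have := card_split S b hbS
      omega
    · exact Finset.disjoint_filter_filter hF
    · exact Finset.disjoint_filter_filter hT
  exact (smul_eq_zero.1 h3).resolve_left hne

lemma IsPl.two {q : K} (hq : q ≠ 0) {n : ℕ} {E : Finset (Fin n) → A} (h : IsPl q E)
    (S : Finset (Fin n)) {a b : Fin n} (hab : a < b) (ha : a ∉ S) (hb : b ∉ S) :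
    E (insert a S) * E (insert b S) = q • (E (insert b S) * E (insert a S)) := by
  have h1 := h.pS hq S {a, b} ∅ (by simp [ha, hb]) (by simp)
  have hne := hab.ne
  have e1 : ({a, b} : Finset (Fin n)).erase a = {b} := by
    ext z; simp; grind
  have e2 : ({a, b} : Finset (Fin n)).erase b = {a} := by
    ext z; simp; grind
  have f1 : ({a, b} : Finset (Fin n)).filter (fun l => a < l) = {b} := by
    ext z; simp; grind
  have f2 : ({a, b} : Finset (Fin n)).filter (fun l => b < l) = ∅ := by
    ext z; simp; grind
  rw [Finset.sdiff_empty, Finset.sum_pair hne, e1, e2, f1, f2] at h1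
  simp at h1
  rw [add_comm, ← sub_eq_add_neg, sub_eq_zero] at h1
  exact h1

lemma IsPl.three {q : K} (hq : q ≠ 0) {n : ℕ} {E : Finset (Fin n) → A} (h : IsPl q E)
    (S : Finset (Fin n)) {t1 t2 t3 e : Fin n} (h12 : t1 < t2) (h23 : t2 < t3)
    (e1 : e ≠ t1) (e2 : e ≠ t2) (e3 : e ≠ t3) (s1 : t1 ∉ S) (s2 : t2 ∉ S) (s3 : t3 ∉ S)
    (se : e ∉ S) :
    (-q) ^ (2 + if e < t1 then 1 else 0) • (E (insert t2 (insert t3 S)) * E (insert e (insert t1 S)))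
    + (-q) ^ (1 + if e < t2 then 1 else 0) •
      (E (insert t1 (insert t3 S)) * E (insert e (insert t2 S)))
    + (-q) ^ (if e < t3 then 1 else 0) • (E (insert t1 (insert t2 S)) * E (insert e (insert t3 S)))
     = 0 := by
  have h1 := h.pS hq S {t1, t2, t3} {e} (by simp [s1, s2, s3]) (by simp [se])
  have hd : ({t1, t2, t3} : Finset (Fin n)) \ {e} = {t1, t2, t3} := by
    ext z; simp; grind
  have d1 : ({t1, t2, t3} : Finset (Fin n)).erase t1 ∪ S = insert t2 (insert t3 S) := by
    ext z; simp; grind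
  have d2 : ({t1, t2, t3} : Finset (Fin n)).erase t2 ∪ S = insert t1 (insert t3 S) := by
    ext z; simp; grind
  have d3 : ({t1, t2, t3} : Finset (Fin n)).erase t3 ∪ S = insert t1 (insert t2 S) := by
    ext z; simp; grind
  have f1 : ({t1, t2, t3} : Finset (Fin n)).filter (fun l => t1 < l) = {t2, t3} := by
    ext z; simp; grind
  have f2 : ({t1, t2, t3} : Finset (Fin n)).filter (fun l => t2 < l) = {t3} := by
    ext z; simp; grind
  have f3 : ({t1, t2, t3} : Finset (Fin n)).filter (fun l => t3 < l) = ∅ := by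
    ext z; simp; grind
  have g : ∀ t, (({e} : Finset (Fin n)).filter (fun k => k < t)).card = if e < t then 1 else 0 := by
    intro t; rw [Finset.filter_singleton]; split_ifs <;> simp
  have i : ∀ t, insert t {e} ∪ S = insert e (insert t S) := by
    intro t; ext z; simp; tauto
  have hn1 : t1 ∉ ({t2, t3} : Finset (Fin n)) := by simp; grind
  have hn2 : t2 ≠ t3 := h23.ne
  rw [hd, Finset.sum_insert hn1, Finset.sum_pair hn2, d1, d2, d3, f1, f2, f3, g, g, g, i, i, i,
    Finset.card_pair hn2, Finset.card_singleton, Finset.card_empty, zero_add, ← add_assoc] at h1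
  exact h1

lemma IsPl.three' {q : K} (hq : q ≠ 0) {n : ℕ} {E : Finset (Fin n) → A} (h : IsPl q E)
    (S : Finset (Fin n)) {t1 t2 t3 e : Fin n} (h12 : t1 < t2) (h23 : t2 < t3)
    (e1 : e < t1) (s1 : t1 ∉ S) (s2 : t2 ∉ S) (s3 : t3 ∉ S) (se : e ∉ S) :
    (E (insert e (insert t1 S)) * E (insert t2 (insert t3 S)))
    + (-q) • (E (insert e (insert t2 S)) * E (insert t1 (insert t3 S)))
    + (-q) ^ 2 • (E (insert e (insert t3 S)) * E (insert t1 (insert t2 S))) = 0 := by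
  have h1 := h.pS' hq S {t1, t2, t3} {e} (by simp [s1, s2, s3]) (by simp [se])
  have hd : ({t1, t2, t3} : Finset (Fin n)) \ {e} = {t1, t2, t3} := by
    ext z; simp; grind
  have d1 : ({t1, t2, t3} : Finset (Fin n)).erase t1 ∪ S = insert t2 (insert t3 S) := by
    ext z; simp; grind
  have d2 : ({t1, t2, t3} : Finset (Fin n)).erase t2 ∪ S = insert t1 (insert t3 S) := by
    ext z; simp; grind
  have d3 : ({t1, t2, t3} : Finset (Fin n)).erase t3 ∪ S = insert t1 (insert t2 S) := by
    ext z; simp; grind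
  have f1 : ({t1, t2, t3} : Finset (Fin n)).filter (fun l => l < t1) = ∅ := by
    ext z; simp; grind
  have f2 : ({t1, t2, t3} : Finset (Fin n)).filter (fun l => l < t2) = {t1} := by
    ext z; simp; grind
  have f3 : ({t1, t2, t3} : Finset (Fin n)).filter (fun l => l < t3) = {t1, t2} := by
    ext z; simp; grind
  have g : ∀ t, e < t → (({e} : Finset (Fin n)).filter (fun k => t < k)).card = 0 := by
    intro t ht; rw [Finset.filter_singleton, if_neg ht.not_gt]; simp
  have i : ∀ t, insert t {e} ∪ S = insert e (insert t S) := by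
    intro t; ext z; simp; tauto
  have hn1 : t1 ∉ ({t2, t3} : Finset (Fin n)) := by simp; grind
  have hn2 : t2 ≠ t3 := h23.ne
  rw [hd, Finset.sum_insert hn1, Finset.sum_pair hn2, d1, d2, d3, f1, f2, f3, g _ e1,
    g _ (e1.trans h12), g _ (e1.trans (h12.trans h23)), i, i, i,
    Finset.card_pair h12.ne, Finset.card_singleton, Finset.card_empty, ← add_assoc] at h1
  simpa using h1

/-- The six products of `2 × 2` type. -/
lemma IsPl.four {q : K} (hq : q ≠ 0) {n : ℕ} {E : Finset (Fin n) → A} (h : IsPl q E)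
    (S : Finset (Fin n)) {e1 e2 e3 e4 : Fin n} (h12 : e1 < e2) (h23 : e2 < e3) (h34 : e3 < e4)
    (s1 : e1 ∉ S) (s2 : e2 ∉ S) (s3 : e3 ∉ S) (s4 : e4 ∉ S) :
    let g := fun a b => E (insert a (insert b S))
    (g e1 e4 * g e2 e3 = q • (g e2 e4 * g e1 e3) - q ^ 2 • (g e3 e4 * g e1 e2)) ∧
    (g e2 e3 * g e1 e4 = q • (g e2 e4 * g e1 e3) - q ^ 2 • (g e3 e4 * g e1 e2)) ∧
    (g e1 e3 * g e2 e4 = q • (g e3 e4 * g e1 e2) + q ^ 2 • (g e2 e4 * g e1 e3)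
      - q ^ 3 • (g e3 e4 * g e1 e2)) ∧
    (g e1 e2 * g e3 e4 = q ^ 2 • (g e3 e4 * g e1 e2)) := by
  intro g
  have g_symm : ∀ a b, g a b = g b a := fun a b => by
    simp only [g, Finset.insert_comm]
  have p1 := h.three hq S h23 h34 h12.ne (h12.trans h23).ne (h12.trans (h23.trans h34)).ne
    s2 s3 s4 s1
  have p2 := h.three hq S (h12.trans h23) h34 h12.ne' h23.ne (h23.trans h34).ne s1 s3 s4 s2
  have p3 := h.three hq S h12 (h23.trans h34) (h12.trans h23).ne' h23.ne' h34.ne s1 s2 s4 s3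
  have p4 := h.three' hq S h23 h34 h12 s2 s3 s4 s1
  rw [if_pos h12, if_pos (h12.trans h23), if_pos (h12.trans (h23.trans h34))] at p1
  rw [if_neg h12.not_gt, if_pos h23, if_pos (h23.trans h34)] at p2
  rw [if_neg (h12.trans h23).not_gt, if_neg h23.not_gt, if_pos h34] at p3
  change _ • (g e3 e4 * g e1 e2) + _ • (g e2 e4 * g e1 e3) + _ • (g e2 e3 * g e1 e4) = 0 at p1
  change _ • (g e3 e4 * g e2 e1) + _ • (g e1 e4 * g e2 e3) + _ • (g e1 e3 * g e2 e4) = 0 at p2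
  change _ • (g e2 e4 * g e3 e1) + _ • (g e1 e4 * g e3 e2) + _ • (g e1 e2 * g e3 e4) = 0 at p3
  change g e1 e2 * g e3 e4 + _ • (g e1 e3 * g e2 e4) + _ • (g e1 e4 * g e2 e3) = 0 at p4
  rw [g_symm e2 e1] at p2
  rw [g_symm e3 e1, g_symm e3 e2] at p3
  generalize g e3 e4 * g e1 e2 = a at *
  generalize g e1 e2 * g e3 e4 = b at *
  generalize g e2 e4 * g e1 e3 = c at *
  generalize g e1 e3 * g e2 e4 = d at *
  generalize g e2 e3 * g e1 e4 = e at *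
  generalize g e1 e4 * g e2 e3 = f at *
  have hE : e = q • c - q ^ 2 • a := by
    have : (-q) • e = (-q) • (q • c - q ^ 2 • a) := by
      linear_combination (norm := module) p1
    exact smul_right_injective _ (neg_ne_zero.2 hq) this
  have hD : d = q • a + q • f := by
    have : (-q) • d = (-q) • (q • a + q • f) := by
      linear_combination (norm := module) p2
    exact smul_right_injective _ (neg_ne_zero.2 hq) this
  have hB : b = q • c - f := by
    have : (-q) • b = (-q) • (q • c - f) := by
      linear_combination (norm := module) p3
    exact smul_right_injective _ (neg_ne_zero.2 hq) this
  have hF : f = q • c - q ^ 2 • a := by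
    rw [hB, hD] at p4
    linear_combination (norm := module) (-1 : K) • p4
  refine ⟨hF, hE, ?_, ?_⟩
  · rw [hD, hF]; module
  · rw [hB, hF]; module

end QG

open scoped BigOperators
namespace QG

variable {K : Type*} [Field K] {A : Type*} [Ring A] [Algebra K A]

/-- The scalar by which conjugation with `M` acts. -/
noncomputable def eps (q : K) {n : ℕ} (b c : Fin n) : K := if b < c then q else q⁻¹

lemma eps_ne {q : K} (hq : q ≠ 0) {n : ℕ} (b c : Fin n) : eps q b c ≠ 0 := by
  unfold eps; split_ifs
  · exact hq
  · exact inv_ne_zero hq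

/-- swapped index set -/
def Jb {n : ℕ} (M : Finset (Fin n)) (b c : Fin n) : Finset (Fin n) := insert c (M.erase b)

/-- dehomogenised generator -/
def xb {n : ℕ} (E : Finset (Fin n) → A) (M : Finset (Fin n)) (y : Aˣ) (b c : Fin n) : A :=
  E (Jb M b c) * ((y⁻¹ : Aˣ) : A)

lemma IsPl.y_J {q : K} (hq : q ≠ 0) {n : ℕ} {E : Finset (Fin n) → A} (h : IsPl q E)
    {M : Finset (Fin n)} {b c : Fin n} (hb : b ∈ M) (hc : c ∉ M) :
    E M * E (Jb M b c) = eps q b c • (E (Jb M b c) * E M) := by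
  have hbc : b ≠ c := fun h => hc (h ▸ hb)
  have h1 : M = insert b (M.erase b) := (Finset.insert_erase hb).symm
  have hb' : b ∉ M.erase b := by simp
  have hc' : c ∉ M.erase b := by simp [hc]
  unfold eps
  split_ifs with hlt
  · have := h.two hq _ hlt hb' hc'
    rw [← h1] at this
    exact this
  · have := h.two hq _ (lt_of_le_of_ne (not_lt.1 hlt) hbc.symm) hc' hb'
    rw [← h1] at this
    rw [Jb, this, smul_smul, inv_mul_cancel₀ hq, one_smul]

lemma IsPl.yinv_J {q : K} (hq : q ≠ 0) {n : ℕ} {E : Finset (Fin n) → A} (h : IsPl q E)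
    {M : Finset (Fin n)} {y : Aˣ} (hy : (y : A) = E M) {b c : Fin n} (hb : b ∈ M) (hc : c ∉ M) :
    ((y⁻¹ : Aˣ) : A) * E (Jb M b c) = (eps q b c)⁻¹ • (E (Jb M b c) * ((y⁻¹ : Aˣ) : A)) := by
  have h1 := h.y_J hq hb hc
  rw [← hy] at h1
  have h2 : E (Jb M b c) * (y : A) = (eps q b c)⁻¹ • ((y : A) * E (Jb M b c)) := by
    rw [h1, smul_smul, inv_mul_cancel₀ (eps_ne hq b c), one_smul]
  calc _ = ((y⁻¹ : Aˣ) : A) * (E (Jb M b c) * (y : A)) * ((y⁻¹ : Aˣ) : A) := by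
        simp [mul_assoc]
    _ = _ := by
        rw [h2]
        simp [← mul_assoc]

lemma IsPl.y_xb {q : K} (hq : q ≠ 0) {n : ℕ} {E : Finset (Fin n) → A} (h : IsPl q E)
    {M : Finset (Fin n)} {y : Aˣ} (hy : (y : A) = E M) {b c : Fin n} (hb : b ∈ M) (hc : c ∉ M) :
    (y : A) * xb E M y b c = eps q b c • (xb E M y b c * y) := by
  have h1 := h.y_J hq hb hc
  rw [← hy] at h1
  rw [xb, ← mul_assoc, h1]
  simp [mul_assoc]

lemma IsPl.xb_mul {q : K} (hq : q ≠ 0) {n : ℕ} {E : Finset (Fin n) → A} (h : IsPl q E)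
    {M : Finset (Fin n)} {y : Aˣ} (hy : (y : A) = E M) (b c : Fin n)
    {b' c' : Fin n} (hb : b' ∈ M) (hc : c' ∉ M) :
    xb E M y b c * xb E M y b' c' = ((eps q b' c')⁻¹ • (E (Jb M b c) * E (Jb M b' c'))) *
      ((y⁻¹ * y⁻¹ : Aˣ) : A) := by
  rw [xb, xb, mul_assoc, ← mul_assoc _ (E (Jb M b' c')), h.yinv_J hq hy hb hc]
  simp [mul_assoc]

lemma eps_pos (q : K) {n : ℕ} {b c : Fin n} (h : b < c) : eps q b c = q := if_pos h
lemma eps_neg (q : K) {n : ℕ} {b c : Fin n} (h : c < b) : eps q b c = q⁻¹ := if_neg h.not_gt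

/-- cyclic order of three indices -/
def Cyc3 {n : ℕ} (a b c : Fin n) : Prop :=
  (a < b ∧ b < c) ∨ (b < c ∧ c < a) ∨ (c < a ∧ a < b)

/-- cyclic order of four indices -/
def Cyc4 {n : ℕ} (a b c d : Fin n) : Prop :=
  (a < b ∧ b < c ∧ c < d) ∨ (b < c ∧ c < d ∧ d < a) ∨ (c < d ∧ d < a ∧ a < b) ∨
  (d < a ∧ a < b ∧ b < c)

lemma IsPl.xb_row {q : K} (hq : q ≠ 0) {n : ℕ} {E : Finset (Fin n) → A} (h : IsPl q E)
    {M : Finset (Fin n)} {y : Aˣ} (hy : (y : A) = E M) {b c c' : Fin n}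
    (hb : b ∈ M) (hc : c ∉ M) (hc' : c' ∉ M) (hcyc : Cyc3 b c c') :
    xb E M y b c * xb E M y b c' = q • (xb E M y b c' * xb E M y b c) := by
  rw [h.xb_mul hq hy b c hb hc', h.xb_mul hq hy b c' hb hc, ← smul_mul_assoc q]
  congr 1
  have e1 : c ∉ M.erase b := by simp [hc]
  have e2 : c' ∉ M.erase b := by simp [hc']
  simp only [Jb]
  rcases hcyc with ⟨h1, h2⟩ | ⟨h1, h2⟩ | ⟨h1, h2⟩
  · rw [h.two hq _ h2 e1 e2, eps_pos _ h1, eps_pos _ (h1.trans h2)]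
    module
  · rw [h.two hq _ h1 e1 e2, eps_neg _ h2, eps_neg _ (h1.trans h2)]
    module
  · rw [h.two hq _ (h1.trans h2) e2 e1, eps_neg _ h1, eps_pos _ h2]
    match_scalars
    field_simp

lemma IsPl.xb_col {q : K} (hq : q ≠ 0) {n : ℕ} {E : Finset (Fin n) → A} (h : IsPl q E)
    {M : Finset (Fin n)} {y : Aˣ} (hy : (y : A) = E M) {b b' c : Fin n}
    (hb : b ∈ M) (hb' : b' ∈ M) (hc : c ∉ M) (hcyc : Cyc3 b' b c) :
    xb E M y b c * xb E M y b' c = q • (xb E M y b' c * xb E M y b c) := by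
  rw [h.xb_mul hq hy b c hb' hc, h.xb_mul hq hy b' c hb hc, ← smul_mul_assoc q]
  congr 1
  have hne : b ≠ b' := by rcases hcyc with h | h | h <;> grind
  have hbc : b ≠ c := fun h => hc (h ▸ hb)
  have hbc' : b' ≠ c := fun h => hc (h ▸ hb')
  have e1 : b ∉ insert c ((M.erase b).erase b') := by simp [hbc]
  have e2 : b' ∉ insert c ((M.erase b).erase b') := by simp [hbc']
  have j1 : Jb M b c = insert b' (insert c ((M.erase b).erase b')) := by
    ext z; simp only [Jb, Finset.mem_insert, Finset.mem_erase]; grind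
  have j2 : Jb M b' c = insert b (insert c ((M.erase b).erase b')) := by
    ext z; simp only [Jb, Finset.mem_insert, Finset.mem_erase]; grind
  rw [j1, j2]
  rcases hcyc with ⟨h1, h2⟩ | ⟨h1, h2⟩ | ⟨h1, h2⟩
  · rw [h.two hq _ h1 e2 e1, eps_pos _ h2, eps_pos _ (h1.trans h2)]
    module
  · rw [h.two hq _ (h1.trans h2) e1 e2, eps_neg _ h2, eps_pos _ h1]
    match_scalars
    field_simp
  · rw [h.two hq _ h2 e2 e1, eps_neg _ h1, eps_neg _ (h1.trans h2)]
    module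

lemma IsPl.xb_four {q : K} (hq : q ≠ 0) {n : ℕ} {E : Finset (Fin n) → A} (h : IsPl q E)
    {M : Finset (Fin n)} {y : Aˣ} (hy : (y : A) = E M) {b b' c c' : Fin n}
    (hb : b ∈ M) (hb' : b' ∈ M) (hc : c ∉ M) (hc' : c' ∉ M) (hcyc : Cyc4 b' b c c') :
    xb E M y b' c * xb E M y b c' = xb E M y b c' * xb E M y b' c ∧
    xb E M y b c * xb E M y b' c' - xb E M y b' c' * xb E M y b c =
      (q - q⁻¹) • (xb E M y b c' * xb E M y b' c) := by
  rw [h.xb_mul hq hy b' c hb hc', h.xb_mul hq hy b c' hb' hc, h.xb_mul hq hy b c hb' hc',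
    h.xb_mul hq hy b' c' hb hc, ← sub_mul, ← smul_mul_assoc (q - q⁻¹)]
  have hne : b ≠ b' := by rcases hcyc with h | h | h | h <;> grind
  have hbc : b ≠ c := fun h => hc (h ▸ hb)
  have hbc' : b' ≠ c := fun h => hc (h ▸ hb')
  have hbd : b ≠ c' := fun h => hc' (h ▸ hb)
  have hbd' : b' ≠ c' := fun h => hc' (h ▸ hb')
  have s1 : b ∉ ((M.erase b).erase b') := by simp
  have s2 : b' ∉ ((M.erase b).erase b') := by simp
  have s3 : c ∉ ((M.erase b).erase b') := by simp [hc]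
  have s4 : c' ∉ ((M.erase b).erase b') := by simp [hc']
  have j1 : Jb M b c = insert b' (insert c ((M.erase b).erase b')) := by
    ext z; simp only [Jb, Finset.mem_insert, Finset.mem_erase]; grind
  have j2 : Jb M b' c = insert b (insert c ((M.erase b).erase b')) := by
    ext z; simp only [Jb, Finset.mem_insert, Finset.mem_erase]; grind
  have j3 : Jb M b c' = insert b' (insert c' ((M.erase b).erase b')) := by
    ext z; simp only [Jb, Finset.mem_insert, Finset.mem_erase]; grind
  have j4 : Jb M b' c' = insert b (insert c' ((M.erase b).erase b')) := by
    ext z; simp only [Jb, Finset.mem_insert, Finset.mem_erase]; grind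
  rw [j1, j2, j3, j4]
  generalize (M.erase b).erase b' = S at *
  suffices hs : (eps q b c')⁻¹ • (E (insert b (insert c S)) * E (insert b' (insert c' S))) =
      (eps q b' c)⁻¹ • (E (insert b' (insert c' S)) * E (insert b (insert c S))) ∧
      (eps q b' c')⁻¹ • (E (insert b' (insert c S)) * E (insert b (insert c' S))) -
      (eps q b c)⁻¹ • (E (insert b (insert c' S)) * E (insert b' (insert c S))) =
      (q - q⁻¹) • ((eps q b' c)⁻¹ • (E (insert b' (insert c' S)) * E (insert b (insert c S)))) by
    exact ⟨by rw [hs.1], by rw [hs.2]⟩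
  rcases hcyc with ⟨h1, h2, h3⟩ | ⟨h1, h2, h3⟩ | ⟨h1, h2, h3⟩ | ⟨h1, h2, h3⟩
  · obtain ⟨f, e, d, b0⟩ := h.four hq S h1 h2 h3 s2 s1 s3 s4
    rw [f, e, d, eps_pos _ h2, eps_pos _ (h2.trans h3), eps_pos _ (h1.trans h2),
      eps_pos _ (h1.trans (h2.trans h3))]
    constructor
    · rfl
    · match_scalars <;> field_simp <;> ring
  · obtain ⟨f, e, d, b0⟩ := h.four hq S h1 h2 h3 s1 s3 s4 s2
    rw [Finset.insert_comm b' c', Finset.insert_comm b' c, b0, d, eps_pos _ h1,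
      eps_pos _ (h1.trans h2), eps_neg _ (h2.trans h3), eps_neg _ h3]
    constructor <;> match_scalars <;> field_simp <;> ring
  · obtain ⟨f, e, d, b0⟩ := h.four hq S h1 h2 h3 s3 s4 s2 s1
    rw [Finset.insert_comm b' c', Finset.insert_comm b' c, Finset.insert_comm b c',
      Finset.insert_comm b c, d, e, f, eps_neg _ (h1.trans (h2.trans h3)),
      eps_neg _ (h2.trans h3), eps_neg _ h2, eps_neg _ (h1.trans h2)]
    constructor <;> match_scalars <;> field_simp <;> ring
  · obtain ⟨f, e, d, b0⟩ := h.four hq S h1 h2 h3 s4 s2 s1 s3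
    rw [Finset.insert_comm b' c', Finset.insert_comm b c', d, b0, eps_pos _ h3,
      eps_neg _ h1, eps_pos _ (h2.trans h3), eps_neg _ (h1.trans h2)]
    constructor <;> match_scalars <;> field_simp <;> ring

end QG

open scoped BigOperators
namespace QG

variable {K : Type*} [Field K] {A : Type*} [Ring A] [Algebra K A]

lemma mod_cases (n α k : ℕ) (hn : 0 < n) (hk : k < n) :
    ((α % n + k < n ∧ (α + k) % n = α % n + k) ∨ (n ≤ α % n + k ∧ (α + k) % n = α % n + k - n)) := by
  have h1 := Nat.mod_lt α hn
  rcases lt_or_ge (α % n + k) n with h | h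
  · left
    refine ⟨h, ?_⟩
    rw [Nat.add_mod, Nat.mod_eq_of_lt hk, Nat.mod_eq_of_lt h]
  · right
    refine ⟨h, ?_⟩
    rw [Nat.add_mod, Nat.mod_eq_of_lt hk, Nat.mod_eq_sub_mod h, Nat.mod_eq_of_lt]
    omega

lemma fmod_inj {n α : ℕ} (hn : 0 < n) {k l : ℕ} (hk : k < n) (hl : l < n)
    (h : fmod n hn (α + k) = fmod n hn (α + l)) : k = l := by
  have := congrArg Fin.val h
  simp only [fmod] at this
  rcases mod_cases n α k hn hk with h1 | h1 <;> rcases mod_cases n α l hn hl with h2 | h2 <;> omega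

lemma cyc3_fmod {n α : ℕ} (hn : 0 < n) {a b c : ℕ} (hab : a < b) (hbc : b < c) (hc : c < n) :
    Cyc3 (fmod n hn (α + a)) (fmod n hn (α + b)) (fmod n hn (α + c)) := by
  simp only [Cyc3, fmod, Fin.lt_def]
  have := Nat.mod_lt α hn
  rcases mod_cases n α a hn (by omega) with h1 | h1 <;>
  rcases mod_cases n α b hn (by omega) with h2 | h2 <;>
  rcases mod_cases n α c hn (by omega) with h3 | h3 <;> omega

lemma cyc4_fmod {n α : ℕ} (hn : 0 < n) {a b c d : ℕ} (hab : a < b) (hbc : b < c) (hcd : c < d)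
    (hd : d < n) :
    Cyc4 (fmod n hn (α + a)) (fmod n hn (α + b)) (fmod n hn (α + c)) (fmod n hn (α + d)) := by
  simp only [Cyc4, fmod, Fin.lt_def]
  have := Nat.mod_lt α hn
  rcases mod_cases n α a hn (by omega) with h1 | h1 <;>
  rcases mod_cases n α b hn (by omega) with h2 | h2 <;>
  rcases mod_cases n α c hn (by omega) with h3 | h3 <;>
  rcases mod_cases n α d hn (by omega) with h4 | h4 <;> omega

lemma mem_consecSet {n m α : ℕ} (hn : 0 < n) (hmn : m < n) {k : ℕ} (hk : k < n) :
    fmod n hn (α + k) ∈ consecSet hn m α ↔ k < m := by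
  simp only [consecSet, Finset.mem_image, Finset.mem_range]
  constructor
  · rintro ⟨l, hl, h⟩
    have := fmod_inj hn (by omega) hk h
    omega
  · intro h
    exact ⟨k, h, rfl⟩

lemma exists_fmod {n α : ℕ} (hn : 0 < n) (c : Fin n) : ∃ k < n, fmod n hn (α + k) = c := by
  have h1 := Nat.mod_lt α hn
  have hc := c.2
  by_cases h : α % n ≤ c
  · refine ⟨c - α % n, by omega, ?_⟩
    apply Fin.ext
    simp only [fmod]
    rcases mod_cases n α (c - α % n) hn (by omega) with h2 | h2 <;> omega
  · refine ⟨c + n - α % n, by omega, ?_⟩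
    apply Fin.ext
    simp only [fmod]
    rcases mod_cases n α (c + n - α % n) hn (by omega) with h2 | h2 <;> omega

lemma card_consecSet {n m α : ℕ} (hn : 0 < n) (hmn : m < n) : (consecSet hn m α).card = m := by
  rw [consecSet, Finset.card_image_of_injOn, Finset.card_range]
  intro a ha b hb h
  simp at ha hb
  exact fmod_inj hn (by omega) (by omega) h

section
variable {m n : ℕ} (hn : 0 < n) (α : ℕ)

/-- removed column -/
def bI (i : Fin m) : Fin n := fmod n hn (α + (m - 1 - i))
/-- added column -/
def cJ (m : ℕ) (j : Fin (n - m)) : Fin n := fmod n hn (α + (m + j))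

lemma bI_mem (hmn : m < n) (i : Fin m) : bI hn α i ∈ consecSet hn m α := by
  rw [bI, mem_consecSet hn hmn] <;> omega

lemma cJ_notMem (hmn : m < n) (j : Fin (n - m)) : cJ hn α m j ∉ consecSet hn m α := by
  rw [cJ, mem_consecSet hn hmn] <;> omega

lemma exists_bI (hmn : m < n) {b : Fin n} (hb : b ∈ consecSet hn m α) :
    ∃ i : Fin m, bI hn α i = b := by
  obtain ⟨k, hk, rfl⟩ := exists_fmod (α := α) hn b
  rw [mem_consecSet hn hmn hk] at hb
  refine ⟨⟨m - 1 - k, by omega⟩, ?_⟩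
  simp only [bI]
  congr 2
  omega

lemma exists_cJ (hmn : m < n) {b : Fin n} (hb : b ∉ consecSet hn m α) :
    ∃ j : Fin (n - m), cJ hn α m j = b := by
  obtain ⟨k, hk, rfl⟩ := exists_fmod (α := α) hn b
  rw [mem_consecSet hn hmn hk] at hb
  refine ⟨⟨k - m, by omega⟩, ?_⟩
  simp only [cJ]
  congr 2
  omega

lemma JxSet_eq (i : Fin m) (j : Fin (n - m)) :
    JxSet hn m α i j = Jb (consecSet hn m α) (bI hn α i) (cJ hn α m j) := by
  rw [JxSet, Jb, bI, cJ, add_assoc]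

lemma isQM_xb {q : K} (hq : q ≠ 0) {E : Finset (Fin n) → A} (h : IsPl q E) (hmn : m < n)
    {y : Aˣ} (hy : (y : A) = E (consecSet hn m α)) :
    IsQM q (fun (i : Fin m) (j : Fin (n - m)) =>
      xb E (consecSet hn m α) y (bI hn α i) (cJ hn α m j)) where
  row := fun i j l hjl => h.xb_row hq hy (bI_mem hn α hmn i) (cJ_notMem hn α hmn j)
    (cJ_notMem hn α hmn l) (cyc3_fmod hn (by omega) (by omega) (by omega))
  col := fun i k j hik => h.xb_col hq hy (bI_mem hn α hmn i) (bI_mem hn α hmn k)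
    (cJ_notMem hn α hmn j) (cyc3_fmod hn (by omega) (by omega) (by omega))
  comm := fun k i j l hik hjl => (h.xb_four hq hy (bI_mem hn α hmn i) (bI_mem hn α hmn k)
    (cJ_notMem hn α hmn j) (cJ_notMem hn α hmn l)
    (cyc4_fmod hn (by omega) (by omega) (by omega) (by omega))).1
  qrel := fun i k j l hik hjl => (h.xb_four hq hy (bI_mem hn α hmn i) (bI_mem hn α hmn k)
    (cJ_notMem hn α hmn j) (cJ_notMem hn α hmn l)
    (cyc4_fmod hn (by omega) (by omega) (by omega) (by omega))).2
end

/-- Conjugation by a unit. -/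
def conjH (K : Type*) [Field K] {A : Type*} [Ring A] [Algebra K A] (y : Aˣ) : A →ₐ[K] A where
  toFun r := (y : A) * r * ((y⁻¹ : Aˣ) : A)
  map_one' := by simp
  map_mul' a b := by simp [mul_assoc]
  map_zero' := by simp
  map_add' a b := by simp [mul_add, add_mul]
  commutes' k := by rw [← Algebra.commutes k (y : A), mul_assoc]; simp

lemma conjH_apply (y : Aˣ) (r : A) : conjH K y r = (y : A) * r * ((y⁻¹ : Aˣ) : A) := rfl

lemma conjH_mul_y (y : Aˣ) (r : A) : conjH K y r * y = (y : A) * r := by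
  simp [conjH_apply, mul_assoc]

/-- The span of `1` and the dehomogenised generators. -/
noncomputable def Usp (K : Type*) [Field K] {A : Type*} [Ring A] [Algebra K A] {n : ℕ}
    (E : Finset (Fin n) → A) (M : Finset (Fin n)) (y : Aˣ) : Submodule K A :=
  1 ⊔ Submodule.span K {z | ∃ b ∈ M, ∃ c ∉ M, z = xb E M y b c}

lemma IsPl.conj_xb {q : K} (hq : q ≠ 0) {n : ℕ} {E : Finset (Fin n) → A} (h : IsPl q E)
    {M : Finset (Fin n)} {y : Aˣ} (hy : (y : A) = E M) {b c : Fin n} (hb : b ∈ M) (hc : c ∉ M) :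
    conjH K y (xb E M y b c) = eps q b c • xb E M y b c := by
  rw [conjH_apply, h.y_xb hq hy hb hc]
  simp [mul_assoc]

lemma conj_inv_conj (y : Aˣ) (r : A) : conjH K y⁻¹ (conjH K y r) = r := by
  simp [conjH_apply, mul_assoc]

lemma conj_conj_inv (y : Aˣ) (r : A) : conjH K y (conjH K y⁻¹ r) = r := by
  simp [conjH_apply, mul_assoc]

lemma IsPl.conj_inv_xb {q : K} (hq : q ≠ 0) {n : ℕ} {E : Finset (Fin n) → A} (h : IsPl q E)
    {M : Finset (Fin n)} {y : Aˣ} (hy : (y : A) = E M) {b c : Fin n} (hb : b ∈ M) (hc : c ∉ M) :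
    conjH K y⁻¹ (xb E M y b c) = (eps q b c)⁻¹ • xb E M y b c := by
  have h1 := congrArg (conjH K y⁻¹) (h.conj_xb hq hy hb hc)
  rw [conj_inv_conj, map_smul] at h1
  rw [h1, smul_smul, inv_mul_cancel₀ (eps_ne hq b c), one_smul, ← h1]

lemma IsPl.conj_U {q : K} (hq : q ≠ 0) {n : ℕ} {E : Finset (Fin n) → A} (h : IsPl q E)
    {M : Finset (Fin n)} {y : Aˣ} (hy : (y : A) = E M) :
    (Usp K E M y).map (conjH K y).toLinearMap ≤ Usp K E M y := by
  rw [Usp, Submodule.map_sup, Submodule.map_one, Submodule.map_span]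
  refine sup_le_sup le_rfl (Submodule.span_le.2 ?_)
  rintro _ ⟨_, ⟨b, hb, c, hc, rfl⟩, rfl⟩
  rw [AlgHom.toLinearMap_apply, h.conj_xb hq hy hb hc]
  exact Submodule.smul_mem _ _ (Submodule.subset_span ⟨b, hb, c, hc, rfl⟩)

lemma IsPl.conj_inv_U {q : K} (hq : q ≠ 0) {n : ℕ} {E : Finset (Fin n) → A} (h : IsPl q E)
    {M : Finset (Fin n)} {y : Aˣ} (hy : (y : A) = E M) :
    (Usp K E M y).map (conjH K y⁻¹).toLinearMap ≤ Usp K E M y := by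
  rw [Usp, Submodule.map_sup, Submodule.map_one, Submodule.map_span]
  refine sup_le_sup le_rfl (Submodule.span_le.2 ?_)
  rintro _ ⟨_, ⟨b, hb, c, hc, rfl⟩, rfl⟩
  rw [AlgHom.toLinearMap_apply, h.conj_inv_xb hq hy hb hc]
  exact Submodule.smul_mem _ _ (Submodule.subset_span ⟨b, hb, c, hc, rfl⟩)

lemma IsPl.conj_U_pow {q : K} (hq : q ≠ 0) {n : ℕ} {E : Finset (Fin n) → A} (h : IsPl q E)
    {M : Finset (Fin n)} {y : Aˣ} (hy : (y : A) = E M) (d : ℕ) {r : A} (hr : r ∈ Usp K E M y ^ d) :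
    conjH K y r ∈ Usp K E M y ^ d := by
  have h1 := Submodule.map_pow (Usp K E M y) (conjH K y) d
  have h2 : conjH K y r ∈ (Usp K E M y ^ d).map (conjH K y).toLinearMap :=
    Submodule.mem_map_of_mem (f := (conjH K y).toLinearMap) hr
  rw [h1] at h2
  exact pow_le_pow_left' (h.conj_U hq hy) d h2

lemma IsPl.conj_inv_U_pow {q : K} (hq : q ≠ 0) {n : ℕ} {E : Finset (Fin n) → A} (h : IsPl q E)
    {M : Finset (Fin n)} {y : Aˣ} (hy : (y : A) = E M) (d : ℕ) {r : A} (hr : r ∈ Usp K E M y ^ d) :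
    conjH K y⁻¹ r ∈ Usp K E M y ^ d := by
  have h1 := Submodule.map_pow (Usp K E M y) (conjH K y⁻¹) d
  have h2 : conjH K y⁻¹ r ∈ (Usp K E M y ^ d).map (conjH K y⁻¹).toLinearMap :=
    Submodule.mem_map_of_mem (f := (conjH K y⁻¹).toLinearMap) hr
  rw [h1] at h2
  exact pow_le_pow_left' (h.conj_inv_U hq hy) d h2

lemma IsPl.expand {q : K} (hq : q ≠ 0) {n : ℕ} {E : Finset (Fin n) → A} (h : IsPl q E)
    {M : Finset (Fin n)} {y : Aˣ} (hy : (y : A) = E M) (d : ℕ) : ∀ I : Finset (Fin n),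
    (I \ M).card = d → I.card = M.card → ∃ r ∈ Usp K E M y ^ d, E I = r * y := by
  induction d with
  | zero =>
    intro I h1 h2
    have h3 : I ⊆ M := by simpa [Finset.sdiff_eq_empty_iff_subset] using h1
    have h4 : I = M := Finset.eq_of_subset_of_card_le h3 h2.ge
    refine ⟨1, ?_, by rw [one_mul, hy, h4]⟩
    simpa using ⟨1, map_one _⟩
  | succ d ih =>
    intro I h1 h2
    obtain ⟨c, hc⟩ : (I \ M).Nonempty := Finset.card_pos.1 (by omega)
    have hcI : c ∈ I := (Finset.mem_sdiff.1 hc).1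
    have hcM : c ∉ M := (Finset.mem_sdiff.1 hc).2
    have hp := h.p (insert c M) (I.erase c)
    have hs : insert c M \ I.erase c = insert c (M \ I) := by
      ext z; simp only [Finset.mem_sdiff, Finset.mem_insert, Finset.mem_erase]
      by_cases hz : z = c
      · simp [hz]
      · simp [hz]
    rw [hs, Finset.sum_insert (by simp [hcI]), Finset.erase_insert hcM,
      Finset.insert_erase hcI] at hp
    have key : ∀ b ∈ M \ I, ∃ s ∈ Usp K E M y ^ (d+1),
        E ((insert c M).erase b) * E (insert b (I.erase c)) = y * (s * y) := by
      intro b hb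
      have hbM : b ∈ M := (Finset.mem_sdiff.1 hb).1
      have hbI : b ∉ I := (Finset.mem_sdiff.1 hb).2
      have hbc : b ≠ c := fun h => hcM (h ▸ hbM)
      have hb' : b ∉ I.erase c := fun h => hbI (Finset.mem_of_mem_erase h)
      have e1 : (insert c M).erase b = Jb M b c := by
        ext z; simp only [Jb, Finset.mem_insert, Finset.mem_erase]
        by_cases hz : z = c
        · subst hz; simp [hbc.symm]
        · simp [hz]
      have e2 : insert b (I.erase c) \ M = (I \ M).erase c := by
        ext z; simp only [Finset.mem_sdiff, Finset.mem_insert, Finset.mem_erase]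
        by_cases hz : z = b
        · subst hz; simp [hbM]
        · simp [hz, and_assoc]
      obtain ⟨r, hr, hr2⟩ := ih (insert b (I.erase c))
        (by rw [e2, Finset.card_erase_of_mem hc, h1]; rfl)
        (by rw [Finset.card_insert_of_notMem hb', Finset.card_erase_of_mem hcI, ← h2]
            have := Finset.card_pos.2 ⟨c, hcI⟩
            omega)
      refine ⟨(eps q b c)⁻¹ • (xb E M y b c * r), ?_, ?_⟩
      · refine Submodule.smul_mem _ _ ?_
        rw [pow_succ']
        refine Submodule.mul_mem_mul ?_ hr
        exact Submodule.mem_sup_right (Submodule.subset_span ⟨b, hbM, c, hcM, rfl⟩)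
      · rw [hr2, e1]
        have e3 : E (Jb M b c) = xb E M y b c * y := by simp [xb, mul_assoc]
        have e4 := h.y_xb hq hy hbM hcM
        rw [e3, smul_mul_assoc, mul_smul_comm, ← mul_assoc (y : A), ← mul_assoc (y : A), e4]
        simp only [smul_mul_assoc, smul_smul, inv_mul_cancel₀ (eps_ne hq b c), one_smul, mul_assoc]
    choose! s hs1 hs2 using key
    rw [Finset.sum_congr rfl (fun b hb => by rw [hs2 b hb])] at hp
    generalize hk : (-q) ^ (((insert c M).filter (fun l => c < l)).card +
      ((I.erase c).filter (fun k => k < c)).card) = k at hp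
    have hk0 : k ≠ 0 := by rw [← hk]; exact pow_ne_zero _ (neg_ne_zero.2 hq)
    refine ⟨(-k⁻¹) • ∑ b ∈ M \ I, (-q) ^ (((insert c M).filter (fun l => b < l)).card +
      ((I.erase c).filter (fun k => k < b)).card) • s b, ?_, ?_⟩
    · exact Submodule.smul_mem _ _ (Submodule.sum_mem _ fun b hb =>
        Submodule.smul_mem _ _ (hs1 b hb))
    · have h5 : (y : A) * E I = y * (((-k⁻¹) • ∑ b ∈ M \ I,
          (-q) ^ (((insert c M).filter (fun l => b < l)).card +
          ((I.erase c).filter (fun k => k < b)).card) • s b) * y) := by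
        simp only [smul_mul_assoc, Finset.sum_mul, mul_smul_comm, Finset.mul_sum]
        rw [← hy] at hp
        rw [neg_smul, ← smul_neg, ← eq_neg_of_add_eq_zero_left hp, smul_smul,
          inv_mul_cancel₀ hk0, one_smul]
      exact (Units.mul_right_inj y).1 h5

end QG

open scoped BigOperators
namespace QG

variable {K : Type*} [Field K] {A : Type*} [Ring A] [Algebra K A]

section step
variable {q : K} {m n : ℕ}

/-- `t`-data extending a `q`-matrix `y` -/
structure TData (q : K) (y : Fin m → Fin n → A) (t : Fin n → Aˣ) : Prop where
  tt : ∀ j l, j < l → (t j : A) * t l = q • ((t l : A) * t j)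
  yt : ∀ i l, y i l * t l = q • ((t l : A) * y i l)
  yt' : ∀ i l j, j ≠ l → y i l * t j = (t j : A) * y i l

/-- auxiliary element -/
def gg (y : Fin m → Fin n → A) (t : Fin n → Aˣ) (i : Fin m) (l : Fin n) : A :=
  y i l * ((t l)⁻¹ : Aˣ)

lemma inv_comm_of {c : K} (hc : c ≠ 0) {a : A} {t : Aˣ} (h : a * t = c • ((t : A) * a)) :
    ((t⁻¹ : Aˣ) : A) * a = c • (a * ((t⁻¹ : Aˣ) : A)) := by
  calc _ = ((t⁻¹ : Aˣ) : A) * (a * t) * ((t⁻¹ : Aˣ) : A) := by simp [mul_assoc]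
    _ = _ := by rw [h]; simp [← mul_assoc]

lemma inv_inv_comm {c : K} (hc : c ≠ 0) {s t : Aˣ} (h : (s : A) * t = c • ((t : A) * s)) :
    ((s⁻¹ : Aˣ) : A) * ((t⁻¹ : Aˣ) : A) = c • (((t⁻¹ : Aˣ) : A) * ((s⁻¹ : Aˣ) : A)) := by
  have h1 := inv_comm_of hc h
  -- t⁻¹ s = c s t⁻¹
  calc _ = ((s⁻¹ : Aˣ) : A) * (((t⁻¹ : Aˣ) : A) * s) * ((s⁻¹ : Aˣ) : A) := by simp [mul_assoc]
    _ = _ := by rw [h1]; simp [← mul_assoc]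

variable {y : Fin m → Fin n → A} {t : Fin n → Aˣ}

lemma TData.inv_y (hq : q ≠ 0) (ht : TData q y t) (i : Fin m) (l : Fin n) :
    (((t l)⁻¹ : Aˣ) : A) * y i l = q • (y i l * (((t l)⁻¹ : Aˣ) : A)) :=
  inv_comm_of hq (ht.yt i l)

lemma TData.inv_y' (ht : TData q y t) (i : Fin m) (l j : Fin n) (hjl : j ≠ l) :
    (((t j)⁻¹ : Aˣ) : A) * y i l = (y i l * (((t j)⁻¹ : Aˣ) : A)) := by
  have := inv_comm_of (K := K) one_ne_zero (a := y i l) (t := t j)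
    (by rw [one_smul]; exact ht.yt' i l j hjl)
  rwa [one_smul] at this

/-- product of two `gg` elements with distinct columns -/
lemma TData.gg_mul' (ht : TData q y t) (i k : Fin m) (l l' : Fin n) (h : l ≠ l') :
    gg y t i l * gg y t k l' = (y i l * y k l') * ((((t l)⁻¹ : Aˣ) : A) * (((t l')⁻¹ : Aˣ) : A)) := by
  simp only [gg, mul_assoc]
  rw [← mul_assoc _ (y k l'), ht.inv_y' k l' l h]
  simp only [mul_assoc]

lemma TData.gg_mul (hq : q ≠ 0) (ht : TData q y t) (i k : Fin m) (l : Fin n) :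
    gg y t i l * gg y t k l = (q • (y i l * y k l)) *
      ((((t l)⁻¹ : Aˣ) : A) * (((t l)⁻¹ : Aˣ) : A)) := by
  simp only [gg, mul_assoc]
  rw [← mul_assoc _ (y k l), ht.inv_y hq k l]
  simp only [smul_mul_assoc, mul_smul_comm, mul_assoc]

lemma TData.gg_row (hq : q ≠ 0) (hy : IsQM q y) (ht : TData q y t) (i : Fin m) {l l' : Fin n}
    (h : l < l') : gg y t i l * gg y t i l' = (q ^ 2) • (gg y t i l' * gg y t i l) := by
  rw [ht.gg_mul' i i l l' h.ne, ht.gg_mul' i i l' l h.ne', hy.row i l l' h,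
    inv_inv_comm hq (ht.tt l l' h)]
  simp only [smul_mul_assoc, mul_smul_comm, smul_smul]
  ring_nf

lemma TData.gg_col (hq : q ≠ 0) (hy : IsQM q y) (ht : TData q y t) {i k : Fin m} (l : Fin n)
    (h : i < k) : gg y t i l * gg y t k l = q • (gg y t k l * gg y t i l) := by
  rw [ht.gg_mul hq, ht.gg_mul hq, hy.col i k l h]
  simp only [smul_mul_assoc]

lemma TData.gg_comm (hq : q ≠ 0) (hy : IsQM q y) (ht : TData q y t) {i k : Fin m} {l l' : Fin n}
    (h : i < k) (hl : l < l') : gg y t k l * gg y t i l' = q • (gg y t i l' * gg y t k l) := by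
  rw [ht.gg_mul' _ _ l l' hl.ne, ht.gg_mul' _ _ l' l hl.ne', hy.comm k i l l' h hl,
    inv_inv_comm hq (ht.tt l l' hl)]
  simp only [mul_smul_comm]

lemma TData.gg_qrel (hq : q ≠ 0) (hy : IsQM q y) (ht : TData q y t) {i k : Fin m} {l l' : Fin n}
    (h : i < k) (hl : l < l') : gg y t i l * gg y t k l' = q • (gg y t k l' * gg y t i l) +
      (q ^ 2 - 1) • (gg y t i l' * gg y t k l) := by
  have h1 : y i l * y k l' = y k l' * y i l + (q - q⁻¹) • (y i l' * y k l) := by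
    rw [← hy.qrel i k l l' h hl]; abel
  rw [ht.gg_mul' _ _ l l' hl.ne, ht.gg_mul' _ _ l' l hl.ne', ht.gg_mul' _ _ l' l hl.ne', h1,
    inv_inv_comm hq (ht.tt l l' hl)]
  simp only [mul_smul_comm, add_mul, smul_mul_assoc]
  match_scalars <;> field_simp

/-- partial row sums -/
def us (y : Fin m → Fin n → A) (t : Fin n → Aˣ) (S : Finset (Fin n)) (i : Fin m) : A :=
  ∑ l ∈ S, gg y t i l

lemma TData.us_row (hq : q ≠ 0) (hy : IsQM q y) (ht : TData q y t) (i : Fin m)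
    {S T : Finset (Fin n)} (h : ∀ a ∈ S, ∀ b ∈ T, a < b) :
    us y t S i * us y t T i = q ^ 2 • (us y t T i * us y t S i) := by
  simp only [us, Finset.sum_mul_sum, Finset.smul_sum]
  rw [Finset.sum_comm]
  exact Finset.sum_congr rfl fun b hb => Finset.sum_congr rfl fun a ha =>
    ht.gg_row hq hy i (h a ha b hb)

lemma TData.us_comm (hq : q ≠ 0) (hy : IsQM q y) (ht : TData q y t) {i k : Fin m} (hik : i < k)
    {S T : Finset (Fin n)} (h : ∀ a ∈ S, ∀ b ∈ T, a < b) :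
    us y t S k * us y t T i = q • (us y t T i * us y t S k) := by
  simp only [us, Finset.sum_mul_sum, Finset.smul_sum]
  rw [Finset.sum_comm]
  exact Finset.sum_congr rfl fun b hb => Finset.sum_congr rfl fun a ha =>
    ht.gg_comm hq hy hik (h a ha b hb)

lemma TData.us_qrel (hq : q ≠ 0) (hy : IsQM q y) (ht : TData q y t) {i k : Fin m} (hik : i < k)
    {S T : Finset (Fin n)} (h : ∀ a ∈ S, ∀ b ∈ T, a < b) :
    us y t S i * us y t T k = q • (us y t T k * us y t S i) +
      (q ^ 2 - 1) • (us y t T i * us y t S k) := by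
  simp only [us, Finset.sum_mul_sum, Finset.smul_sum]
  rw [Finset.sum_comm, ← Finset.sum_add_distrib]
  refine Finset.sum_congr rfl fun b hb => ?_
  rw [← Finset.sum_add_distrib]
  exact Finset.sum_congr rfl fun a ha => ht.gg_qrel hq hy hik (h a ha b hb)

lemma TData.us_col (hq : q ≠ 0) (hy : IsQM q y) (ht : TData q y t) {i k : Fin m} (hik : i < k)
    (S : Finset (Fin n)) : us y t S i * us y t S k = q • (us y t S k * us y t S i) := by
  induction S using Finset.induction_on_min with
  | empty => simp [us]
  | insert a S ha ih =>
    have haS : a ∉ S := fun h => lt_irrefl _ (ha a h)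
    have e : ∀ i, us y t (insert a S) i = us y t {a} i + us y t S i := fun i => by
      simp [us, Finset.sum_insert haS]
    have hlt : ∀ a' ∈ ({a} : Finset (Fin n)), ∀ b ∈ S, a' < b := by simpa using ha
    have e1 := ht.us_qrel hq hy hik hlt
    have e2 := ht.us_comm hq hy hik hlt
    have e3 : us y t {a} i * us y t {a} k = q • (us y t {a} k * us y t {a} i) := by
      simpa [us] using ht.gg_col hq hy a hik
    rw [e, e]
    simp only [mul_add, add_mul, smul_add]
    rw [e1, e2, e3, ih]
    module

lemma TData.t_gg (hq : q ≠ 0) (ht : TData q y t) (j : Fin n) (i : Fin m) (l : Fin n) (h : j ≤ l) :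
    (t j : A) * gg y t i l = q⁻¹ • (gg y t i l * t j) := by
  rcases h.eq_or_lt with rfl | h
  · have := ht.yt i j
    have h2 : (t j : A) * y i j = q⁻¹ • (y i j * t j) := by
      rw [this, smul_smul, inv_mul_cancel₀ hq, one_smul]
    rw [gg, ← mul_assoc, h2]
    simp [mul_assoc]
  · have h1 := inv_comm_of hq (ht.tt j l h)
    rw [gg, ← mul_assoc, ← ht.yt' i l j h.ne, mul_assoc, mul_assoc, h1]
    simp [smul_smul, inv_mul_cancel₀ hq]

lemma TData.t_gg' (hq : q ≠ 0) (ht : TData q y t) (j : Fin n) (i : Fin m) (l : Fin n) (h : l < j) :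
    (t j : A) * gg y t i l = q • (gg y t i l * t j) := by
  have h0 : (t j : A) * t l = q⁻¹ • ((t l : A) * t j) := by
    rw [ht.tt l j h, smul_smul, inv_mul_cancel₀ hq, one_smul]
  have h1 := inv_comm_of (inv_ne_zero hq) h0
  rw [gg, ← mul_assoc, ← ht.yt' i l j h.ne', mul_assoc, mul_assoc, h1]
  simp [smul_smul, mul_inv_cancel₀ hq]

lemma TData.t_us (hq : q ≠ 0) (ht : TData q y t) (j : Fin n) (i : Fin m) (S : Finset (Fin n))
    (h : ∀ l ∈ S, j ≤ l) : (t j : A) * us y t S i = q⁻¹ • (us y t S i * t j) := by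
  simp only [us, Finset.mul_sum, Finset.sum_mul, Finset.smul_sum]
  exact Finset.sum_congr rfl fun l hl => ht.t_gg hq j i l (h l hl)

lemma TData.t_us' (hq : q ≠ 0) (ht : TData q y t) (j : Fin n) (i : Fin m) (S : Finset (Fin n))
    (h : ∀ l ∈ S, l < j) : (t j : A) * us y t S i = q • (us y t S i * t j) := by
  simp only [us, Finset.mul_sum, Finset.sum_mul, Finset.smul_sum]
  exact Finset.sum_congr rfl fun l hl => ht.t_gg' hq j i l (h l hl)

/-- tail row sums -/
def ut (y : Fin m → Fin n → A) (t : Fin n → Aˣ) (i : Fin m) (j : Fin n) : A :=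
  us y t (Finset.univ.filter (fun l => j ≤ l)) i
/-- middle row sums -/
def hh (y : Fin m → Fin n → A) (t : Fin n → Aˣ) (i : Fin m) (j l : Fin n) : A :=
  us y t (Finset.univ.filter (fun k => j ≤ k ∧ k < l)) i

lemma ut_split (y : Fin m → Fin n → A) (t : Fin n → Aˣ) (i : Fin m) {j l : Fin n} (h : j < l) :
    ut y t i j = hh y t i j l + ut y t i l := by
  rw [ut, hh, ut, us, us, us, ← Finset.sum_union]
  · refine Finset.sum_congr ?_ fun _ _ => rfl
    ext k; simp; grind
  · rw [Finset.disjoint_filter]; grind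

/-- the enlarged matrix -/
def newX (y : Fin m → Fin n → A) (t : Fin n → Aˣ) (i : Fin (m + 1)) (j : Fin n) : A :=
  Fin.lastCases (motive := fun _ => A) (t j : A) (fun i => ut y t i j * t j) i

lemma newX_last (y : Fin m → Fin n → A) (t : Fin n → Aˣ) (j : Fin n) :
    newX y t (Fin.last m) j = t j := by simp [newX]
lemma newX_cast (y : Fin m → Fin n → A) (t : Fin n → Aˣ) (i : Fin m) (j : Fin n) :
    newX y t i.castSucc j = ut y t i j * t j := by simp [newX]

lemma TData.isQM_newX (hq : q ≠ 0) (hy : IsQM q y) (ht : TData q y t) : IsQM q (newX y t) := by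
  -- normal form of products
  have F5 : ∀ i j l, j ≤ l → (t j : A) * ut y t i l = q⁻¹ • (ut y t i l * t j) :=
    fun i j l h => ht.t_us hq j i _ (by simp; intro k hk; exact h.trans hk)
  have F5' : ∀ i j l, (t l : A) * hh y t i j l = q • (hh y t i j l * t l) :=
    fun i j l => ht.t_us' hq l i _ (by simp)
  have hlt : ∀ j l : Fin n, ∀ a ∈ (Finset.univ.filter (fun k => j ≤ k ∧ k < l)),
      ∀ b ∈ (Finset.univ.filter (fun k => l ≤ k)), a < b := by
    intro j l a ha b hb
    simp at ha hb
    exact lt_of_lt_of_le ha.2 hb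
  have P1 : ∀ i k j l, j ≤ l → (ut y t i j * t j) * (ut y t k l * t l) =
      q⁻¹ • (ut y t i j * ut y t k l * (t j * t l)) := by
    intro i k j l h
    rw [mul_assoc, ← mul_assoc (t j : A), F5 k j l h]
    simp [mul_assoc]
  have P1' : ∀ i k j l, j < l → (ut y t i j * t j) * (ut y t k l * t l) =
      (ut y t i j * ut y t k l * (t l * t j)) := by
    intro i k j l h
    rw [P1 i k j l h.le, ht.tt j l h, mul_smul_comm, smul_smul, inv_mul_cancel₀ hq, one_smul]
  have P2 : ∀ i k j l, j < l → (ut y t k l * t l) * (ut y t i j * t j) =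
      (ut y t k l * (q • hh y t i j l + q⁻¹ • ut y t i l) * (t l * t j)) := by
    intro i k j l h
    rw [mul_assoc, ← mul_assoc (t l : A), ut_split y t i h, mul_add, F5 i l l le_rfl, F5' i j l]
    simp only [mul_add, add_mul, smul_mul_assoc, mul_smul_comm, mul_assoc]
  constructor
  · intro i j l hjl
    refine Fin.lastCases ?_ (fun i => ?_) i
    · simp only [newX_last]; exact ht.tt j l hjl
    · simp only [newX_cast]
      have F1 := ht.us_row hq hy i (hlt j l)
      change hh y t i j l * ut y t i l = _ • (ut y t i l * hh y t i j l) at F1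
      rw [P1' i i j l hjl, P2 i i j l hjl, ← smul_mul_assoc q, ut_split y t i hjl]
      congr 1
      rw [add_mul, F1]
      simp only [mul_add, mul_smul_comm]
      match_scalars <;> field_simp
  · intro i k j hik
    revert hik
    refine Fin.lastCases ?_ (fun k => ?_) k
    · refine Fin.lastCases ?_ (fun i => ?_) i
      · intro h; exact absurd h (lt_irrefl _)
      · intro _
        simp only [newX_last, newX_cast]
        rw [← mul_assoc (t j : A), F5 i j j le_rfl]
        simp [smul_smul, mul_inv_cancel₀ hq]
    · refine Fin.lastCases ?_ (fun i => ?_) i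
      · intro h; exact absurd h (not_lt.2 (Fin.le_last _))
      · intro hik
        have hik : i < k := hik
        simp only [newX_cast]
        have F2 := ht.us_col hq hy hik (Finset.univ.filter (fun l => j ≤ l))
        change ut y t i j * ut y t k j = _ • (ut y t k j * ut y t i j) at F2
        rw [P1 i k j j le_rfl, P1 k i j j le_rfl, F2]
        simp only [smul_mul_assoc]
        rw [smul_comm]
  · intro k i j l hik hjl
    revert hik
    refine Fin.lastCases ?_ (fun k => ?_) k
    · refine Fin.lastCases ?_ (fun i => ?_) i
      · intro h; exact absurd h (lt_irrefl _)
      · intro _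
        simp only [newX_last, newX_cast]
        rw [← mul_assoc (t j : A), F5 i j l hjl.le, smul_mul_assoc, mul_assoc, ht.tt j l hjl]
        simp [smul_smul, inv_mul_cancel₀ hq, mul_assoc]
    · refine Fin.lastCases ?_ (fun i => ?_) i
      · intro h; exact absurd h (not_lt.2 (Fin.le_last _))
      · intro hik
        have hik : i < k := hik
        simp only [newX_cast]
        have F2 := ht.us_col hq hy hik (Finset.univ.filter (fun k => l ≤ k))
        change ut y t i l * ut y t k l = _ • (ut y t k l * ut y t i l) at F2
        have F3 := ht.us_comm hq hy hik (hlt j l)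
        change hh y t k j l * ut y t i l = _ • (ut y t i l * hh y t k j l) at F3
        rw [P1' k i j l hjl, P2 k i j l hjl, ut_split y t k hjl]
        congr 1
        rw [add_mul, F3]
        simp only [mul_add, mul_smul_comm]
        rw [F2]
        match_scalars <;> field_simp
  · intro i k j l hik hjl
    revert hik
    refine Fin.lastCases ?_ (fun k => ?_) k
    · refine Fin.lastCases ?_ (fun i => ?_) i
      · intro h; exact absurd h (lt_irrefl _)
      · intro _
        simp only [newX_last, newX_cast]
        rw [← mul_assoc (t l : A), ut_split y t i hjl, mul_add, F5 i l l le_rfl, F5' i j l]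
        simp only [add_mul, smul_mul_assoc, mul_assoc]
        rw [ht.tt j l hjl]
        simp only [mul_smul_comm]
        match_scalars <;> field_simp <;> ring
    · refine Fin.lastCases ?_ (fun i => ?_) i
      · intro h; exact absurd h (not_lt.2 (Fin.le_last _))
      · intro hik
        have hik : i < k := hik
        simp only [newX_cast]
        have F2 := ht.us_col hq hy hik (Finset.univ.filter (fun k => l ≤ k))
        change ut y t i l * ut y t k l = _ • (ut y t k l * ut y t i l) at F2
        have F4 := ht.us_qrel hq hy hik (hlt j l)
        change hh y t i j l * ut y t k l = _ • (ut y t k l * hh y t i j l) +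
          _ • (ut y t i l * hh y t k j l) at F4
        rw [P1' i k j l hjl, P2 i k j l hjl, P2 k i j l hjl, ut_split y t i hjl, ← sub_mul,
          ← smul_mul_assoc (q - q⁻¹)]
        congr 1
        rw [add_mul, F4]
        simp only [mul_add, mul_smul_comm]
        rw [F2]
        match_scalars <;> field_simp <;> ring

end step
end QG


open scoped BigOperators
namespace QG
variable {K : Type*} [Field K] {A : Type*} [Ring A] [Algebra K A]

section ops
variable {n m : ℕ}

/-- weighted shift operator -/
def sh (A : Type*) [Ring A] [Algebra K A] {n : ℕ} (c : (Fin n → ℤ) → K) (d : Fin n → ℤ) :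
    Module.End K ((Fin n → ℤ) → A) where
  toFun f := fun e => c e • f (e + d)
  map_add' f g := by ext e; simp
  map_smul' r f := by ext e; simp only [Pi.smul_apply, RingHom.id_apply]; rw [smul_comm]

lemma sh_apply (c : (Fin n → ℤ) → K) (d : Fin n → ℤ) (f : (Fin n → ℤ) → A) (e : Fin n → ℤ) :
    sh A c d f e = c e • f (e + d) := rfl

/-- weighted multiplication operator -/
def my (q : K) (x : A) (l : Fin n) : Module.End K ((Fin n → ℤ) → A) where
  toFun f := fun e => q ^ (e l) • (x * f e)
  map_add' f g := by ext e; simp [mul_add]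
  map_smul' r f := by
    ext e; simp only [Pi.smul_apply, RingHom.id_apply, mul_smul_comm]; rw [smul_comm]

lemma my_apply (q : K) (x : A) (l : Fin n) (f : (Fin n → ℤ) → A) (e : Fin n → ℤ) :
    my q x l f e = q ^ (e l) • (x * f e) := rfl

/-- the exponent weight -/
def tw (q : K) (j : Fin n) (e : Fin n → ℤ) : K := q ^ (∑ l ∈ Finset.univ.filter (fun l => j < l), e l)

lemma tw_ne {q : K} (hq : q ≠ 0) (j : Fin n) (e : Fin n → ℤ) : tw q j e ≠ 0 := zpow_ne_zero _ hq

lemma tw_add {q : K} (hq : q ≠ 0) (j : Fin n) (e d : Fin n → ℤ) :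
    tw q j (e + d) = tw q j e * tw q j d := by
  simp [tw, Finset.sum_add_distrib, zpow_add₀ hq]

lemma tw_single (q : K) (j l : Fin n) (a : ℤ) :
    tw q j (Pi.single l a) = if j < l then q ^ a else 1 := by
  unfold tw
  split_ifs with h
  · rw [Finset.sum_eq_single l]
    · simp
    · intro b _ hb; simp [hb]
    · intro h2; simp at h2; omega
  · rw [Finset.sum_eq_zero]
    · simp
    · intro b hb
      rw [Pi.single_eq_of_ne]; rintro rfl; simp at hb; omega

/-- the shift as a unit -/
def tU (A : Type*) [Ring A] [Algebra K A] {n : ℕ} {q : K} (hq : q ≠ 0) (j : Fin n) :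
    (Module.End K ((Fin n → ℤ) → A))ˣ where
  val := sh A (tw q j) (Pi.single j (-1))
  inv := sh A (fun e => (tw q j e)⁻¹) (Pi.single j 1)
  val_inv := by
    ext f e
    simp only [Module.End.mul_apply, sh_apply, Module.End.one_apply, tw_add hq, tw_single]
    rw [add_assoc, ← Pi.single_add]
    simp [smul_smul, mul_inv_cancel₀ (tw_ne hq j e)]
  inv_val := by
    ext f e
    simp only [Module.End.mul_apply, sh_apply, Module.End.one_apply, tw_add hq, tw_single]
    rw [add_assoc, ← Pi.single_add]
    simp [smul_smul, inv_mul_cancel₀ (tw_ne hq j e)]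

lemma tU_apply {q : K} (hq : q ≠ 0) (j : Fin n) (f : (Fin n → ℤ) → A) (e : Fin n → ℤ) :
    (tU A hq j : Module.End K ((Fin n → ℤ) → A)) f e = tw q j e • f (e + Pi.single j (-1)) := rfl

lemma tU_inv_apply {q : K} (hq : q ≠ 0) (j : Fin n) (f : (Fin n → ℤ) → A) (e : Fin n → ℤ) :
    (((tU A hq j)⁻¹ : (Module.End K ((Fin n → ℤ) → A))ˣ) : Module.End K ((Fin n → ℤ) → A)) f e
      = (tw q j e)⁻¹ • f (e + Pi.single j 1) := rfl

lemma isQM_my {q : K} (hq : q ≠ 0) {x : Fin m → Fin n → A} (h : IsQM q x) :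
    IsQM q (fun i j => my q (x i j) j) where
  row i j l hjl := by
    ext f e
    simp only [Module.End.mul_apply, my_apply, LinearMap.smul_apply, Pi.smul_apply,
      mul_smul_comm, ← mul_assoc]
    rw [h.row i j l hjl]
    simp only [smul_smul, smul_mul_assoc]
    congr 1; ring
  col i k j hik := by
    ext f e
    simp only [Module.End.mul_apply, my_apply, LinearMap.smul_apply, Pi.smul_apply,
      mul_smul_comm, ← mul_assoc]
    rw [h.col i k j hik]
    simp only [smul_smul, smul_mul_assoc]
    congr 1; ring
  comm i k j l hik hjl := by
    ext f e
    simp only [Module.End.mul_apply, my_apply, LinearMap.smul_apply, Pi.smul_apply,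
      mul_smul_comm, ← mul_assoc]
    rw [h.comm i k j l hik hjl]
    simp only [smul_smul, smul_mul_assoc]
    congr 1; ring
  qrel i k j l hik hjl := by
    ext f e
    simp only [Module.End.mul_apply, my_apply, LinearMap.smul_apply, LinearMap.sub_apply,
      Pi.smul_apply, Pi.sub_apply, mul_smul_comm, ← mul_assoc]
    have h1 : x i j * x k l = x k l * x i j + (q - q⁻¹) • (x i l * x k j) := by
      rw [← h.qrel i k j l hik hjl]; abel
    rw [h1]
    simp only [add_mul, smul_smul, smul_mul_assoc, smul_add]
    rw [mul_comm (q ^ e l) (q ^ e j), add_sub_cancel_left]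
    congr 1; ring

lemma tdata {q : K} (hq : q ≠ 0) (x : Fin m → Fin n → A) :
    TData q (fun i j => my q (x i j) j) (fun j => tU A hq j) where
  tt j l hjl := by
    ext f e
    simp only [Module.End.mul_apply, tU_apply, LinearMap.smul_apply, Pi.smul_apply, tw_add hq,
      tw_single, smul_smul]
    rw [if_neg (by omega), if_pos hjl, add_right_comm]
    congr 1
    field_simp
  yt i l := by
    ext f e
    simp only [Module.End.mul_apply, tU_apply, my_apply, LinearMap.smul_apply, Pi.smul_apply,
      smul_smul, mul_smul_comm, Pi.add_apply, Pi.single_eq_same, zpow_add₀ hq]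
    congr 1
    field_simp
  yt' i l j hjl := by
    ext f e
    simp only [Module.End.mul_apply, tU_apply, my_apply,
      smul_smul, mul_smul_comm, Pi.add_apply, Pi.single_eq_of_ne hjl.symm, add_zero]
    congr 1
    ring

/-- linear form on exponents -/
def lam (e : Fin n → ℤ) : ℤ := ∑ j : Fin n, (j : ℤ) * e j

lemma lam_add (e d : Fin n → ℤ) : lam (e + d) = lam e + lam d := by
  simp [lam, mul_add, Finset.sum_add_distrib]

lemma lam_single (l : Fin n) (a : ℤ) : lam (Pi.single l a) = l * a := by
  rw [lam, Finset.sum_eq_single l] <;> simp +contextual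

/-- supported at zero and in negative degrees -/
def Low (f : (Fin n → ℤ) → A) : Prop := ∀ e, e ≠ 0 → 0 ≤ lam e → f e = 0

/-- the new matrix of operators -/
noncomputable def opX {q : K} (hq : q ≠ 0) (x : Fin m → Fin n → A) :
    Fin (m + 1) → Fin n → Module.End K ((Fin n → ℤ) → A) :=
  newX (fun i j => my q (x i j) j) (fun j => tU A hq j)

lemma opX_cast {q : K} (hq : q ≠ 0) (x : Fin m → Fin n → A) (i : Fin m) (j : Fin n)
    (f : (Fin n → ℤ) → A) (hf : Low f) (e : Fin n → ℤ) (he : 0 ≤ lam e) :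
    opX hq x i.castSucc j f e = q ^ e j • (x i j * f e) := by
  rw [opX, newX_cast, ut, us, Finset.sum_mul, LinearMap.sum_apply, Finset.sum_apply,
    Finset.sum_eq_single j]
  · simp only [gg]
    rw [mul_assoc]
    simp [my_apply]
  · intro l hl hlj
    simp only [Finset.mem_filter, Finset.mem_univ, true_and] at hl
    have hlt : j < l := lt_of_le_of_ne hl (Ne.symm hlj)
    simp only [gg, Module.End.mul_apply, my_apply, tU_apply, tU_inv_apply]
    rw [hf]
    · simp
    all_goals
      have h1 : lam (e + Pi.single l 1 + Pi.single j (-1)) = lam e + l - j := by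
        simp [lam_add, lam_single]; ring
      have h2 : (j : ℤ) < l := by exact_mod_cast hlt
    · intro h0; rw [h0] at h1; simp [lam] at h1 he; omega
    · omega
  · intro h; simp at h

/-- word in a matrix -/
def wd {m n : ℕ} (x : Fin m → Fin n → A) (l : List (Fin m × Fin n)) : A :=
  (l.map fun p => x p.1 p.2).prod

lemma wd_map (B : Type*) [Ring B] [Algebra K B] (φ : A →ₐ[K] B) (x : Fin m → Fin n → A)
    (l : List (Fin m × Fin n)) : φ (wd x l) = wd (fun i j => φ (x i j)) l := by
  simp [wd, map_list_prod, List.map_map, Function.comp_def]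

/-- vacuum vector -/
def vac (A : Type*) [Ring A] (n : ℕ) : (Fin n → ℤ) → A := Pi.single 0 1

lemma word_vac {q : K} (hq : q ≠ 0) (x : Fin m → Fin n → A) (l : List (Fin m × Fin n)) :
    Low (wd (opX hq x) (l.map (fun p => (p.1.castSucc, p.2))) (vac A n)) ∧
    wd (opX hq x) (l.map (fun p => (p.1.castSucc, p.2))) (vac A n) 0 = wd x l := by
  induction l with
  | nil =>
    refine ⟨?_, by simp [wd, vac]⟩
    intro e he _; simp [wd, vac, he]
  | cons p l ih =>
    have e1 : wd (opX hq x) ((p :: l).map (fun p => (p.1.castSucc, p.2))) =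
      opX hq x p.1.castSucc p.2 * wd (opX hq x) (l.map (fun p => (p.1.castSucc, p.2))) := by
      simp [wd]
    rw [e1]
    refine ⟨?_, ?_⟩
    · intro e he hle
      rw [Module.End.mul_apply, opX_cast hq x _ _ _ ih.1 e hle, ih.1 e he hle]; simp
    · rw [Module.End.mul_apply, opX_cast hq x _ _ _ ih.1 0 (by simp [lam]), ih.2]
      simp [wd]

/-- count of row list -/
def rc (r : List (Fin n)) : Fin n → ℤ := fun j => (r.count j : ℤ)

lemma row_word {q : K} (hq : q ≠ 0) (x : Fin m → Fin n → A) (r : List (Fin n)) (e : Fin n → ℤ) :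
    ∃ u : K, u ≠ 0 ∧ ∀ f : (Fin n → ℤ) → A,
      wd (opX hq x) (r.map (fun j => (Fin.last m, j))) f e = u • f (e - rc r) := by
  induction r generalizing e with
  | nil => exact ⟨1, one_ne_zero, fun f => by
      have : rc ([] : List (Fin n)) = 0 := by ext; simp [rc]
      simp [wd, this]⟩
  | cons j r ih =>
    obtain ⟨u, hu, h⟩ := ih (e + Pi.single j (-1))
    refine ⟨tw q j e * u, mul_ne_zero (tw_ne hq j e) hu, fun f => ?_⟩
    have e1 : wd (opX hq x) ((j :: r).map (fun j => (Fin.last m, j))) =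
      (tU A hq j : Module.End K ((Fin n → ℤ) → A)) * wd (opX hq x) (r.map (fun j => (Fin.last m, j))) := by
      simp [wd, opX, newX_last]
    rw [e1, Module.End.mul_apply, tU_apply, h, smul_smul]
    congr 2
    ext k
    by_cases hk : k = j
    · subst hk; simp [rc]; ring
    · simp [rc, hk, List.count_cons_of_ne (Ne.symm hk)]

/-- canonical row list -/
noncomputable def rowL (e : Fin n → ℕ) : List (Fin n) := (Finset.univ.toList : List (Fin n)).flatMap fun j => List.replicate (e j) j

lemma rowL_count (e : Fin n → ℕ) (j : Fin n) : (rowL e).count j = e j := by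
  have key : ∀ L : List (Fin n), L.Nodup →
      (L.flatMap fun j => List.replicate (e j) j).count j = if j ∈ L then e j else 0 := by
    intro L
    induction L with
    | nil => simp
    | cons a L ih =>
      intro hL
      rw [List.nodup_cons] at hL
      rw [List.flatMap_cons, List.count_append, ih hL.2, List.count_replicate]
      by_cases h : a = j
      · subst h; simp [hL.1]
      · have : ¬ j = a := fun h' => h h'.symm
        simp [h, this]
  rw [rowL, key _ (Finset.nodup_toList _)]
  simp

end ops

universe u

/-- Existence of a `q`-matrix with linearly independent canonical words. -/
theorem pbw_exists (K : Type u) [Field K] {q : K} (hq : q ≠ 0) (m n : ℕ) :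
    ∃ (A : Type u) (_ : Ring A) (_ : Algebra K A) (x : Fin m → Fin n → A)
      (can : (Fin m × Fin n → ℕ) → List (Fin m × Fin n)),
      IsQM q x ∧ (∀ s p, (can s).count p = s p) ∧ LinearIndependent K (fun s => wd x (can s)) := by
  induction m with
  | zero =>
    refine ⟨K, inferInstance, inferInstance, fun i => i.elim0, fun _ => [],
      ⟨fun i => i.elim0, fun i => i.elim0, fun i => i.elim0, fun i => i.elim0⟩,
      fun _ p => p.1.elim0, ?_⟩
    have hs : Subsingleton (Fin 0 × Fin n → ℕ) := ⟨fun a b => by ext p; exact p.1.elim0⟩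
    rw [linearIndependent_iff']
    intro S g hg i hi
    have : S = {i} := by
      ext j; simp [Subsingleton.elim j i, hi]
    subst this
    simpa [wd] using hg
  | succ m ih =>
    classical
    obtain ⟨A, iR, iA, x, can, hx, hcan, hind⟩ := ih
    let low : (Fin (m + 1) × Fin n → ℕ) → (Fin m × Fin n → ℕ) := fun s p => s (p.1.castSucc, p.2)
    let top : (Fin (m + 1) × Fin n → ℕ) → (Fin n → ℕ) := fun s j => s (Fin.last m, j)
    have hlt : ∀ s s', low s = low s' → top s = top s' → s = s' := by
      intro s s' h1 h2
      ext ⟨i, j⟩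
      refine Fin.lastCases ?_ (fun i => ?_) i
      · exact congrFun h2 j
      · exact congrFun h1 (i, j)
    refine ⟨Module.End K ((Fin n → ℤ) → A), inferInstance, inferInstance, opX hq x,
      fun s => (rowL (top s)).map (fun j => (Fin.last m, j)) ++
        (can (low s)).map (fun p => (p.1.castSucc, p.2)),
      (tdata hq x).isQM_newX hq (isQM_my hq hx), ?_, ?_⟩
    · rintro s ⟨i, j⟩
      rw [List.count_append]
      refine Fin.lastCases ?_ (fun i => ?_) i
      · rw [List.count_map_of_injective _ _ (fun a b h => by simpa using h), rowL_count,
          List.count_eq_zero_of_not_mem]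
        · rfl
        · simp [Fin.castSucc_ne_last]
      · have := List.count_map_of_injective (can (low s))
          (fun p : Fin m × Fin n => (p.1.castSucc, p.2)) (fun a b h => by
            simp only [Prod.mk.injEq, Fin.castSucc_inj] at h; exact Prod.ext h.1 h.2) (i, j)
        rw [this, hcan, List.count_eq_zero_of_not_mem]
        · simp [low]
        · simp [(Fin.castSucc_ne_last _).symm]
    · rw [linearIndependent_iff']
      intro S g hg
      by_contra hne
      push Not at hne
      obtain ⟨s1, hs1, hg1⟩ := hne
      let S' := S.filter (fun s => g s ≠ 0)
      have hS' : S'.Nonempty := ⟨s1, by simp [S', hs1, hg1]⟩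
      obtain ⟨s0, hs0, hmax⟩ := S'.exists_max_image (fun s => lam (fun j => (top s j : ℤ))) hS'
      simp only [S', Finset.mem_filter] at hs0 hmax
      have hrc : ∀ e : Fin n → ℕ, rc (rowL e) = fun j => (e j : ℤ) := by
        intro e; ext j; simp [rc, rowL_count]
      obtain ⟨u, hu, hr⟩ := row_word hq x (rowL (top s0)) (fun j => (top s0 j : ℤ))
      have h0 := congrFun (congrArg (fun T => T (vac A n)) hg) (fun j => (top s0 j : ℤ))
      simp only [LinearMap.sum_apply, Finset.sum_apply, LinearMap.smul_apply, Pi.smul_apply,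
        LinearMap.zero_apply, Pi.zero_apply] at h0
      have h1 : ∑ s ∈ S.filter (fun s => top s = top s0), g s • (u • wd x (can (low s))) = 0 := by
        rw [← h0, Finset.sum_filter]
        refine Finset.sum_congr rfl fun s hs => ?_
        have hw : wd (opX hq x) ((rowL (top s)).map (fun j => (Fin.last m, j)) ++
          (can (low s)).map (fun p => (p.1.castSucc, p.2))) =
          wd (opX hq x) ((rowL (top s)).map (fun j => (Fin.last m, j))) *
          wd (opX hq x) ((can (low s)).map (fun p => (p.1.castSucc, p.2))) := by simp [wd]
        rw [hw, Module.End.mul_apply]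
        split_ifs with h
        · rw [h, hr, hrc, sub_self, (word_vac hq x _).2]
        · by_cases hgs : g s = 0
          · simp [hgs]
          obtain ⟨u', hu', hr'⟩ := row_word hq x (rowL (top s)) (fun j => (top s0 j : ℤ))
          rw [hr', (word_vac hq x _).1]
          · simp
          · rw [hrc]
            intro h2
            apply h
            ext j
            have := congrFun h2 j
            simp at this; omega
          · have := hmax s ⟨hs, hgs⟩
            have e1 : lam (fun j => (top s0 j : ℤ)) = lam (fun j => (top s0 j : ℤ) - (top s j : ℤ)) +
              lam (fun j => (top s j : ℤ)) := by
              rw [← lam_add]; congr 1; ext j; simp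
            rw [hrc]
            change 0 ≤ lam (fun j => (top s0 j : ℤ) - (top s j : ℤ))
            omega
      have hinj : Function.Injective (fun s : {s // top s = top s0} => low s.1) := fun a b hab =>
        Subtype.ext (hlt _ _ hab (a.2.trans b.2.symm))
      have hind2 := hind.comp _ hinj
      rw [linearIndependent_iff'] at hind2
      have := hind2 (S.subtype (fun s => top s = top s0)) (fun s => g s.1 * u) (by
        simp only [Function.comp_apply]
        rw [Finset.sum_subtype_eq_sum_filter (f := fun s => (g s * u) • wd x (can (low s)))]
        simpa [smul_smul] using h1) ⟨s0, rfl⟩ (by simpa using hs0.1)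
      simp [hu] at this
      exact hs0.2 this

/-- PBW: independent canonical words in `QMat`. -/
theorem pbw {K : Type*} [Field K] {q : K} (hq : q ≠ 0) (m n : ℕ) :
    ∃ (can : (Fin m × Fin n → ℕ) → List (Fin m × Fin n)),
      (∀ s p, (can s).count p = s p) ∧
      LinearIndependent K (fun s => wd (fun i j => X K q (m := m) (n := n) i j) (can s)) := by
  obtain ⟨A, iR, iA, x, can, hx, hcan, hind⟩ := pbw_exists K hq m n
  refine ⟨can, hcan, ?_⟩
  apply LinearIndependent.of_comp (qlift hx).toLinearMap
  have e1 : ((qlift hx).toLinearMap ∘ fun s => wd (fun i j => X K q (m := m) (n := n) i j) (can s))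
      = fun s => wd x (can s) := by
    ext s; simp [wd_map, qlift_X]
  rw [e1]; exact hind

end QG


open scoped BigOperators
namespace QG
variable {K : Type*} [Field K] {A : Type*} [Ring A] [Algebra K A]

section filt
variable {n m : ℕ}

/-- strictly supermodular weights -/
def SM (W : Fin m × Fin n → ℕ) : Prop :=
  ∀ i k j l, i < k → j < l → W (i, l) + W (k, j) < W (i, j) + W (k, l)

/-- weight of a word -/
def Wl (W : Fin m × Fin n → ℕ) (l : List (Fin m × Fin n)) : ℕ := (l.map W).sum

/-- weight of an exponent -/
def Ws (W : Fin m × Fin n → ℕ) (s : Fin m × Fin n → ℕ) : ℕ := ∑ p, s p * W p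

lemma Wl_count (W : Fin m × Fin n → ℕ) (l : List (Fin m × Fin n)) :
    Wl W l = Ws W (fun p => l.count p) := by
  induction l with
  | nil => simp [Wl, Ws]
  | cons a l ih =>
    have : Wl W (a :: l) = W a + Wl W l := by simp [Wl]
    rw [this, ih]
    simp only [Ws, List.count_cons, add_mul, Finset.sum_add_distrib]
    simp [add_comm]

/-- elements of weight less than `w` -/
def Vlt (K : Type*) [Field K] {A : Type*} [Ring A] [Algebra K A] {m n : ℕ}
    (x : Fin m → Fin n → A) (W : Fin m × Fin n → ℕ) (w : ℕ) : Submodule K A :=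
  Submodule.span K {a | ∃ l, Wl W l < w ∧ a = wd x l}

variable {x : Fin m → Fin n → A} {W : Fin m × Fin n → ℕ}

lemma wd_append (l l' : List (Fin m × Fin n)) : wd x (l ++ l') = wd x l * wd x l' := by
  simp [wd]

lemma wd_cons (p : Fin m × Fin n) (l : List (Fin m × Fin n)) :
    wd x (p :: l) = x p.1 p.2 * wd x l := by
  simp [wd]

lemma Wl_append (l l' : List (Fin m × Fin n)) : Wl W (l ++ l') = Wl W l + Wl W l' := by
  simp [Wl]

lemma Wl_cons (p : Fin m × Fin n) (l : List (Fin m × Fin n)) : Wl W (p :: l) = W p + Wl W l := by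
  simp [Wl]

lemma Wl_perm {l l' : List (Fin m × Fin n)} (h : l.Perm l') : Wl W l = Wl W l' :=
  (h.map W).sum_eq

lemma Vlt_mono {w w' : ℕ} (h : w ≤ w') : Vlt K x W w ≤ Vlt K x W w' :=
  Submodule.span_mono fun _ ⟨l, hl, e⟩ => ⟨l, hl.trans_le h, e⟩

lemma wd_mem_Vlt {l : List (Fin m × Fin n)} {w : ℕ} (h : Wl W l < w) : wd x l ∈ Vlt K x W w :=
  Submodule.subset_span ⟨l, h, rfl⟩

lemma wd_mul_Vlt {a : A} {w : ℕ} (ha : a ∈ Vlt K x W w) (l : List (Fin m × Fin n)) (w' : ℕ)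
    (h : w + Wl W l ≤ w') : wd x l * a ∈ Vlt K x W w' := by
  induction ha using Submodule.span_induction with
  | mem a ha =>
    obtain ⟨l', hl', rfl⟩ := ha
    rw [← wd_append]; exact wd_mem_Vlt (by rw [Wl_append]; omega)
  | zero => simp
  | add a b _ _ h1 h2 => rw [mul_add]; exact add_mem h1 h2
  | smul c a _ h1 => rw [mul_smul_comm]; exact Submodule.smul_mem _ _ h1

lemma Vlt_mul_wd {a : A} {w : ℕ} (ha : a ∈ Vlt K x W w) (l : List (Fin m × Fin n)) (w' : ℕ)
    (h : w + Wl W l ≤ w') : a * wd x l ∈ Vlt K x W w' := by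
  induction ha using Submodule.span_induction with
  | mem a ha =>
    obtain ⟨l', hl', rfl⟩ := ha
    rw [← wd_append]; exact wd_mem_Vlt (by rw [Wl_append]; omega)
  | zero => simp
  | add a b _ _ h1 h2 => rw [add_mul]; exact add_mem h1 h2
  | smul c a _ h1 => rw [smul_mul_assoc]; exact Submodule.smul_mem _ _ h1

lemma Vlt_mul_Vlt {a b : A} {w w' w'' : ℕ} (ha : a ∈ Vlt K x W w) (hb : b ∈ Vlt K x W w')
    (h : w + w' ≤ w'' + 1) : a * b ∈ Vlt K x W w'' := by
  induction ha using Submodule.span_induction with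
  | mem a ha =>
    obtain ⟨l', hl', rfl⟩ := ha
    exact wd_mul_Vlt hb l' w'' (by omega)
  | zero => simp
  | add a b _ _ h1 h2 => rw [add_mul]; exact add_mem h1 h2
  | smul c a _ h1 => rw [smul_mul_assoc]; exact Submodule.smul_mem _ _ h1

lemma swap_rel {q : K} (hq : q ≠ 0) (hx : IsQM q x) (hW : SM W) (p r : Fin m × Fin n) :
    ∃ c : K, c ≠ 0 ∧ wd x [p, r] - c • wd x [r, p] ∈ Vlt K x W (W p + W r) := by
  obtain ⟨i, j⟩ := p
  obtain ⟨k, l⟩ := r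
  simp only [wd, List.map_cons, List.map_nil, List.prod_cons, List.prod_nil, mul_one]
  have inv : ∀ {a b : A}, a * b = q • (b * a) → b * a - q⁻¹ • (a * b) = 0 := by
    intro a b h; rw [h, smul_smul, inv_mul_cancel₀ hq]; simp
  have hlow : ∀ {i k j l}, i < k → j < l → x i l * x k j ∈ Vlt K x W (W (i, j) + W (k, l)) := by
    intro i k j l hik hjl
    have := wd_mem_Vlt (K := K) (x := x) (W := W) (l := [(i, l), (k, j)])
      (w := W (i, j) + W (k, l)) (by simpa [Wl] using hW i k j l hik hjl)
    simpa [wd] using this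
  rcases lt_trichotomy i k with hik | rfl | hik <;> rcases lt_trichotomy j l with hjl | rfl | hjl
  · refine ⟨1, one_ne_zero, ?_⟩
    rw [one_smul, hx.qrel i k j l hik hjl]
    exact Submodule.smul_mem _ _ (hlow hik hjl)
  · exact ⟨q, hq, by rw [hx.col i k j hik]; simp⟩
  · exact ⟨1, one_ne_zero, by rw [hx.comm k i l j hik hjl]; simp⟩
  · exact ⟨q, hq, by rw [hx.row i j l hjl]; simp⟩
  · exact ⟨1, one_ne_zero, by simp⟩
  · exact ⟨q⁻¹, inv_ne_zero hq, by rw [inv (hx.row i l j hjl)]; simp⟩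
  · exact ⟨1, one_ne_zero, by rw [hx.comm i k j l hik hjl]; simp⟩
  · exact ⟨q⁻¹, inv_ne_zero hq, by rw [inv (hx.col k i j hik)]; simp⟩
  · refine ⟨1, one_ne_zero, ?_⟩
    rw [one_smul, ← neg_sub, hx.qrel k i l j hik hjl, add_comm]
    exact neg_mem (Submodule.smul_mem _ _ (hlow hik hjl))

lemma perm_rel {q : K} (hq : q ≠ 0) (hx : IsQM q x) (hW : SM W) {l l' : List (Fin m × Fin n)}
    (h : l.Perm l') : ∃ c : K, c ≠ 0 ∧ wd x l - c • wd x l' ∈ Vlt K x W (Wl W l) := by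
  induction h with
  | nil => exact ⟨1, one_ne_zero, by simp⟩
  | @cons p l₁ l₂ h ih =>
    obtain ⟨c, hc, h1⟩ := ih
    refine ⟨c, hc, ?_⟩
    have := wd_mul_Vlt h1 [p] (Wl W (p :: l₁)) (by rw [Wl_cons, add_comm]; simp [Wl])
    simpa [wd_cons, mul_sub, wd] using this
  | swap p r l =>
    obtain ⟨c, hc, h1⟩ := swap_rel hq hx hW r p
    refine ⟨c, hc, ?_⟩
    have := Vlt_mul_wd h1 l (Wl W (r :: p :: l)) (by simp [Wl_cons, add_assoc])
    simpa [wd, sub_mul, mul_assoc] using this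
  | trans h1 h2 ih1 ih2 =>
    obtain ⟨c, hc, h3⟩ := ih1
    obtain ⟨d, hd, h4⟩ := ih2
    refine ⟨c * d, mul_ne_zero hc hd, ?_⟩
    rw [← Wl_perm h1] at h4
    have := add_mem h3 (Submodule.smul_mem _ c h4)
    convert this using 1
    rw [smul_sub, smul_smul]; abel

/-- canonical words -/
def IsCan (can : (Fin m × Fin n → ℕ) → List (Fin m × Fin n)) : Prop := ∀ s p, (can s).count p = s p

variable {can : (Fin m × Fin n → ℕ) → List (Fin m × Fin n)}

lemma IsCan.Wl (hc : IsCan can) (s : Fin m × Fin n → ℕ) : Wl W (can s) = Ws W s := by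
  rw [Wl_count]; congr 1; ext p; exact hc s p

lemma IsCan.perm (hc : IsCan can) {s : Fin m × Fin n → ℕ} {l : List (Fin m × Fin n)}
    (h : ∀ p, l.count p = s p) : l.Perm (can s) := by
  rw [List.perm_iff_count]; intro p; rw [h, hc]

/-- `V_{<w}` is spanned by canonical words, possibly avoiding a given set -/
lemma Vlt_le_span {q : K} (hq : q ≠ 0) (hx : IsQM q x) (hW : SM W) (hc : IsCan can)
    (Bad : (Fin m × Fin n → ℕ) → Prop)
    (hBad : ∀ s, Bad s → ∃ l, (∀ p, l.count p = s p) ∧ wd x l ∈ Vlt K x W (Ws W s)) (w : ℕ) :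
    Vlt K x W w ≤ Submodule.span K {a | ∃ s, Ws W s < w ∧ ¬ Bad s ∧ a = wd x (can s)} := by
  induction w with
  | zero =>
    refine Submodule.span_le.2 ?_
    rintro _ ⟨l, hl, rfl⟩; omega
  | succ w ih =>
    have ih' : Vlt K x W w ≤ Submodule.span K {a | ∃ s, Ws W s < w + 1 ∧ ¬ Bad s ∧ a = wd x (can s)} :=
      ih.trans (Submodule.span_mono fun _ ⟨s, h1, h2⟩ => ⟨s, by omega, h2⟩)
    refine Submodule.span_le.2 ?_
    rintro _ ⟨l, hl, rfl⟩
    rcases Nat.lt_or_ge (Wl W l) w with hlw | hlw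
    · exact ih' (wd_mem_Vlt hlw)
    have hlw : Wl W l = w := by omega
    by_cases hb : Bad (fun p => l.count p)
    · obtain ⟨l', hl', hm⟩ := hBad _ hb
      obtain ⟨c, hc0, h1⟩ := perm_rel hq hx hW (List.perm_iff_count.2 fun p => (hl' p).symm)
      rw [← Wl_count, hlw] at hm
      rw [hlw] at h1
      have := ih' (add_mem h1 (Submodule.smul_mem _ c hm))
      simpa using this
    · obtain ⟨c, hc0, h1⟩ := perm_rel hq hx hW (hc.perm (l := l) fun p => rfl)
      rw [hlw] at h1
      have h2 : wd x (can (fun p => l.count p)) ∈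
        Submodule.span K {a | ∃ s, Ws W s < w + 1 ∧ ¬ Bad s ∧ a = wd x (can s)} :=
        Submodule.subset_span ⟨_, by rw [← Wl_count]; omega, hb, rfl⟩
      have := add_mem (ih' h1) (Submodule.smul_mem _ c h2)
      simpa using this

/-- leading exponent -/
def Lead (K : Type*) [Field K] {A : Type*} [Ring A] [Algebra K A] {m n : ℕ}
    (x : Fin m → Fin n → A) (W : Fin m × Fin n → ℕ) (a : A) (s : Fin m × Fin n → ℕ) : Prop :=
  ∃ (c : K) (l : List (Fin m × Fin n)), c ≠ 0 ∧ (∀ p, l.count p = s p) ∧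
    a - c • wd x l ∈ Vlt K x W (Ws W s)

lemma Ws_add (s t : Fin m × Fin n → ℕ) : Ws W (s + t) = Ws W s + Ws W t := by
  simp [Ws, add_mul, Finset.sum_add_distrib]

lemma Lead.one : Lead K x W 1 0 :=
  ⟨1, [], one_ne_zero, by simp, by simp [wd]⟩

lemma Lead.mul {a b : A} {s t : Fin m × Fin n → ℕ} (ha : Lead K x W a s) (hb : Lead K x W b t) :
    Lead K x W (a * b) (s + t) := by
  obtain ⟨c, l, hc, hl, h⟩ := ha
  obtain ⟨d, l', hd, hl', h'⟩ := hb
  refine ⟨c * d, l ++ l', mul_ne_zero hc hd, fun p => by simp [hl, hl'], ?_⟩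
  have el : Wl W l = Ws W s := by rw [Wl_count]; congr 1; ext p; exact hl p
  have el' : Wl W l' = Ws W t := by rw [Wl_count]; congr 1; ext p; exact hl' p
  have e : a * b - (c * d) • wd x (l ++ l') = (a - c • wd x l) * (b - d • wd x l') +
      ((a - c • wd x l) * (d • wd x l') + (c • wd x l) * (b - d • wd x l')) := by
    rw [wd_append]
    simp only [sub_mul, mul_sub, smul_mul_assoc, mul_smul_comm, smul_sub, smul_smul]
    rw [mul_comm d c]
    abel
  rw [e, Ws_add]
  refine add_mem ?_ (add_mem ?_ ?_)
  · exact Vlt_mul_Vlt h h' (by omega)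
  · rw [mul_smul_comm]; exact Submodule.smul_mem _ _ (Vlt_mul_wd h _ _ (by omega))
  · rw [smul_mul_assoc]; exact Submodule.smul_mem _ _ (wd_mul_Vlt h' _ _ (by omega))

lemma Lead.pow {a : A} {s : Fin m × Fin n → ℕ} (ha : Lead K x W a s) (k : ℕ) :
    Lead K x W (a ^ k) (k • s) := by
  induction k with
  | zero => simpa using Lead.one
  | succ k ih => rw [pow_succ, succ_nsmul]; exact ih.mul ha

lemma Lead.list_prod {ι : Type*} (L : List ι) (a : ι → A) (s : ι → Fin m × Fin n → ℕ)
    (h : ∀ i, Lead K x W (a i) (s i)) : Lead K x W (L.map a).prod (L.map s).sum := by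
  induction L with
  | nil => simpa using Lead.one
  | cons i L ih => simpa using (h i).mul ih

/-- canonical words span the generated subalgebra -/
lemma wd_mem_span {q : K} (hq : q ≠ 0) (hx : IsQM q x) (hW : SM W) (hc : IsCan can)
    (l : List (Fin m × Fin n)) : wd x l ∈ Submodule.span K (Set.range fun s => wd x (can s)) := by
  have := Vlt_le_span hq hx hW hc (fun _ => False) (fun _ h => h.elim) _
    (wd_mem_Vlt (K := K) (x := x) (W := W) (l := l) (Nat.lt_succ_self _))
  refine Submodule.span_mono ?_ this
  rintro _ ⟨s, _, _, rfl⟩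
  exact ⟨s, rfl⟩

lemma SM_mul : SM (fun p : Fin m × Fin n => (p.1 : ℕ) * p.2) := by
  intro i k j l hik hjl
  have h1 : (i : ℕ) < k := hik
  have h2 : (j : ℕ) < l := hjl
  simp only
  nlinarith [mul_pos (Nat.sub_pos_of_lt h1) (Nat.sub_pos_of_lt h2), Nat.add_sub_of_le h1.le, Nat.add_sub_of_le h2.le]

/-- span of words is the subalgebra generated -/
lemma adjoin_eq_span_wd (x : Fin m → Fin n → A) :
    Subalgebra.toSubmodule (Algebra.adjoin K (Set.range fun p : Fin m × Fin n => x p.1 p.2)) =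
      Submodule.span K (Set.range (wd x)) := by
  rw [Algebra.adjoin_eq_span]
  congr 1
  ext a
  simp only [SetLike.mem_coe]
  constructor
  · intro h
    induction h using Submonoid.closure_induction with
    | mem a ha => obtain ⟨p, rfl⟩ := ha; exact ⟨[p], by simp [wd]⟩
    | one => exact ⟨[], by simp [wd]⟩
    | mul a b _ _ h1 h2 =>
      obtain ⟨l, rfl⟩ := h1
      obtain ⟨l', rfl⟩ := h2
      exact ⟨l ++ l', wd_append l l'⟩
  · rintro ⟨l, rfl⟩
    refine Submonoid.list_prod_mem _ ?_
    intro a ha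
    rw [List.mem_map] at ha
    obtain ⟨p, _, rfl⟩ := ha
    exact Submonoid.subset_closure ⟨p, rfl⟩

lemma adjoin_X (q : K) (m n : ℕ) :
    Algebra.adjoin K (Set.range fun p : Fin m × Fin n => X K q p.1 p.2) = ⊤ := by
  have h1 : (Set.range fun p : Fin m × Fin n => X K q p.1 p.2) =
    (RingQuot.mkAlgHom K (QMatRel K q m n)) '' (Set.range (FreeAlgebra.ι K)) := by
    rw [← Set.range_comp]; rfl
  rw [h1, ← AlgHom.map_adjoin, FreeAlgebra.adjoin_range_ι, Algebra.map_top, AlgHom.range_eq_top]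
  exact RingQuot.mkAlgHom_surjective K _

lemma span_can_X {q : K} (hq : q ≠ 0) (hc : IsCan can) :
    Submodule.span K (Set.range fun s => wd (fun i j => X K q (m := m) (n := n) i j) (can s)) = ⊤ := by
  rw [eq_top_iff, ← Algebra.top_toSubmodule, ← adjoin_X, adjoin_eq_span_wd (fun i j => X K q i j)]
  refine Submodule.span_le.2 ?_
  rintro _ ⟨l, rfl⟩
  exact wd_mem_span hq (isQM_X q m n) SM_mul hc l

/-- elements with distinct leading exponents are independent -/
theorem lead_indep {q : K} (hq : q ≠ 0) (hW : SM W) {ι : Type*} (a : ι → QMat K q m n)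
    (s : ι → Fin m × Fin n → ℕ) (hs : Function.Injective s)
    (h : ∀ i, Lead K (fun i j => X K q i j) W (a i) (s i)) : LinearIndependent K a := by
  classical
  obtain ⟨can, hc, hind⟩ := pbw hq m n
  let b := Module.Basis.mk hind (span_can_X hq hc).ge
  have hb : ∀ s, b s = wd (fun i j => X K q (m := m) (n := n) i j) (can s) := fun s => by simp [b]
  -- coordinates vanish on lower weights
  have hlow : ∀ t w, w ≤ Ws W t → ∀ v ∈ Vlt K (fun i j => X K q (m := m) (n := n) i j) W w,
      b.coord t v = 0 := by
    intro t w hw v hv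
    have h1 := Vlt_le_span hq (isQM_X q m n) hW hc (fun _ => False) (fun _ h => h.elim) _ hv
    have h2 : Submodule.span K {a | ∃ s, Ws W s < w ∧ ¬ False ∧
        a = wd (fun i j => X K q (m := m) (n := n) i j) (can s)} ≤ LinearMap.ker (b.coord t) := by
      refine Submodule.span_le.2 ?_
      rintro _ ⟨s, hs, -, rfl⟩
      rw [SetLike.mem_coe, LinearMap.mem_ker, ← hb, Module.Basis.coord_apply,
        Module.Basis.repr_self, Finsupp.single_apply, if_neg]
      rintro rfl; omega
    exact h2 h1
  have hlead : ∀ i, ∃ c : K, c ≠ 0 ∧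
      a i - c • b (s i) ∈ Vlt K (fun i j => X K q (m := m) (n := n) i j) W (Ws W (s i)) := by
    intro i
    obtain ⟨c, l, hc0, hl, hm⟩ := h i
    obtain ⟨d, hd, hp⟩ := perm_rel hq (isQM_X q m n) hW (IsCan.perm hc hl)
    have el : Wl W l = Ws W (s i) := by rw [Wl_count]; congr 1; ext p; exact hl p
    refine ⟨c * d, mul_ne_zero hc0 hd, ?_⟩
    rw [el] at hp
    have := add_mem hm (Submodule.smul_mem _ c hp)
    convert this using 1
    rw [hb, smul_sub, smul_smul]; abel
  rw [linearIndependent_iff']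
  intro S g hg
  by_contra hne
  push Not at hne
  obtain ⟨i1, hi1, hg1⟩ := hne
  obtain ⟨i0, hi0, hmax⟩ := (S.filter (fun i => g i ≠ 0)).exists_max_image (fun i => Ws W (s i))
    ⟨i1, by simp [hi1, hg1]⟩
  simp only [Finset.mem_filter] at hi0 hmax
  have h0 := congrArg (b.coord (s i0)) hg
  rw [map_sum, map_zero, Finset.sum_eq_single i0] at h0
  · obtain ⟨c, hc0, hm⟩ := hlead i0
    have h1 := hlow (s i0) _ le_rfl _ hm
    rw [map_sub, sub_eq_zero] at h1
    rw [map_smul, h1] at h0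
    simp [hc0] at h0
    exact hi0.2 h0
  · intro i hi hii
    by_cases hgi : g i = 0
    · simp [hgi]
    obtain ⟨c, hc0, hm⟩ := hlead i
    have h1 := hlow (s i0) _ (hmax i ⟨hi, hgi⟩) _ hm
    rw [map_sub, sub_eq_zero] at h1
    rw [map_smul, h1, map_smul, Module.Basis.coord_apply, Module.Basis.repr_self,
      Finsupp.single_apply, if_neg (fun h => hii (hs h))]
    simp
  · intro h; exact absurd hi0.1 h

end filt
end QG


open scoped BigOperators
namespace QG
variable {K : Type*} [Field K] {A : Type*} [Ring A] [Algebra K A]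

section lead
variable {n m : ℕ}

/-- standard supermodular weight -/
def W0 (m n : ℕ) : Fin m × Fin n → ℕ := fun p => (p.1 : ℕ) * p.2

lemma perm_eq_one_of_mono (σ : Equiv.Perm (Fin m)) (h : Monotone σ) : σ = 1 := by
  have h1 : StrictMono σ := h.strictMono_of_injective σ.injective
  have h2 : (σ : Fin m → Fin m) = id := (h1.range_inj strictMono_id).1 (by simp)
  ext i; simp [h2]

lemma rearr (J : Fin m → Fin n) (hJ : StrictMono J) (σ : Equiv.Perm (Fin m)) (hσ : σ ≠ 1) :
    ∑ k, ((σ k : Fin m) : ℕ) * (J k : ℕ) < ∑ k : Fin m, (k : ℕ) * (J k : ℕ) := by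
  have hm : Monovary (fun k : Fin m => (k : ℕ)) (fun k => (J k : ℕ)) := by
    intro a b hab
    have : J a < J b := hab
    exact (hJ.lt_iff_lt.1 this).le
  refine (hm.sum_comp_perm_mul_lt_sum_mul_iff (σ := σ)).2 fun h => hσ ?_
  apply perm_eq_one_of_mono
  intro a b hab
  rcases hab.eq_or_lt with rfl | hab
  · rfl
  · exact h (hJ hab)

/-- exponent of the diagonal of a minor -/
def dg (J : Fin m → Fin n) : Fin m × Fin n → ℕ := fun p => if p.2 = J p.1 then 1 else 0

lemma count_diag (J : Fin m → Fin n) (p : Fin m × Fin n) :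
    (List.ofFn fun k => (k, J k)).count p = dg J p := by
  unfold dg
  split_ifs with h
  · refine List.count_eq_one_of_mem ?_ ?_
    · rw [List.nodup_ofFn]; intro a b h; simpa using congrArg Prod.fst h
    · rw [List.mem_ofFn]; exact ⟨p.1, by ext <;> simp [h]⟩
  · refine List.count_eq_zero_of_not_mem ?_
    rw [List.mem_ofFn]; rintro ⟨k, rfl⟩; exact h rfl

lemma grMinor_image (q : K) (J : Fin m → Fin n) (hJ : StrictMono J) :
    grMinor K q m (Finset.univ.image J) =
      ∑ σ : Equiv.Perm (Fin m), ((-q) ^ invCount σ) •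
        wd (fun i j => X K q (m := m) (n := n) i j) (List.ofFn fun k => (σ k, J k)) := by
  have hc : (Finset.univ.image J).card = m := by
    rw [Finset.card_image_of_injective _ hJ.injective]; simp
  have h1 : J = (Finset.univ.image J).orderEmbOfFin hc :=
    Finset.orderEmbOfFin_unique hc (fun x => by simp) hJ
  rw [grMinor, dif_pos hc, qMinor, ← h1]
  refine Finset.sum_congr rfl fun σ _ => ?_
  rw [wd, List.map_ofFn]
  rfl

lemma lead_minor (q : K) (J : Fin m → Fin n) (hJ : StrictMono J) :
    Lead K (fun i j => X K q (m := m) (n := n) i j) (W0 m n)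
      (grMinor K q m (Finset.univ.image J)) (dg J) := by
  refine ⟨1, List.ofFn fun k => (k, J k), one_ne_zero, count_diag J, ?_⟩
  have hW : Ws (W0 m n) (dg J) = ∑ k : Fin m, (k : ℕ) * (J k : ℕ) := by
    rw [← funext (count_diag J), ← Wl_count, Wl, List.map_ofFn, List.sum_ofFn]
    rfl
  rw [grMinor_image q J hJ, ← Finset.add_sum_erase _ _ (Finset.mem_univ 1)]
  have h1 : invCount (1 : Equiv.Perm (Fin m)) = 0 := by
    rw [invCount, Finset.card_eq_zero, Finset.filter_eq_empty_iff]
    rintro ⟨a, b⟩ _ ⟨h1, h2⟩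
    exact absurd h1 (not_lt.2 (le_of_lt h2))
  rw [h1, pow_zero]
  simp only [Equiv.Perm.coe_one, id_eq, add_sub_cancel_left]
  refine Submodule.sum_mem _ fun σ hσ => Submodule.smul_mem _ _ (wd_mem_Vlt ?_)
  rw [hW, Wl, List.map_ofFn, List.sum_ofFn]
  exact rearr J hJ σ (Finset.ne_of_mem_erase hσ)

end lead

section rect
variable {m n : ℕ}

/-- column function of the rectangle-type index set -/
def rJ (hmn : m < n) (p : Fin m × Fin (n - m)) (r : Fin m) : Fin n :=
  ⟨if r < p.1 then r else r + 1 + p.2, by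
    have := p.2.2; have := r.2; split_ifs <;> omega⟩

/-- base column function -/
def bJ (hmn : m < n) (r : Fin m) : Fin n := ⟨r, by have := r.2; omega⟩

lemma rJ_mono (hmn : m < n) (p : Fin m × Fin (n - m)) : StrictMono (rJ hmn p) := by
  intro a b hab
  have h : (a : ℕ) < b := hab
  rw [Fin.lt_def]
  simp only [rJ]
  split_ifs with h1 h2 h2
  · exact h
  · omega
  · rw [Fin.lt_def] at h1 h2; omega
  · omega

lemma bJ_mono (hmn : m < n) : StrictMono (bJ hmn) := by
  intro a b hab
  exact hab

/-- test products -/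
noncomputable def gf (K : Type*) [Field K] (q : K) (hmn : m < n) (T : ℕ) (f : Fin m × Fin (n - m) → ℕ) :
    ↥(qGrass K q m n) :=
  (((Finset.univ.toList : List (Fin m × Fin (n - m))).map fun p =>
    grE K q m (Finset.univ.image (rJ hmn p)) ^ f p)).prod *
      grE K q m (Finset.univ.image (bJ hmn)) ^ (T - ∑ p, f p)

/-- leading exponents of test products -/
def gs (hmn : m < n) (T : ℕ) (f : Fin m × Fin (n - m) → ℕ) : Fin m × Fin n → ℕ :=
  (∑ p, f p • dg (rJ hmn p)) + (T - ∑ p, f p) • dg (bJ hmn)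

lemma gf_lead (q : K) (hmn : m < n) (T : ℕ) (f : Fin m × Fin (n - m) → ℕ) :
    Lead K (fun i j => X K q (m := m) (n := n) i j) (W0 m n)
      (gf K q hmn T f : QMat K q m n) (gs hmn T f) := by
  have h1 := Lead.list_prod (K := K) (x := (fun i j => X K q (m := m) (n := n) i j))
    (W := W0 m n) (Finset.univ.toList : List (Fin m × Fin (n - m)))
    (fun p => grMinor K q m (Finset.univ.image (rJ hmn p)) ^ f p)
    (fun p => f p • dg (rJ hmn p)) (fun p => (lead_minor q _ (rJ_mono hmn p)).pow (f p))
  have h2 := h1.mul ((lead_minor q _ (bJ_mono hmn)).pow (T - ∑ p, f p))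
  rw [Finset.sum_map_toList] at h2
  convert h2 using 1
  rotate_left
  · rfl
  simp [gf, grE, Function.comp_def]

lemma gs_apply (hmn : m < n) (T : ℕ) (f : Fin m × Fin (n - m) → ℕ) (r : Fin m) (c : Fin (n - m)) :
    gs hmn T f (r, ⟨r + 1 + c, by omega⟩) = ∑ k ∈ Finset.univ.filter (fun k : Fin m => k ≤ r), f (k, c) := by
  simp only [gs, Pi.add_apply, Finset.sum_apply, Pi.smul_apply, smul_eq_mul, dg, rJ, bJ, Fin.mk.injEq]
  rw [if_neg (by omega), mul_zero, add_zero, Fintype.sum_prod_type, Finset.sum_filter]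
  refine Finset.sum_congr rfl fun k _ => ?_
  rw [Finset.sum_eq_single c]
  · split_ifs with h1 h2 <;> simp_all <;> omega
  · intro b _ hb
    have : (b : ℕ) ≠ c := fun h => hb (Fin.ext h)
    split_ifs <;> simp_all <;> omega
  · simp

lemma gs_inj (hmn : m < n) (T : ℕ) : Function.Injective (gs hmn T) := by
  intro f g h
  have h1 : ∀ r c, ∑ k ∈ Finset.univ.filter (fun k : Fin m => k ≤ r), f (k, c) =
    ∑ k ∈ Finset.univ.filter (fun k : Fin m => k ≤ r), g (k, c) := fun r c => by
    rw [← gs_apply hmn T, ← gs_apply hmn T, h]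
  ext ⟨r, c⟩
  induction r using WellFoundedLT.induction with
  | _ r ih =>
    have h2 := h1 r c
    have e : (Finset.univ.filter (fun k : Fin m => k ≤ r)) =
      insert r (Finset.univ.filter (fun k : Fin m => k < r)) := by ext k; simp [le_iff_eq_or_lt]
    rw [e, Finset.sum_insert (by simp), Finset.sum_insert (by simp),
      Finset.sum_congr rfl (fun k hk => ih k (by simpa using hk))] at h2
    omega

theorem gf_indep {q : K} (hq : q ≠ 0) (hmn : m < n) (T : ℕ) : LinearIndependent K (gf K q hmn T) := by
  have := lead_indep hq (W := W0 m n) SM_mul (fun f => (gf K q hmn T f : QMat K q m n)) (gs hmn T)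
    (gs_inj hmn T) (gf_lead q hmn T)
  exact LinearIndependent.of_comp (qGrass K q m n).val.toLinearMap this

end rect
end QG


open scoped BigOperators
namespace QG
variable {K : Type*} [Field K] {A : Type*} [Ring A] [Algebra K A]

section cnt
variable {n m : ℕ}

lemma exists_W (S : Finset (Fin m × Fin n → ℕ)) :
    ∃ W : Fin m × Fin n → ℕ, SM W ∧ (∀ p, 1 ≤ W p) ∧ Set.InjOn (Ws W) (S : Set (Fin m × Fin n → ℕ)) := by
  classical
  obtain ⟨z, hz⟩ : ∃ z : ℕ, 0 < z ∧ ∀ s ∈ S, ∀ p, s p < z := by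
    refine ⟨(∑ s ∈ S, ∑ p, s p) + 1, by omega, fun s hs p => ?_⟩
    have h1 : s p ≤ ∑ p, s p := Finset.single_le_sum (f := s) (fun _ _ => Nat.zero_le _) (Finset.mem_univ p)
    have h2 : ∑ p, s p ≤ ∑ s ∈ S, ∑ p, s p :=
      Finset.single_le_sum (f := fun s : Fin m × Fin n → ℕ => ∑ p, s p) (fun _ _ => Nat.zero_le _) hs
    omega
  obtain ⟨hz0, hz⟩ := hz
  set d := m * n
  let W : Fin m × Fin n → ℕ := fun p => z ^ d * (3 * ((p.1 : ℕ) * p.2)) + z ^ (finProdFinEquiv p : ℕ)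
  have hzd : ∀ p : Fin m × Fin n, z ^ (finProdFinEquiv p : ℕ) ≤ z ^ d := fun p =>
    Nat.pow_le_pow_right hz0 (finProdFinEquiv p).2.le
  have hzd0 : 0 < z ^ d := Nat.pow_pos hz0
  refine ⟨W, ?_, ?_, ?_⟩
  · intro i k j l hik hjl
    have h1 := SM_mul (m := m) (n := n) i k j l hik hjl
    have h2 := hzd (i, l)
    have h3 := hzd (k, j)
    simp only [W] at h1 ⊢
    have h4 := Nat.mul_le_mul_left (z ^ d) (show 3 * ((i : ℕ) * l) + 3 * ((k : ℕ) * j) + 3 ≤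
      3 * ((i : ℕ) * j) + 3 * ((k : ℕ) * l) by omega)
    simp only [mul_add] at h4
    omega
  · intro p
    have : 0 < z ^ (finProdFinEquiv p : ℕ) := Nat.pow_pos hz0
    simp only [W]; omega
  · intro s hs t ht hst
    let F : (u : Fin m × Fin n → ℕ) → (∀ p, u p < z) → Fin d → Fin z := fun u hu k =>
      ⟨u (finProdFinEquiv.symm k), hu _⟩
    have key : ∀ (u : Fin m × Fin n → ℕ) (hu : ∀ p, u p < z),
        Ws W u % z ^ d = (finFunctionFinEquiv (F u hu) : ℕ) := by
      intro u hu
      have h1 : Ws W u = (finFunctionFinEquiv (F u hu) : ℕ) +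
        z ^ d * ∑ p, u p * (3 * ((p.1 : ℕ) * p.2)) := by
        rw [finFunctionFinEquiv_apply, ← (finProdFinEquiv (m := m) (n := n)).sum_comp, Finset.mul_sum,
          ← Finset.sum_add_distrib, Ws]
        refine Finset.sum_congr rfl fun p _ => ?_
        simp only [W, F, Equiv.symm_apply_apply]
        ring
      rw [h1, Nat.add_mul_mod_self_left, Nat.mod_eq_of_lt (finFunctionFinEquiv (F u hu)).2]
    have h2 : finFunctionFinEquiv (F s (hz s hs)) = finFunctionFinEquiv (F t (hz t ht)) := by
      apply Fin.ext
      rw [← key, ← key, hst]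
    have h3 := finFunctionFinEquiv.injective h2
    ext p
    have := congrArg Fin.val (congrFun h3 (finProdFinEquiv p))
    simpa [F] using this

/-- the finite set of bounded exponents not dominating `s0` -/
def badSet (s0 : Fin m × Fin n → ℕ) (w : ℕ) : Finset (Fin m × Fin n → ℕ) :=
  Finset.univ.biUnion fun p => Fintype.piFinset fun r => Finset.range (if r = p then s0 p else w)

lemma badSet_card (s0 : Fin m × Fin n → ℕ) (w : ℕ) :
    (badSet s0 w).card ≤ (∑ p, s0 p) * w ^ (m * n - 1) := by
  refine Finset.card_biUnion_le.trans ?_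
  rw [Finset.sum_mul]
  refine Finset.sum_le_sum fun p _ => ?_
  rw [Fintype.card_piFinset, ← Finset.mul_prod_erase _ _ (Finset.mem_univ p)]
  simp only [Finset.card_range, if_true]
  rw [Finset.prod_congr rfl (g := fun _ => w) (fun r hr => if_neg (Finset.ne_of_mem_erase hr)),
    Finset.prod_const, Finset.card_erase_of_mem (Finset.mem_univ p)]
  simp

lemma mem_badSet {s0 s : Fin m × Fin n → ℕ} {w : ℕ} {W : Fin m × Fin n → ℕ} (hW : ∀ p, 1 ≤ W p)
    (h : Ws W s < w) (h0 : ¬ s0 ≤ s) : s ∈ badSet s0 w := by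
  rw [Pi.le_def] at h0
  push Not at h0
  obtain ⟨p, hp⟩ := h0
  simp only [badSet, Finset.mem_biUnion, Finset.mem_univ, true_and, Fintype.mem_piFinset, Finset.mem_range]
  refine ⟨p, fun r => ?_⟩
  split_ifs with h1
  · rw [h1]; exact hp
  · have h2 : s r * W r ≤ Ws W s :=
      Finset.single_le_sum (f := fun r => s r * W r) (fun _ _ => Nat.zero_le _) (Finset.mem_univ r)
    have h3 := Nat.le_mul_of_pos_right (s r) (hW r)
    omega

/-- Injectivity by counting dimensions. -/
theorem inj_of_growth {q : K} (hq : q ≠ 0) (hm : 0 < m) (hn : 0 < n) {x : Fin m → Fin n → A} (hx : IsQM q x)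
    (H : ∀ W : Fin m × Fin n → ℕ, ∃ D : ℕ, ∀ e : ℕ, ∃ v : (Fin m × Fin n → Fin (e + 1)) → A,
      LinearIndependent K v ∧ ∀ f, v f ∈ Vlt K x W (D * e + 1)) : Function.Injective (qlift hx) := by
  classical
  obtain ⟨can, hc, -⟩ := pbw hq m n
  rw [injective_iff_map_eq_zero]
  intro z hz
  have hz1 : z ∈ Submodule.span K (Set.range fun s => wd (fun i j => X K q (m := m) (n := n) i j) (can s)) := by
    rw [span_can_X hq hc]; trivial
  rw [Finsupp.mem_span_range_iff_exists_finsupp] at hz1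
  obtain ⟨c, rfl⟩ := hz1
  by_contra hne
  have hc0 : c.support.Nonempty := by
    rw [Finsupp.support_nonempty_iff]; rintro rfl; simp at hne
  have hrel : ∑ s ∈ c.support, c s • wd x (can s) = 0 := by
    rw [← hz, Finsupp.sum, map_sum]
    refine Finset.sum_congr rfl fun s _ => ?_
    rw [map_smul, wd_map]; simp [qlift_X]
  obtain ⟨W, hSM, hW1, hinj⟩ := exists_W c.support
  obtain ⟨s0, hs0, hmax⟩ := c.support.exists_max_image (Ws W) hc0
  have hlow : wd x (can s0) ∈ Vlt K x W (Ws W s0) := by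
    rw [← Finset.add_sum_erase _ _ hs0, add_comm, add_eq_zero_iff_neg_eq] at hrel
    have h1 : c s0 • wd x (can s0) ∈ Vlt K x W (Ws W s0) := by
      rw [← hrel]
      refine neg_mem (Submodule.sum_mem _ fun s hs => Submodule.smul_mem _ _ (wd_mem_Vlt ?_))
      rw [IsCan.Wl hc]
      rw [Finset.mem_erase] at hs
      exact lt_of_le_of_ne (hmax s hs.2) fun h => hs.1 (hinj hs.2 hs0 h)
    have h2 := Submodule.smul_mem _ (c s0)⁻¹ h1
    rwa [smul_smul, inv_mul_cancel₀ (by simpa using hs0), one_smul] at h2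
  have hspan : ∀ w, Vlt K x W w ≤ Submodule.span K
      (((badSet s0 w).image fun s => wd x (can s) : Finset A) : Set A) := by
    intro w
    refine (Vlt_le_span hq hx hSM hc (fun s => s0 ≤ s) ?_ w).trans (Submodule.span_mono ?_)
    · intro s hs
      refine ⟨can s0 ++ can (s - s0), fun p => ?_, ?_⟩
      · rw [List.count_append, hc, hc]
        have h5 : s0 p ≤ s p := hs p
        simp only [Pi.sub_apply]; omega
      · rw [wd_append]
        refine Vlt_mul_wd hlow _ _ ?_
        rw [IsCan.Wl hc, ← Ws_add, add_tsub_cancel_of_le hs]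
    · rintro _ ⟨s, h1, h2, rfl⟩
      rw [Finset.coe_image]
      exact ⟨s, mem_badSet hW1 h1 h2, rfl⟩
  obtain ⟨D, hD⟩ := H W
  have hcard : ∀ e, (e + 1) ^ (m * n) ≤ (∑ p, s0 p) * (D * e + 1) ^ (m * n - 1) := by
    intro e
    obtain ⟨v, hv, hvm⟩ := hD e
    have h1 := linearIndependent_le_span_aux' v hv
      (((badSet s0 (D * e + 1)).image fun s => wd x (can s) : Finset A) : Set A) (by
        rintro _ ⟨f, rfl⟩
        exact hspan _ (hvm f))
    rw [Fintype.card_fun, Fintype.card_fin, Fintype.card_prod, Fintype.card_fin, Fintype.card_fin] at h1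
    refine h1.trans (le_trans ?_ (badSet_card s0 (D * e + 1)))
    simp only [Finset.coe_sort_coe, Fintype.card_coe]
    exact Finset.card_image_le
  obtain ⟨k, hk⟩ : ∃ k, m * n = k + 1 := ⟨m * n - 1, by have := Nat.mul_pos hm hn; omega⟩
  rw [hk] at hcard
  simp only [Nat.add_sub_cancel] at hcard
  set C := ∑ p, s0 p
  set e := C * (D + 1) ^ k
  have h1 := hcard e
  have h2 : (D * e + 1) ^ k ≤ ((D + 1) * (e + 1)) ^ k := Nat.pow_le_pow_left (by nlinarith) k
  have h3 : (e + 1) ^ (k + 1) ≤ e * (e + 1) ^ k := by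
    calc _ ≤ C * (D * e + 1) ^ k := h1
      _ ≤ C * ((D + 1) * (e + 1)) ^ k := Nat.mul_le_mul_left _ h2
      _ = e * (e + 1) ^ k := by rw [mul_pow, ← mul_assoc]
  rw [pow_succ, mul_comm] at h3
  have h4 := Nat.le_of_mul_le_mul_right h3 (Nat.pow_pos (Nat.succ_pos e))
  omega

end cnt

section homog
variable {m n : ℕ}

/-- elements of the form `r y^t` with `r` of bounded degree -/
def Hg (K : Type*) [Field K] {A : Type*} [Ring A] [Algebra K A] {n : ℕ}
    (E : Finset (Fin n) → A) (M : Finset (Fin n)) (y : Aˣ) (m t : ℕ) (a : A) : Prop :=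
  ∃ r ∈ Usp K E M y ^ (m * t), a = r * (y : A) ^ t

variable {E : Finset (Fin n) → A} {M : Finset (Fin n)} {y : Aˣ} {q : K}

lemma Usp_pow_mono {a b : ℕ} (h : a ≤ b) : Usp K E M y ^ a ≤ Usp K E M y ^ b := by
  induction h with
  | refl => exact le_rfl
  | step h ih =>
    refine ih.trans fun r hr => ?_
    rw [pow_succ]
    have h1 : (1 : A) ∈ Usp K E M y := (Submodule.one_le.1 (le_sup_left : _ ≤ Usp K E M y))
    simpa using Submodule.mul_mem_mul hr h1

lemma IsPl.conj_U_pow' (hq : q ≠ 0) (h : IsPl q E) (hy : (y : A) = E M) (d t : ℕ) {r : A}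
    (hr : r ∈ Usp K E M y ^ d) :
    ∃ r' ∈ Usp K E M y ^ d, (y : A) ^ t * r = r' * (y : A) ^ t := by
  induction t with
  | zero => exact ⟨r, hr, by simp⟩
  | succ t ih =>
    obtain ⟨r', h1, h2⟩ := ih
    refine ⟨conjH K y r', h.conj_U_pow hq hy d h1, ?_⟩
    rw [pow_succ', mul_assoc, h2, ← mul_assoc, ← conjH_mul_y (K := K), mul_assoc]

lemma Hg.one : Hg K E M y m 0 1 := ⟨1, by rw [mul_zero, pow_zero]; exact Submodule.one_le.1 le_rfl, by simp⟩

lemma Hg.mul (hq : q ≠ 0) (h : IsPl q E) (hy : (y : A) = E M) {s t : ℕ} {a b : A}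
    (ha : Hg K E M y m s a) (hb : Hg K E M y m t b) : Hg K E M y m (s + t) (a * b) := by
  obtain ⟨r, hr, rfl⟩ := ha
  obtain ⟨r', hr', rfl⟩ := hb
  obtain ⟨r'', h1, h2⟩ := h.conj_U_pow' hq hy _ s hr'
  refine ⟨r * r'', ?_, ?_⟩
  · rw [mul_add, pow_add]; exact Submodule.mul_mem_mul hr h1
  · rw [mul_assoc, ← mul_assoc _ r', h2, pow_add]; simp only [mul_assoc]

lemma Hg.pow (hq : q ≠ 0) (h : IsPl q E) (hy : (y : A) = E M) {s : ℕ} {a : A}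
    (ha : Hg K E M y m s a) (k : ℕ) : Hg K E M y m (k * s) (a ^ k) := by
  induction k with
  | zero => simpa using Hg.one
  | succ k ih => rw [pow_succ, add_mul, one_mul]; exact ih.mul hq h hy ha

lemma Hg.list (hq : q ≠ 0) (h : IsPl q E) (hy : (y : A) = E M) {ι : Type*} (L : List ι) (a : ι → A)
    (d : ι → ℕ) (H : ∀ i, Hg K E M y m (d i) (a i)) : Hg K E M y m (L.map d).sum (L.map a).prod := by
  induction L with
  | nil => simpa using Hg.one
  | cons i L ih => simpa using (H i).mul hq h hy ih

lemma Hg.minor (hq : q ≠ 0) (h : IsPl q E) (hy : (y : A) = E M) (hM : M.card = m) {I : Finset (Fin n)}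
    (hI : I.card = m) : Hg K E M y m 1 (E I) := by
  obtain ⟨r, hr, e⟩ := h.expand hq hy _ I rfl (hI.trans hM.symm)
  refine ⟨r, Usp_pow_mono ?_ hr, by simpa using e⟩
  rw [mul_one, ← hI]; exact Finset.card_le_card Finset.sdiff_subset

lemma Usp_pow_le (hn : 0 < n) (α : ℕ) (hmn : m < n) (W : Fin m × Fin (n - m) → ℕ) (d : ℕ) :
    Usp K E (consecSet hn m α) y ^ d ≤
      Vlt K (fun i j => xb E (consecSet hn m α) y (bI hn α i) (cJ hn α m j)) W (d * (∑ p, W p) + 1) := by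
  have h1 : Usp K E (consecSet hn m α) y ≤
      Vlt K (fun i j => xb E (consecSet hn m α) y (bI hn α i) (cJ hn α m j)) W ((∑ p, W p) + 1) := by
    refine sup_le ?_ (Submodule.span_le.2 ?_)
    · rw [Submodule.one_le]
      exact wd_mem_Vlt (l := []) (by simp [Wl])
    · rintro _ ⟨b, hb, c, hc, rfl⟩
      obtain ⟨i, rfl⟩ := exists_bI hn α hmn hb
      obtain ⟨j, rfl⟩ := exists_cJ hn α hmn hc
      have := wd_mem_Vlt (K := K) (x := (fun i j => xb E (consecSet hn m α) y (bI hn α i) (cJ hn α m j)))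
        (W := W) (l := [(i, j)]) (w := (∑ p, W p) + 1) (by
          have := Finset.single_le_sum (f := W) (fun _ _ => Nat.zero_le _) (Finset.mem_univ (i, j))
          simp [Wl]; omega)
      simpa [wd] using this
  induction d with
  | zero =>
    rw [pow_zero, Submodule.one_le]
    exact wd_mem_Vlt (l := []) (by simp [Wl])
  | succ d ih =>
    rw [pow_succ, Submodule.mul_le]
    intro a ha b hb
    exact Vlt_mul_Vlt (ih ha) (h1 hb) (by ring_nf; omega)

lemma indep_restrict {R : Type*} [Ring R] [Algebra K R] (S : Subalgebra K R) {ι : Type*}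
    (G : (ι → ℕ) → S)
    (hG : LinearIndependent K G) (e : ℕ) (φ : S →ₐ[K] A) (hφ : Function.Injective φ) (u : Aˣ) :
    LinearIndependent K (fun f : ι → Fin e => φ (G fun p => (f p : ℕ)) * (u : A)) := by
  have h1 : LinearIndependent K (fun f : ι → Fin e => G fun p => (f p : ℕ)) :=
    hG.comp (fun (f : ι → Fin e) p => (f p : ℕ)) (fun f g h => by ext p; exact congrFun h p)
  exact h1.map_injOn ((LinearMap.mulRight K (u : A)).comp φ.toLinearMap)
    (fun a _ b _ hab => hφ ((Units.mul_left_inj u).1 hab))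

theorem phi_inj (hq : q ≠ 0) (hn : 0 < n) (hm : 0 < m) (hmn : m < n) (α : ℕ)
    (ψ : ↥(qGrass K q m n) →ₐ[K] A) (hψ : Function.Injective ψ)
    (hy : (y : A) = ψ (grE K q m (consecSet hn m α))) :
    Function.Injective (qlift (isQM_xb hn α hq ((isPl_grE hq m n).map ψ) hmn (y := y) hy)) := by
  classical
  have hpl := (isPl_grE hq m n).map ψ
  refine inj_of_growth hq hm (by omega) _ fun W => ⟨m * (m * (n - m)) * ∑ p, W p, fun e => ?_⟩
  set T := m * (n - m) * e
  refine ⟨fun f => ψ (gf K q hmn T fun p => (f p : ℕ)) * (((y ^ T)⁻¹ : Aˣ) : A), ?_, fun f => ?_⟩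
  · exact indep_restrict (qGrass K q m n) (gf K q hmn T) (gf_indep hq hmn T) (e + 1) ψ hψ ((y ^ T)⁻¹)
  · have hT : ∑ p, (f p : ℕ) ≤ T := by
      calc _ ≤ ∑ p : Fin m × Fin (n - m), e := Finset.sum_le_sum fun p _ => by omega
        _ = T := by simp [T]
    have hM := card_consecSet (α := α) hn hmn
    have hcard : ∀ J : Fin m → Fin n, StrictMono J → (Finset.univ.image J).card = m := fun J hJ => by
      rw [Finset.card_image_of_injective _ hJ.injective]; simp
    have h1 := Hg.list hq hpl hy (Finset.univ.toList : List (Fin m × Fin (n - m)))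
      (fun p => ψ (grE K q m (Finset.univ.image (rJ hmn p))) ^ (f p : ℕ)) (fun p => (f p : ℕ) * 1)
      (fun p => (Hg.minor hq hpl hy hM (hcard _ (rJ_mono hmn p))).pow hq hpl hy _)
    have h2 := h1.mul hq hpl hy ((Hg.minor hq hpl hy hM (hcard _ (bJ_mono hmn))).pow hq hpl hy (T - ∑ p, (f p : ℕ)))
    simp only [mul_one] at h2
    rw [Finset.sum_map_toList, Nat.add_sub_cancel' hT] at h2
    obtain ⟨r, hr, e1⟩ := h2
    have e2 : ψ (gf K q hmn T fun p => (f p : ℕ)) = r * (y : A) ^ T := by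
      rw [← e1]; simp [gf, map_list_prod, Function.comp_def]
    beta_reduce
    rw [e2, ← Units.val_pow_eq_pow_val, Units.mul_inv_cancel_right]
    have h3 := Usp_pow_le hn α hmn W _ hr
    refine Vlt_mono (le_of_eq ?_) h3
    simp only [T]; ring

end homog
end QG


open scoped BigOperators
namespace QG
variable {K : Type*} [Field K] {A : Type*} [Ring A] [Algebra K A]

section grade
variable {m n : ℕ}

lemma isQM_deg (q : K) (m n : ℕ) : IsQM q (fun (i : Fin m) (j : Fin n) =>
    (Polynomial.monomial 1 (X K q i j) : Polynomial (QMat K q m n))) where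
  row i j l h := by
    rw [Polynomial.monomial_mul_monomial, Polynomial.monomial_mul_monomial, Polynomial.smul_monomial,
      (isQM_X q m n).row i j l h]
  col i k j h := by
    rw [Polynomial.monomial_mul_monomial, Polynomial.monomial_mul_monomial, Polynomial.smul_monomial,
      (isQM_X q m n).col i k j h]
  comm i k j l h h' := by
    rw [Polynomial.monomial_mul_monomial, Polynomial.monomial_mul_monomial,
      (isQM_X q m n).comm i k j l h h']
  qrel i k j l h h' := by
    rw [Polynomial.monomial_mul_monomial, Polynomial.monomial_mul_monomial,
      Polynomial.monomial_mul_monomial, Polynomial.smul_monomial,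
      ← (isQM_X q m n).qrel i k j l h h']
    exact (map_sub (Polynomial.monomial (R := QMat K q m n) (1 + 1)) _ _).symm

/-- The degree homomorphism. -/
noncomputable def degH (q : K) (m n : ℕ) : QMat K q m n →ₐ[K] Polynomial (QMat K q m n) :=
  qlift (isQM_deg q m n)

/-- homogeneous elements of degree `d` -/
def Hd (q : K) (m n : ℕ) (d : ℕ) (a : QMat K q m n) : Prop :=
  degH q m n a = Polynomial.monomial d a

variable {q : K}

lemma Hd.one : Hd q m n 0 1 := by
  rw [Hd, map_one]; rfl

lemma Hd.mul {d e : ℕ} {a b : QMat K q m n} (ha : Hd q m n d a) (hb : Hd q m n e b) :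
    Hd q m n (d + e) (a * b) := by
  rw [Hd] at *
  rw [map_mul, ha, hb, Polynomial.monomial_mul_monomial]

lemma Hd.pow {d : ℕ} {a : QMat K q m n} (ha : Hd q m n d a) (k : ℕ) : Hd q m n (d * k) (a ^ k) := by
  induction k with
  | zero => simpa using Hd.one
  | succ k ih => rw [pow_succ, mul_add, mul_one]; exact ih.mul ha

lemma Hd.add {d : ℕ} {a b : QMat K q m n} (ha : Hd q m n d a) (hb : Hd q m n d b) :
    Hd q m n d (a + b) := by
  rw [Hd] at *
  rw [map_add, ha, hb, map_add]

lemma Hd.zero {d : ℕ} : Hd q m n d 0 := by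
  rw [Hd]; simp

lemma Hd.smul {d : ℕ} {a : QMat K q m n} (c : K) (ha : Hd q m n d a) :
    Hd q m n d (c • a) := by
  rw [Hd] at *
  rw [map_smul, ha, Polynomial.smul_monomial]

lemma Hd.sum {ι : Type*} {d : ℕ} (s : Finset ι) (a : ι → QMat K q m n) (ha : ∀ i ∈ s, Hd q m n d (a i)) :
    Hd q m n d (∑ i ∈ s, a i) :=
  Finset.sum_induction _ _ (fun _ _ h h' => h.add h') Hd.zero ha

lemma Hd.X (i : Fin m) (j : Fin n) : Hd q m n 1 (X K q i j) := by
  rw [Hd, degH, qlift_X]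

lemma Hd.list (l : List (QMat K q m n)) (h : ∀ a ∈ l, Hd q m n 1 a) : Hd q m n l.length l.prod := by
  induction l with
  | nil => simpa using Hd.one
  | cons a l ih =>
    rw [List.prod_cons, List.length_cons, add_comm]
    exact (h a (by simp)).mul (ih fun b hb => h b (by simp [hb]))

lemma Hd.minor (J : Finset (Fin n)) : Hd q m n m (grMinor K q m J) := by
  rw [grMinor]
  split_ifs with h
  · rw [qMinor]
    refine Hd.sum _ _ fun σ _ => Hd.smul _ ?_
    have := Hd.list (List.ofFn fun k => QG.X K q (σ k) (J.orderEmbOfFin h k)) (by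
      intro a ha
      rw [List.mem_ofFn] at ha
      obtain ⟨k, rfl⟩ := ha
      exact Hd.X _ _)
    simpa using this
  · exact Hd.zero

lemma Hd.indep {ι : Type*} (s : Finset ι) (d : ι → ℕ) (hd : Set.InjOn d s) (a : ι → QMat K q m n)
    (ha : ∀ i ∈ s, Hd q m n (d i) (a i)) (h0 : ∑ i ∈ s, a i = 0) : ∀ i ∈ s, a i = 0 := by
  classical
  intro i hi
  have h1 := congrArg (degH q m n) h0
  rw [map_sum, map_zero, Finset.sum_congr rfl ha] at h1
  have h2 := congrArg (fun p => Polynomial.coeff p (d i)) h1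
  simp only [Polynomial.finset_sum_coeff, Polynomial.coeff_monomial, Polynomial.coeff_zero] at h2
  rw [Finset.sum_eq_single i] at h2
  · simpa using h2
  · intro j hj hji
    rw [if_neg]
    exact fun h => hji (hd hj hi h)
  · exact fun h => absurd hi h

variable {y : Aˣ}

lemma Usp_hom (hq : q ≠ 0) (M : Finset (Fin n))
    (ψ : ↥(qGrass K q m n) →ₐ[K] A) (hy : (y : A) = ψ (grE K q m M)) (d : ℕ) :
    ∀ r ∈ Usp K (fun J => ψ (grE K q m J)) M y ^ d,
      ∃ a : ↥(qGrass K q m n), Hd q m n (m * d) a ∧ r * (y : A) ^ d = ψ a := by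
  have hpl := (isPl_grE hq m n).map ψ
  have h1 : ∀ r ∈ Usp K (fun J => ψ (grE K q m J)) M y,
      ∃ a : ↥(qGrass K q m n), Hd q m n m a ∧ r * (y : A) = ψ a := by
    intro r hr
    obtain ⟨c, hc, z, hz, rfl⟩ := Submodule.mem_sup.1 hr
    clear hr
    obtain ⟨c, rfl⟩ := Submodule.mem_one.1 hc
    have h2 : ∃ a : ↥(qGrass K q m n), Hd q m n m a ∧ z * (y : A) = ψ a := by
      induction hz using Submodule.span_induction with
      | mem z hz =>
        obtain ⟨b, hb, c, hc, rfl⟩ := hz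
        exact ⟨grE K q m (Jb M b c), Hd.minor _, by simp [xb]⟩
      | zero => exact ⟨0, Hd.zero, by simp⟩
      | add x z _ _ hx hz =>
        obtain ⟨a, ha, e⟩ := hx
        obtain ⟨b, hb, e'⟩ := hz
        exact ⟨a + b, ha.add hb, by rw [add_mul, e, e', map_add]⟩
      | smul k x _ hx =>
        obtain ⟨a, ha, e⟩ := hx
        exact ⟨k • a, ha.smul k, by rw [smul_mul_assoc, e, map_smul]⟩
    obtain ⟨a, ha, e⟩ := h2
    refine ⟨c • grE K q m M + a, ((Hd.minor M).smul c).add ha, ?_⟩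
    rw [add_mul, e, map_add, map_smul, ← hy, Algebra.smul_def]
  induction d with
  | zero =>
    intro r hr
    rw [pow_zero] at hr
    obtain ⟨c, rfl⟩ := Submodule.mem_one.1 hr
    refine ⟨algebraMap K _ c, ?_, by simp⟩
    have := (Hd.one (q := q) (m := m) (n := n)).smul c
    rw [mul_zero]
    convert this using 1
    rw [← Algebra.algebraMap_eq_smul_one]; rfl
  | succ d ih =>
    intro r hr
    rw [pow_succ'] at hr
    induction hr using Submodule.mul_induction_on' with
    | mem_mul_mem u hu v hv =>
      obtain ⟨a, ha, e⟩ := h1 u hu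
      obtain ⟨b, hb, e'⟩ := ih _ (hpl.conj_inv_U_pow hq hy d hv)
      refine ⟨a * b, ?_, ?_⟩
      · have := ha.mul hb
        rw [mul_add, mul_one, add_comm]; exact this
      · rw [map_mul, ← e, ← e', conjH_apply, pow_succ']
        simp [mul_assoc]
    | add x _ z _ hx hz =>
      obtain ⟨a, ha, e⟩ := hx
      obtain ⟨b, hb, e'⟩ := hz
      exact ⟨a + b, ha.add hb, by rw [add_mul, e, e', map_add]⟩

end grade

section alg
variable {m n : ℕ} {E : Finset (Fin n) → A} {y : Aˣ} {q : K}

/-- the subalgebra generated by dehomogenised generators -/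
noncomputable def Rg (K : Type*) [Field K] {A : Type*} [Ring A] [Algebra K A] {m n : ℕ} (hn : 0 < n) (α : ℕ)
    (E : Finset (Fin n) → A) (y : Aˣ) : Subalgebra K A :=
  Algebra.adjoin K (Set.range fun p : Fin m × Fin (n - m) =>
    xb E (consecSet hn m α) y (bI hn α p.1) (cJ hn α m p.2))

lemma Usp_le_Rg (hn : 0 < n) (α : ℕ) (hmn : m < n) (d : ℕ) :
    Usp K E (consecSet hn m α) y ^ d ≤ Subalgebra.toSubmodule (Rg K (m := m) hn α E y) := by
  have h1 : Usp K E (consecSet hn m α) y ≤ Subalgebra.toSubmodule (Rg K (m := m) hn α E y) := by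
    refine sup_le ?_ (Submodule.span_le.2 ?_)
    · rw [Submodule.one_le]; exact one_mem (Rg K (m := m) hn α E y)
    · rintro _ ⟨b, hb, c, hc, rfl⟩
      obtain ⟨i, rfl⟩ := exists_bI hn α hmn hb
      obtain ⟨j, rfl⟩ := exists_cJ hn α hmn hc
      exact Algebra.subset_adjoin ⟨(i, j), rfl⟩
  induction d with
  | zero => rw [pow_zero, Submodule.one_le]; exact one_mem (Rg K (m := m) hn α E y)
  | succ d ih =>
    rw [pow_succ, Submodule.mul_le]
    intro a ha b hb
    exact mul_mem (S := Subalgebra K A) (ih ha) (h1 hb)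

lemma Rg_le_Usp (hn : 0 < n) (α : ℕ) (hmn : m < n) {r : A} (hr : r ∈ Rg K (m := m) hn α E y) :
    ∃ d, r ∈ Usp K E (consecSet hn m α) y ^ d := by
  induction hr using Algebra.adjoin_induction with
  | mem x hx =>
    obtain ⟨p, rfl⟩ := hx
    refine ⟨1, ?_⟩
    rw [pow_one]
    exact Submodule.mem_sup_right (Submodule.subset_span ⟨_, bI_mem hn α hmn _, _, cJ_notMem hn α hmn _, rfl⟩)
  | algebraMap c => exact ⟨0, by rw [pow_zero]; exact Submodule.mem_one.2 ⟨c, rfl⟩⟩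
  | add a b _ _ ha hb =>
    obtain ⟨d, hd⟩ := ha
    obtain ⟨e, he⟩ := hb
    exact ⟨d + e, Submodule.add_mem _ (Usp_pow_mono (by omega) hd) (Usp_pow_mono (by omega) he)⟩
  | mul a b _ _ ha hb =>
    obtain ⟨d, hd⟩ := ha
    obtain ⟨e, he⟩ := hb
    exact ⟨d + e, by rw [pow_add]; exact Submodule.mul_mem_mul hd he⟩

lemma conj_Rg (hq : q ≠ 0) (hn : 0 < n) (α : ℕ) (hmn : m < n) (h : IsPl q E)
    (hy : (y : A) = E (consecSet hn m α)) {r : A} (hr : r ∈ Rg K (m := m) hn α E y) :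
    conjH K y r ∈ Rg K (m := m) hn α E y := by
  obtain ⟨d, hd⟩ := Rg_le_Usp hn α hmn hr
  exact Usp_le_Rg hn α hmn d (h.conj_U_pow hq hy d hd)

lemma conj_inv_Rg (hq : q ≠ 0) (hn : 0 < n) (α : ℕ) (hmn : m < n) (h : IsPl q E)
    (hy : (y : A) = E (consecSet hn m α)) {r : A} (hr : r ∈ Rg K (m := m) hn α E y) :
    conjH K y⁻¹ r ∈ Rg K (m := m) hn α E y := by
  obtain ⟨d, hd⟩ := Rg_le_Usp hn α hmn hr
  exact Usp_le_Rg hn α hmn d (h.conj_inv_U_pow hq hy d hd)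

/-- evaluation of Laurent expressions -/
noncomputable def lev (R : Subalgebra K A) (y : Aˣ) : (ℤ →₀ ↥R) →+ A :=
  Finsupp.liftAddHom fun k =>
    ((AddMonoidHom.mulRight ((y ^ k : Aˣ) : A)).comp (R.val : ↥R →+* A).toAddMonoidHom)

lemma lev_apply (R : Subalgebra K A) (y : Aˣ) (f : ℤ →₀ ↥R) :
    lev R y f = f.sum fun k r => (r : A) * ((y ^ k : Aˣ) : A) := rfl

lemma lev_single (R : Subalgebra K A) (y : Aˣ) (k : ℤ) (r : ↥R) :
    lev R y (Finsupp.single k r) = (r : A) * ((y ^ k : Aˣ) : A) := by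
  rw [lev_apply, Finsupp.sum_single_index]; simp

theorem lev_inj (hq : q ≠ 0) (hn : 0 < n) (hm : 0 < m) (hmn : m < n) (α : ℕ)
    (ψ : ↥(qGrass K q m n) →ₐ[K] A) (hψ : Function.Injective ψ)
    (hy : (y : A) = ψ (grE K q m (consecSet hn m α))) :
    Function.Injective (lev (Rg K (m := m) hn α (fun J => ψ (grE K q m J)) y) y) := by
  classical
  rw [injective_iff_map_eq_zero]
  intro f hf
  choose D hD using fun k => Rg_le_Usp hn α hmn (f k).2
  set T : ℤ := ∑ k ∈ f.support, (D k + |k|)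
  have hT : ∀ k ∈ f.support, (D k : ℤ) + |k| ≤ T := fun k hk =>
    Finset.single_le_sum (f := fun k : ℤ => (D k : ℤ) + |k|) (fun i _ => by positivity) hk
  have hT' : ∀ k ∈ f.support, (D k : ℤ) ≤ k + T := fun k hk => by
    have := hT k hk
    have := neg_abs_le k
    omega
  have key : ∀ k, ∃ a : ↥(qGrass K q m n), k ∈ f.support →
      Hd q m n (m * (k + T).toNat) a ∧ ((f k : A) * ((y ^ k : Aˣ) : A)) * ((y ^ T : Aˣ) : A) = ψ a := by
    intro k
    by_cases hk : k ∈ f.support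
    · have hk' := hT' k hk
      obtain ⟨a, ha, e⟩ := Usp_hom hq _ ψ hy (k + T).toNat _
        (Usp_pow_mono (by omega) (hD k))
      refine ⟨a, fun _ => ⟨ha, ?_⟩⟩
      rw [← e, mul_assoc, ← Units.val_mul, ← zpow_add, ← Units.val_pow_eq_pow_val, ← zpow_natCast,
        Int.toNat_of_nonneg (by omega)]
    · exact ⟨0, fun h => absurd h hk⟩
  choose a ha using key
  have h0 : ψ (∑ k ∈ f.support, a k) = 0 := by
    rw [map_sum, ← Finset.sum_congr rfl fun k hk => (ha k hk).2, ← Finset.sum_mul]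
    have : ∑ k ∈ f.support, (f k : A) * ((y ^ k : Aˣ) : A) = 0 := hf
    rw [this, zero_mul]
  have h1 : ∑ k ∈ f.support, (a k : QMat K q m n) = 0 := by
    have := hψ (h0.trans (map_zero ψ).symm)
    have := congrArg Subtype.val this
    simpa using this
  have h2 := Hd.indep f.support (fun k => m * (k + T).toNat) (by
    intro k hk l hl e
    have hk' := hT' k hk
    have hl' := hT' l hl
    have := Nat.eq_of_mul_eq_mul_left hm e
    omega) (fun k => (a k : QMat K q m n)) (fun k hk => (ha k hk).1) h1
  ext k
  by_cases hk : k ∈ f.support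
  · have h3 := (ha k hk).2
    have h4 : a k = 0 := Subtype.ext (h2 k hk)
    rw [h4, map_zero, mul_assoc, ← Units.val_mul, Units.mul_left_eq_zero] at h3
    rw [h3]; rfl
  · rw [Finsupp.notMem_support_iff.1 hk]; rfl

theorem lev_surj (hq : q ≠ 0) (hn : 0 < n) (hmn : m < n) (α : ℕ)
    (ψ : ↥(qGrass K q m n) →ₐ[K] A)
    (hy : (y : A) = ψ (grE K q m (consecSet hn m α)))
    (hs : ∀ b : A, ∃ (a : ↥(qGrass K q m n)) (k : ℕ), b = ψ a * ((y⁻¹ ^ k : Aˣ) : A)) :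
    Function.Surjective (lev (Rg K (m := m) hn α (fun J => ψ (grE K q m J)) y) y) := by
  have hpl := (isPl_grE hq m n).map ψ
  set E := fun J => ψ (grE K q m J) with hE
  set M := consecSet hn m α
  set Q := Submodule.span K {b | ∃ t, Hg K E M y m t b}
  have hQQ : Q * Q ≤ Q := by
    rw [Submodule.span_mul_span]
    refine Submodule.span_mono ?_
    rintro _ ⟨a, ⟨s, ha⟩, b, ⟨t, hb⟩, rfl⟩
    exact ⟨s + t, ha.mul hq hpl hy hb⟩
  have hQ1 : (1 : A) ∈ Q := Submodule.subset_span ⟨0, Hg.one⟩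
  have hM := card_consecSet (α := α) hn hmn
  have hQ : ∀ a (ha : a ∈ Algebra.adjoin K (grGenSet K q m n)), ψ ⟨a, ha⟩ ∈ Q := by
    intro a ha
    induction ha using Algebra.adjoin_induction with
    | mem x hx =>
      obtain ⟨J, rfl⟩ := hx
      by_cases hJ : J.card = m
      · exact Submodule.subset_span ⟨1, Hg.minor hq hpl hy hM hJ⟩
      · have : (⟨grMinor K q m J, Algebra.subset_adjoin ⟨J, rfl⟩⟩ : ↥(qGrass K q m n)) = 0 := by
          apply Subtype.ext; simp [grMinor, hJ]
        change ψ (⟨grMinor K q m J, Algebra.subset_adjoin ⟨J, rfl⟩⟩ : ↥(qGrass K q m n)) ∈ Q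
        rw [this, map_zero]; exact Submodule.zero_mem _
    | algebraMap c =>
      change ψ (algebraMap K ↥(qGrass K q m n) c) ∈ Q
      rw [AlgHom.commutes, Algebra.algebraMap_eq_smul_one]
      exact Submodule.smul_mem _ _ hQ1
    | add a b ha' hb' ha hb =>
      change ψ ((⟨a, ha'⟩ : ↥(qGrass K q m n)) + ⟨b, hb'⟩) ∈ Q
      rw [map_add]; exact Submodule.add_mem _ ha hb
    | mul a b ha' hb' ha hb =>
      change ψ ((⟨a, ha'⟩ : ↥(qGrass K q m n)) * ⟨b, hb'⟩) ∈ Q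
      rw [map_mul]; exact hQQ (Submodule.mul_mem_mul ha hb)
  intro b
  obtain ⟨a, k, rfl⟩ := hs b
  have h1 := hQ a.1 a.2
  change ψ a ∈ Q at h1
  change ψ a * _ ∈ Set.range (lev (Rg K (m := m) hn α E y) y)
  generalize ψ a = z at h1
  induction h1 using Submodule.span_induction with
  | mem z hz =>
    obtain ⟨t, r, hr, rfl⟩ := hz
    refine ⟨Finsupp.single ((t : ℤ) - k) ⟨r, Usp_le_Rg hn α hmn _ hr⟩, ?_⟩
    rw [lev_single, mul_assoc, ← Units.val_pow_eq_pow_val, ← Units.val_mul]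
    congr 2
    rw [zpow_sub, inv_pow, zpow_natCast, zpow_natCast]
  | zero => exact ⟨0, by simp⟩
  | add u v _ _ hu hv =>
    obtain ⟨f, hf⟩ := hu
    obtain ⟨g, hg⟩ := hv
    exact ⟨f + g, by rw [map_add, hf, hg, add_mul]⟩
  | smul c u _ hu =>
    obtain ⟨f, hf⟩ := hu
    refine ⟨c • f, ?_⟩
    rw [smul_mul_assoc, ← hf, lev_apply, lev_apply, Finsupp.sum_smul_index', Finsupp.smul_sum]
    · simp
    · simp

end alg
end QG

namespace QG

/-- The main theorem for an arbitrary name of the family of generators. -/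
theorem dehom_aux
    {K : Type*} [Field K] {q : K} (hq : q ≠ 0) {m n : ℕ} (hm : 0 < m) (hmn : m < n) (hn : 0 < n)
    (α : ℕ) {B : Type*} [Ring B] [Algebra K B]
    (L : NormalLoc K (↥(qGrass K q m n)) B (grE K q m (consecSet hn m α)))
    (x : Fin m → Fin (n - m) → B)
    (hx : x = fun i j => xb (fun J => L.emb (grE K q m J)) (consecSet hn m α) L.isUnit.unit
      (bI hn α i) (cJ hn α m j)) :
    (∃ iso : QMat K q m (n - m) ≃ₐ[K]
        ↥(Algebra.adjoin K (Set.range fun pr : Fin m × Fin (n - m) => x pr.1 pr.2)),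
      ∀ (i : Fin m) (j : Fin (n - m)), (iso (X K q i j) : B) = x i j) ∧
    (∃ σ : ↥(Algebra.adjoin K (Set.range fun pr : Fin m × Fin (n - m) => x pr.1 pr.2)) ≃ₐ[K]
          ↥(Algebra.adjoin K (Set.range fun pr : Fin m × Fin (n - m) => x pr.1 pr.2)),
      (∀ (i : Fin m) (j : Fin (n - m)),
        (σ ⟨x i j, Algebra.subset_adjoin (Set.mem_range_self (i, j))⟩ : B) *
          L.emb (grE K q m (consecSet hn m α)) = L.emb (grE K q m (consecSet hn m α)) * x i j) ∧
      (∀ r : ↥(Algebra.adjoin K (Set.range fun pr : Fin m × Fin (n - m) => x pr.1 pr.2)),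
        (L.isUnit.unit : B) * r = (σ r : B) * (L.isUnit.unit : B)) ∧
      IsSkewLaurent K (Algebra.adjoin K (Set.range fun pr : Fin m × Fin (n - m) => x pr.1 pr.2))
        L.isUnit.unit) := by
  subst hx
  have hy : ((L.isUnit.unit : Bˣ) : B) = L.emb (grE K q m (consecSet hn m α)) := IsUnit.unit_spec _
  have hpl := (isPl_grE hq m n).map L.emb
  have hinj := phi_inj hq hn hm hmn α L.emb L.inj hy
  have hpX := fun i j => qlift_X (isQM_xb hn α hq hpl hmn (y := L.isUnit.unit) hy) i j
  set φ := qlift (isQM_xb hn α hq hpl hmn (y := L.isUnit.unit) hy) with hφ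
  have hrange : φ.range = Algebra.adjoin K (Set.range fun pr : Fin m × Fin (n - m) =>
      xb (fun J => L.emb (grE K q m J)) (consecSet hn m α) L.isUnit.unit
        (bI hn α pr.1) (cJ hn α m pr.2)) := by
    rw [← Algebra.map_top, ← adjoin_X, AlgHom.map_adjoin, ← Set.range_comp]
    congr 2
    funext p
    exact hpX p.1 p.2
  have hlinj := lev_inj hq hn hm hmn α L.emb L.inj hy
  have hlsurj := lev_surj hq hn hmn α L.emb hy L.surj
  refine ⟨⟨(AlgEquiv.ofInjective φ hinj).trans (Subalgebra.equivOfEq _ _ hrange), fun i j => ?_⟩, ?_⟩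
  · exact hpX i j
  · refine ⟨AlgEquiv.ofAlgHom
      (((conjH K L.isUnit.unit).comp (Subalgebra.val _)).codRestrict _
        fun r => conj_Rg hq hn α hmn hpl hy r.2)
      (((conjH K L.isUnit.unit⁻¹).comp (Subalgebra.val _)).codRestrict _
        fun r => conj_inv_Rg hq hn α hmn hpl hy r.2) ?_ ?_, ?_, ?_, ?_, ?_⟩
    · ext r
      exact conj_conj_inv (K := K) _ _
    · ext r
      exact conj_inv_conj (K := K) _ _
    · intro i j
      have h := conjH_mul_y (K := K) L.isUnit.unit (xb (fun J => L.emb (grE K q m J))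
        (consecSet hn m α) L.isUnit.unit (bI hn α i) (cJ hn α m j))
      have h2 : ∀ u v z : B, u = v → z * u = u * xb (fun J => L.emb (grE K q m J))
        (consecSet hn m α) L.isUnit.unit (bI hn α i) (cJ hn α m j) →
          z * v = v * xb (fun J => L.emb (grE K q m J))
        (consecSet hn m α) L.isUnit.unit (bI hn α i) (cJ hn α m j) := by
        rintro u _ z rfl h
        exact h
      exact h2 _ _ _ hy h
    · intro r
      exact (conjH_mul_y (K := K) _ _).symm
    · intro r hr
      exact conj_Rg hq hn α hmn hpl hy hr
    · intro b
      obtain ⟨f, hf⟩ := hlsurj b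
      exact ⟨f, hf.symm, fun g hg => hlinj (hg.symm.trans hf.symm)⟩

end QG
namespace QG

/-- (Noncommutative dehomogenisation at a consecutive minor.)
Let `M_α` be a consecutive quantum minor of `O_q(G(m,n))` and let `B` be the
localisation of `O_q(G(m,n))` at the powers of `M_α`, with
`x_{ij} = [M_α ∪ {~(j+α+m−1)} ∖ {~(α+m−i)}]·M_α^{-1}`.  Then (1) the subalgebra
generated by the `x_{ij}` is isomorphic to the quantum matrix algebra
`O_q(M_{m,n−m})` via `x_{ij} ↦ X_{ij}`, and (2) `B` is a skew-Laurent extension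
`K[x_{ij}][y_α^{±1}; σ_α]`, where `y_α` is the image of `M_α` and `σ_α` is the
automorphism of `K[x_{ij}]` determined by `σ_α(x_{ij})·M_α = M_α·x_{ij}`. -/
theorem dehomogenisation_at_consecutive_minor
    (K : Type*) [Field K] (q : K) (hq : q ≠ 0) (m n : ℕ) (hm : 0 < m) (hmn : m < n)
    (α : ℕ) (B : Type*) [Ring B] [Algebra K B]
    (L : NormalLoc K (↥(qGrass K q m n)) B
      (grE K q m (consecSet (show 0 < n by omega) m α))) :
    (∃ iso : QMat K q m (n - m) ≃ₐ[K]
        ↥(Algebra.adjoin K (Set.range fun pr : Fin m × Fin (n - m) =>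
            xElt K q m n (show 0 < n by omega) α L pr.1 pr.2)),
      ∀ (i : Fin m) (j : Fin (n - m)),
        (iso (X K q i j) : B) = xElt K q m n (show 0 < n by omega) α L i j) ∧
    (∃ σ : ↥(Algebra.adjoin K (Set.range fun pr : Fin m × Fin (n - m) =>
            xElt K q m n (show 0 < n by omega) α L pr.1 pr.2)) ≃ₐ[K]
          ↥(Algebra.adjoin K (Set.range fun pr : Fin m × Fin (n - m) =>
            xElt K q m n (show 0 < n by omega) α L pr.1 pr.2)),
      (∀ (i : Fin m) (j : Fin (n - m)),
        (σ ⟨xElt K q m n (show 0 < n by omega) α L i j,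
            Algebra.subset_adjoin (Set.mem_range_self (i, j))⟩ : B) *
          L.emb (grE K q m (consecSet (show 0 < n by omega) m α)) =
        L.emb (grE K q m (consecSet (show 0 < n by omega) m α)) *
          xElt K q m n (show 0 < n by omega) α L i j) ∧
      (∀ r : ↥(Algebra.adjoin K (Set.range fun pr : Fin m × Fin (n - m) =>
            xElt K q m n (show 0 < n by omega) α L pr.1 pr.2)),
        (L.isUnit.unit : B) * r = (σ r : B) * (L.isUnit.unit : B)) ∧
      IsSkewLaurent K (Algebra.adjoin K (Set.range fun pr : Fin m × Fin (n - m) =>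
          xElt K q m n (show 0 < n by omega) α L pr.1 pr.2)) L.isUnit.unit) := by
  have hn : 0 < n := by omega
  refine dehom_aux hq hm hmn hn α L (fun i j => xElt K q m n hn α L i j) ?_
  funext i j
  rw [xElt, JxSet_eq, xb]

end QG
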